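/- arXiv:2206.08820 — 2 statements merged into one kernel-verified Lean document; each statement's English description precedes it below -/
import Mathlib

section
/- Under the standing assumptions on a and q, let c : (0,∞) → [0,∞) be a function such that N_A(c_b) < ∞ for every b > 0, c_b/b → 0 as b → ∞, Φ_b := (1 + c_b²)·N_A(c_b)/b → 0 as b → ∞, and either sup_{b>0} c_b < ∞ or (1 + c_b²)^{1/2}·N_A(c_b) → ∞ as b → ∞. Then there exist constants C > 0 and b₀ > 0 such that for every b ≥ b₀, setting λ_b = −c_b + i·b: (i) for every Schwartz function u : ℝ → ℂ one has 2b·(1 − C·Φ_b)·‖u‖ ≤ N_A(c_b)·‖T(λ_b)u‖; and (ii) for every real M with M < N_A(c_b) there exists a nonzero Schwartz function u : ℝ → ℂ with M·‖T(λ_b)u‖ ≤ 2b·(1 + C·Φ_b)·‖u‖. (Together these say ‖T(λ_b)^{-1}‖ = N_A(c_b)·(2b)^{-1}·(1 + O(Φ_b)) as b → ∞.) -/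
open MeasureTheory Filter
open scoped ENNReal

/-- The quadratic operator family `T(λ)u = -u'' + q·u + 2λ·a·u + λ²·u`. -/
noncomputable def Tq (a q : ℝ → ℝ) (lam : ℂ) (u : ℝ → ℂ) : ℝ → ℂ :=
  fun x => -deriv (deriv u) x + (q x : ℂ) * u x + 2 * lam * (a x : ℂ) * u x + lam ^ 2 * u x

/-- Standing assumptions on the damping `a` and the potential `q`. -/
structure Standing (a q : ℝ → ℝ) : Prop where
  smooth_a : ContDiff ℝ (⊤ : ℕ∞) a
  smooth_q : ContDiff ℝ (⊤ : ℕ∞) q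
  nonneg_a : ∀ x, 0 ≤ a x
  nonneg_q : ∀ x, 0 ≤ q x
  unbounded_a : Tendsto a (cocompact ℝ) atTop
  deriv_a : ∀ n : ℕ, 1 ≤ n → ∃ C : ℝ, 0 < C ∧ ∀ x : ℝ,
      |iteratedDeriv n a x| ≤ C * (1 + a x) * (1 + x ^ 2) ^ (-(n : ℝ) / 2)
  deriv_q : ∀ n : ℕ, 1 ≤ n → ∃ C : ℝ, 0 < C ∧ ∀ x : ℝ,
      |iteratedDeriv n q x| ≤ C * (1 + q x) * (1 + x ^ 2) ^ (-(n : ℝ) / 2)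
  q_le_a : ∃ K₀ : ℝ, 0 < K₀ ∧ ∃ x₀ : ℝ, 0 < x₀ ∧ ∀ x : ℝ, x₀ < |x| → q x ≤ K₀ * a x

/-- The norm of the resolvent `(A - c)⁻¹` of the generalised Airy operator
`A = -d/dx + a`, as the supremum of `‖u‖ / ‖-u' + a·u - c·u‖` over nonzero
Schwartz functions, valued in `[0,∞]`. -/
noncomputable def NA (a : ℝ → ℝ) (c : ℝ) : ℝ≥0∞ :=
  ⨆ (u : SchwartzMap ℝ ℂ) (_ : u ≠ 0),
    eLpNorm (⇑u) 2 volume /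
      eLpNorm (fun x => -deriv (⇑u) x + (a x : ℂ) * u x - (c : ℂ) * u x) 2 volume

/-- The quantity `Φ_b = (1 + c_b²)·‖(A − c_b)⁻¹‖ / b`. -/
noncomputable def Phi (a : ℝ → ℝ) (c : ℝ → ℝ) (b : ℝ) : ℝ :=
  (1 + c b ^ 2) * (NA a (c b)).toReal / b

lemma temp_deriv {F : Type*} [NormedAddCommGroup F] [NormedSpace ℝ F] {f : ℝ → F}
    (hf : f.HasTemperateGrowth) : (deriv f).HasTemperateGrowth := by
  refine ⟨(contDiff_infty_iff_deriv.1 hf.1).2, fun n => ?_⟩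
  obtain ⟨k, C, h⟩ := hf.2 (n + 1)
  refine ⟨k, C, fun x => ?_⟩
  have := h x
  rwa [norm_iteratedFDeriv_eq_norm_iteratedDeriv, iteratedDeriv_succ',
    ← norm_iteratedFDeriv_eq_norm_iteratedDeriv] at this

lemma temp_exp (κ : ℝ) : (fun x : ℝ => Complex.exp (Complex.I * κ * x)).HasTemperateGrowth := by
  have hd : ∀ x : ℝ, HasDerivAt (fun x : ℝ => Complex.exp (Complex.I * κ * x))
      (Complex.I * κ * Complex.exp (Complex.I * κ * x)) x := by
    intro x
    have h1 : HasDerivAt (fun x : ℝ => Complex.I * κ * (x : ℂ)) (Complex.I * κ * 1) x :=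
      (HasDerivAt.ofReal_comp (hasDerivAt_id x)).const_mul _
    have := h1.cexp
    convert this using 1
    ring
  have hi : ∀ n : ℕ, iteratedDeriv n (fun x : ℝ => Complex.exp (Complex.I * κ * x))
      = fun x : ℝ => (Complex.I * κ) ^ n * Complex.exp (Complex.I * κ * x) := by
    intro n
    induction n with
    | zero => simp
    | succ n ih =>
      rw [iteratedDeriv_succ, ih]
      funext x
      rw [((hd x).const_mul _).deriv]
      ring
  refine ⟨?_, fun n => ⟨0, |κ| ^ n, fun x => ?_⟩⟩
  · exact (contDiff_const.mul Complex.ofRealCLM.contDiff).cexp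
  · rw [norm_iteratedFDeriv_eq_norm_iteratedDeriv, hi]
    have : ‖Complex.exp (Complex.I * κ * x)‖ = 1 := by
      rw [Complex.norm_exp]; simp
    simp [this]

lemma poly_growth (a : ℝ → ℝ) (ha : ContDiff ℝ (⊤ : ℕ∞) a) (h0 : ∀ x, 0 ≤ a x)
    (h1 : ∃ C : ℝ, 0 < C ∧ ∀ x : ℝ,
      |iteratedDeriv 1 a x| ≤ C * (1 + a x) * (1 + x ^ 2) ^ (-((1 : ℕ) : ℝ) / 2)) :
    ∃ (k : ℕ) (C : ℝ), 0 ≤ C ∧ ∀ x, 1 + a x ≤ C * (1 + ‖x‖) ^ k := by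
  obtain ⟨C, hC, h⟩ := h1
  have hdiff : Differentiable ℝ a := (contDiff_infty_iff_deriv.1 ha).1
  have hbd : ∀ x, |deriv a x / (1 + a x)| ≤ C * (√(1 + x ^ 2))⁻¹ := by
    intro x
    have hx := h x
    rw [iteratedDeriv_one] at hx
    have hp : 0 < 1 + a x := by linarith [h0 x]
    rw [abs_div, abs_of_pos hp, div_le_iff₀ hp]
    have e : (1 + x ^ 2) ^ (-((1 : ℕ) : ℝ) / 2) = (√(1 + x ^ 2))⁻¹ := by
      rw [Real.sqrt_eq_rpow, ← Real.rpow_neg (by positivity)]; norm_num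
    rw [e] at hx
    linarith
  have hl : ∀ x, HasDerivAt (fun x => Real.log (1 + a x)) (deriv a x / (1 + a x)) x := by
    intro x
    have := ((hdiff x).hasDerivAt.const_add 1).log (by linarith [h0 x])
    exact this
  have hs : ∀ x, HasDerivAt (fun x => C * Real.arsinh x) (C * (√(1 + x ^ 2))⁻¹) x :=
    fun x => (Real.hasDerivAt_arsinh x).const_mul C
  have m1 : Monotone (fun x => C * Real.arsinh x - Real.log (1 + a x)) := by
    apply monotone_of_deriv_nonneg
    · exact fun x => ((hs x).sub (hl x)).differentiableAt
    · intro x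
      have := ((hs x).sub (hl x)).deriv
      have h2 := (abs_le.1 (hbd x)).2
      erw [this]; linarith
  have m2 : Monotone (fun x => C * Real.arsinh x + Real.log (1 + a x)) := by
    apply monotone_of_deriv_nonneg
    · exact fun x => ((hs x).add (hl x)).differentiableAt
    · intro x
      have := ((hs x).add (hl x)).deriv
      have h2 := (abs_le.1 (hbd x)).1
      erw [this]; linarith
  have key : ∀ x, Real.log (1 + a x) ≤ Real.log (1 + a 0) + C * Real.arsinh |x| := by
    intro x
    rcases le_total 0 x with hx | hx
    · have := m1 hx
      simp only [Real.arsinh_zero] at this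
      rw [abs_of_nonneg hx]; linarith
    · have := m2 hx
      simp only [Real.arsinh_zero] at this
      rw [abs_of_nonpos hx, Real.arsinh_neg]; linarith
  refine ⟨⌈C⌉₊, (1 + a 0) * 2 ^ ⌈C⌉₊, by have := h0 0; positivity, fun x => ?_⟩
  have hp : 0 < 1 + a x := by linarith [h0 x]
  have hp0 : 0 < 1 + a 0 := by linarith [h0 0]
  have hk : C * Real.arsinh |x| ≤ ⌈C⌉₊ * Real.arsinh |x| := by
    apply mul_le_mul_of_nonneg_right (Nat.le_ceil C)
    rw [Real.arsinh_nonneg_iff]; positivity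
  calc 1 + a x = Real.exp (Real.log (1 + a x)) := (Real.exp_log hp).symm
    _ ≤ Real.exp (Real.log (1 + a 0) + ⌈C⌉₊ * Real.arsinh |x|) := by
        apply Real.exp_le_exp.2; linarith [key x]
    _ = (1 + a 0) * (|x| + √(1 + |x| ^ 2)) ^ ⌈C⌉₊ := by
        rw [Real.exp_add, Real.exp_log hp0, Real.exp_nat_mul, Real.exp_arsinh]
    _ ≤ (1 + a 0) * (2 * (1 + |x|)) ^ ⌈C⌉₊ := by
        gcongr
        have : √(1 + |x| ^ 2) ≤ 1 + |x| := by
          apply Real.sqrt_le_iff.2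
          constructor
          · positivity
          · nlinarith [abs_nonneg x]
        linarith
    _ = _ := by rw [mul_pow, Real.norm_eq_abs]; ring

lemma temp_of_symbol (a : ℝ → ℝ) (ha : ContDiff ℝ (⊤ : ℕ∞) a) (h0 : ∀ x, 0 ≤ a x)
    (h1 : ∀ n : ℕ, 1 ≤ n → ∃ C : ℝ, 0 < C ∧ ∀ x : ℝ,
      |iteratedDeriv n a x| ≤ C * (1 + a x) * (1 + x ^ 2) ^ (-(n : ℝ) / 2)) :
    a.HasTemperateGrowth := by
  obtain ⟨k, C, hC0, hC⟩ := poly_growth a ha h0 (h1 1 le_rfl)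
  refine ⟨ha, fun n => ?_⟩
  rcases Nat.eq_zero_or_pos n with rfl | hn
  · refine ⟨k, C, fun x => ?_⟩
    rw [norm_iteratedFDeriv_zero, Real.norm_eq_abs, abs_of_nonneg (h0 x)]
    linarith [hC x]
  · obtain ⟨B, hB, hb⟩ := h1 n hn
    refine ⟨k, B * C, fun x => ?_⟩
    rw [norm_iteratedFDeriv_eq_norm_iteratedDeriv, Real.norm_eq_abs]
    have e : (1 + x ^ 2) ^ (-(n : ℝ) / 2) ≤ 1 := by
      apply Real.rpow_le_one_of_one_le_of_nonpos
      · nlinarith [sq_nonneg x]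
      · have : (0 : ℝ) ≤ n := by positivity
        linarith
    have hp : 0 ≤ B * (1 + a x) := by have := h0 x; positivity
    calc _ ≤ B * (1 + a x) * (1 + x ^ 2) ^ (-(n : ℝ) / 2) := hb x
      _ ≤ B * (1 + a x) * 1 := by gcongr
      _ ≤ _ := by rw [mul_one, mul_assoc]; gcongr; exact hC x

lemma deriv_bound (a : ℝ → ℝ) (h0 : ∀ x, 0 ≤ a x) (n : ℕ)
    (h1 : ∃ C : ℝ, 0 < C ∧ ∀ x : ℝ,
      |iteratedDeriv n a x| ≤ C * (1 + a x) * (1 + x ^ 2) ^ (-(n : ℝ) / 2)) :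
    ∃ C : ℝ, 0 < C ∧ ∀ x, |iteratedDeriv n a x| ≤ C * (1 + a x) := by
  obtain ⟨B, hB, hb⟩ := h1
  refine ⟨B, hB, fun x => ?_⟩
  have e : (1 + x ^ 2) ^ (-(n : ℝ) / 2) ≤ 1 := by
    apply Real.rpow_le_one_of_one_le_of_nonpos
    · nlinarith [sq_nonneg x]
    · have : (0 : ℝ) ≤ n := by positivity
      linarith
  have hp : 0 ≤ B * (1 + a x) := by have := h0 x; positivity
  calc _ ≤ B * (1 + a x) * (1 + x ^ 2) ^ (-(n : ℝ) / 2) := hb x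
    _ ≤ B * (1 + a x) * 1 := by gcongr
    _ = _ := by ring

lemma ode_compare (w W : ℝ → ℝ) (φ ψ : ℝ → ℂ) (k : ℕ) (M δ x1 x2 : ℝ) (h12 : x1 ≤ x2)
    (hM : 0 ≤ M)
    (hW : ∀ x, HasDerivAt W (w x) x)
    (hφ : ∀ x, HasDerivAt φ (ψ x - w x * φ x) x)
    (hψ : ∀ x, ‖ψ x‖ ≤ M * Real.exp (-(k * Real.log (1 + x ^ 2))))
    (hw : ∀ x ∈ Set.Icc x1 x2, 1 ≤ w x)
    (hx : ∀ x ∈ Set.Icc x1 x2, k * (2 * x / (1 + x ^ 2)) ≤ 1 / 2)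
    (h1 : ‖Real.exp (W x1) * φ x1‖ ≤
      2 * M * Real.exp (W x1 - k * Real.log (1 + x1 ^ 2)) + δ) :
    ‖Real.exp (W x2) * φ x2‖ ≤
      2 * M * Real.exp (W x2 - k * Real.log (1 + x2 ^ 2)) + δ := by
  have hG : ∀ x, HasDerivAt (fun x => (Real.exp (W x) : ℂ) * φ x) (Real.exp (W x) * ψ x) x := by
    intro x
    have h2 := ((hW x).exp.ofReal_comp).mul (hφ x)
    refine h2.congr_deriv ?_
    push_cast; ring
  have hB : ∀ x, HasDerivAt (fun x => 2 * M * Real.exp (W x - k * Real.log (1 + x ^ 2)) + δ)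
      (2 * M * (Real.exp (W x - k * Real.log (1 + x ^ 2)) *
        (w x - k * (2 * x / (1 + x ^ 2))))) x := by
    intro x
    have h3 : HasDerivAt (fun x : ℝ => 1 + x ^ 2) (2 * x) x := by
      have := (hasDerivAt_pow 2 x).const_add 1
      refine this.congr_deriv ?_
      push_cast; ring
    have h4 := (((hW x).sub ((h3.log (by positivity)).const_mul (k : ℝ))).exp.const_mul
      (2 * M)).add_const δ
    exact h4
  refine image_norm_le_of_norm_deriv_right_le_deriv_boundary
    (f := fun x => (Real.exp (W x) : ℂ) * φ x) (f' := fun x => Real.exp (W x) * ψ x)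
    (a := x1) (b := x2) ?_ ?_ h1 hB ?_ (Set.right_mem_Icc.2 h12)
  · exact fun x _ => (hG x).continuousAt.continuousWithinAt
  · exact fun x _ => (hG x).hasDerivWithinAt
  · intro x hxx
    have hxx' := Set.Ico_subset_Icc_self hxx
    have a1 := hw x hxx'
    have a2 := hx x hxx'
    rw [norm_mul, Complex.norm_real, Real.norm_eq_abs, abs_of_pos (Real.exp_pos _),
      sub_eq_add_neg (W x), Real.exp_add]
    have := hψ x
    have e1 := Real.exp_pos (W x)
    have e2 := Real.exp_pos (-(k * Real.log (1 + x ^ 2)))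
    have e3 : 0 ≤ M * Real.exp (W x) * Real.exp (-(k * Real.log (1 + x ^ 2))) := by positivity
    have : Real.exp (W x) * ‖ψ x‖ ≤ Real.exp (W x) * (M * Real.exp (-(k * Real.log (1 + x ^ 2)))) := by
      gcongr
    nlinarith

lemma ode_decay (w W : ℝ → ℝ) (φ ψ : ℝ → ℂ) (R : ℝ)
    (hW : ∀ x, HasDerivAt W (w x) x)
    (hφ : ∀ x, HasDerivAt φ (ψ x - w x * φ x) x)
    (hψ : ∀ k : ℕ, ∃ M, 0 ≤ M ∧ ∀ x, ‖ψ x‖ ≤ M * Real.exp (-(k * Real.log (1 + x ^ 2))))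
    (hw : ∀ x, R ≤ |x| → 1 ≤ w x)
    (hlim : Tendsto (fun x => ‖(Real.exp (W x) : ℂ) * φ x‖) atBot (nhds 0)) (k : ℕ) :
    ∃ C, ∀ x, ‖φ x‖ ≤ C * Real.exp (-(k * Real.log (1 + x ^ 2))) := by
  obtain ⟨M, hM, hMψ⟩ := hψ k
  set R' := max (max R (4 * k)) 1 with hR'
  have hR1 : R ≤ R' := (le_max_left _ _).trans (le_max_left _ _)
  have hR2 : 4 * k ≤ R' := (le_max_right _ _).trans (le_max_left _ _)
  have hR3 : 1 ≤ R' := le_max_right _ _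
  have hcont : Continuous φ := continuous_iff_continuousAt.2 fun x => (hφ x).continuousAt
  have fin : ∀ (x M δ : ℝ), ‖(Real.exp (W x) : ℂ) * φ x‖ ≤
      2 * M * Real.exp (W x - k * Real.log (1 + x ^ 2)) →
      ‖φ x‖ ≤ 2 * M * Real.exp (-(k * Real.log (1 + x ^ 2))) := by
    intro x M δ h
    rw [norm_mul, Complex.norm_real, Real.norm_eq_abs, abs_of_pos (Real.exp_pos _),
      sub_eq_add_neg (W x), Real.exp_add] at h
    have e1 := Real.exp_pos (W x)
    refine le_of_mul_le_mul_left ?_ e1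
    linarith
  -- left
  have left : ∀ x, x ≤ -R' → ‖φ x‖ ≤ 2 * M * Real.exp (-(k * Real.log (1 + x ^ 2))) := by
    intro x hx
    apply fin x M 0
    have : ∀ᶠ x1 in atBot, ‖(Real.exp (W x) : ℂ) * φ x‖ ≤
      2 * M * Real.exp (W x - k * Real.log (1 + x ^ 2)) + ‖(Real.exp (W x1) : ℂ) * φ x1‖ := by
      filter_upwards [eventually_le_atBot x] with x1 hx1
      apply ode_compare w W φ ψ k M _ x1 x hx1 hM hW hφ hMψ
      · intro t ht
        apply hw
        rw [abs_of_nonpos (by linarith [ht.2])]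
        linarith [ht.2]
      · intro t ht
        have : 2 * t / (1 + t ^ 2) ≤ 0 :=
          div_nonpos_of_nonpos_of_nonneg (by linarith [ht.2]) (by positivity)
        have : (k : ℝ) * (2 * t / (1 + t ^ 2)) ≤ 0 := mul_nonpos_of_nonneg_of_nonpos (by positivity) this
        linarith
      · have : 0 ≤ 2 * M * Real.exp (W x1 - k * Real.log (1 + x1 ^ 2)) := by positivity
        linarith
    have h2 := ge_of_tendsto (hlim.const_add _) this
    simpa using h2
  obtain ⟨M2, hM2⟩ : ∃ M2, M2 * Real.exp (-(k * Real.log (1 + R' ^ 2))) = ‖φ R'‖ := by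
    refine ⟨‖φ R'‖ / Real.exp (-(k * Real.log (1 + R' ^ 2))), ?_⟩
    rw [div_mul_cancel₀]; exact (Real.exp_pos _).ne'
  have right : ∀ x, R' ≤ x → ‖φ x‖ ≤ 2 * (max M M2) * Real.exp (-(k * Real.log (1 + x ^ 2))) := by
    intro x hx
    apply fin x _ 0
    have hm : 0 ≤ max M M2 := le_max_of_le_left hM
    have := ode_compare w W φ ψ k (max M M2) 0 R' x hx hm hW hφ ?_ ?_ ?_ ?_
    · simpa using this
    · intro t
      exact (hMψ t).trans (by gcongr; exact le_max_left _ _)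
    · intro t ht
      apply hw
      rw [abs_of_nonneg (by linarith [ht.1])]
      linarith [ht.1]
    · intro t ht
      have ht1 := ht.1
      rw [mul_div_assoc', div_le_iff₀ (by positivity)]
      have : 0 < t := by linarith
      nlinarith
    · rw [norm_mul, Complex.norm_real, Real.norm_eq_abs, abs_of_pos (Real.exp_pos _),
        sub_eq_add_neg (W R'), Real.exp_add, ← hM2]
      have e1 := Real.exp_pos (W R')
      have e2 := Real.exp_pos (-(k * Real.log (1 + R' ^ 2)))
      have : M2 ≤ 2 * max M M2 := by
        have := le_max_right M M2
        linarith
      calc _ = M2 * (Real.exp (W R') * Real.exp (-(k * Real.log (1 + R' ^ 2)))) := by ring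
        _ ≤ _ := by rw [add_zero]; gcongr
  -- middle
  obtain ⟨C, hC⟩ := (isCompact_Icc (a := -R') (b := R')).exists_bound_of_continuousOn
    (f := fun x => φ x * Real.exp (k * Real.log (1 + x ^ 2))) (by
      refine Continuous.continuousOn ?_
      refine hcont.mul (Complex.continuous_ofReal.comp (Real.continuous_exp.comp
        (continuous_const.mul (Continuous.log (by fun_prop) ?_))))
      intro x; positivity)
  refine ⟨max C (2 * max M M2), fun x => ?_⟩
  have e2 := Real.exp_pos (-(k * Real.log (1 + x ^ 2)))
  rcases le_total x (-R') with h | h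
  · refine (left x h).trans ?_
    gcongr
    exact (by gcongr; exact le_max_left _ _ : 2 * M ≤ 2 * max M M2).trans (le_max_right _ _)
  rcases le_total R' x with h' | h'
  · refine (right x h').trans ?_
    gcongr
    exact le_max_right _ _
  · have := hC x ⟨h, h'⟩
    rw [norm_mul, Complex.norm_real, Real.norm_eq_abs, abs_of_pos (Real.exp_pos _)] at this
    have h5 : ‖φ x‖ ≤ C * Real.exp (-(k * Real.log (1 + x ^ 2))) := by
      rw [Real.exp_neg, ← div_eq_mul_inv, le_div_iff₀ (Real.exp_pos _)]
      exact this
    refine h5.trans ?_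
    gcongr
    exact le_max_left _ _

lemma exp_log_pow (k : ℕ) (x : ℝ) : Real.exp (-(k * Real.log (1 + x ^ 2))) = ((1 + x ^ 2) ^ k)⁻¹ := by
  rw [Real.exp_neg, Real.exp_nat_mul, Real.exp_log (by positivity)]

lemma one_add_abs_pow (k : ℕ) (x : ℝ) : (1 + ‖x‖) ^ k ≤ 2 ^ k * (1 + x ^ 2) ^ k := by
  rw [← mul_pow]
  gcongr
  rw [Real.norm_eq_abs, ← sq_abs]
  nlinarith [sq_nonneg (|x| - 1), abs_nonneg x]

lemma schwartz_decay' (ψ : SchwartzMap ℝ ℂ) (k : ℕ) :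
    ∃ M, 0 ≤ M ∧ ∀ x, ‖ψ x‖ ≤ M * Real.exp (-(k * Real.log (1 + x ^ 2))) := by
  obtain ⟨C, hC⟩ : ∃ C, ∀ x, (1 + x ^ 2) ^ k * ‖ψ x‖ ≤ C := by
    refine ⟨2 ^ (2 * k) * ((Finset.Iic (2 * k, 0)).sup (fun m => SchwartzMap.seminorm ℝ m.1 m.2)) ψ, fun x => ?_⟩
    have := SchwartzMap.one_add_le_sup_seminorm_apply (𝕜 := ℝ) (m := (2 * k, 0)) (k := 2 * k) (n := 0)
      le_rfl le_rfl ψ x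
    simp only [norm_iteratedFDeriv_zero] at this
    refine le_trans ?_ this
    rw [pow_mul]
    gcongr
    rw [Real.norm_eq_abs, ← sq_abs]
    nlinarith [abs_nonneg x]
  refine ⟨max C 0, le_max_right _ _, fun x => ?_⟩
  rw [exp_log_pow, ← div_eq_mul_inv, le_div_iff₀ (by positivity)]
  have := hC x
  rw [mul_comm]
  exact this.trans (le_max_left _ _)

lemma temp_ofReal {w : ℝ → ℝ} (hw : w.HasTemperateGrowth) :
    (fun x => (w x : ℂ)).HasTemperateGrowth := by
  have h : (fun x : ℝ => (x : ℂ)).HasTemperateGrowth := Complex.ofRealCLM.hasTemperateGrowth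
  exact h.comp hw

lemma ode_schwartz (w : ℝ → ℝ) (hw : w.HasTemperateGrowth) (φ : ℝ → ℂ) (ψ : SchwartzMap ℝ ℂ)
    (hφ : ∀ x, HasDerivAt φ (ψ x - w x * φ x) x)
    (hdec : ∀ k : ℕ, ∃ C, ∀ x, ‖φ x‖ ≤ C * Real.exp (-(k * Real.log (1 + x ^ 2)))) :
    ∃ f : SchwartzMap ℝ ℂ, ⇑f = φ := by
  have hd : deriv φ = fun x => ψ x - w x * φ x := funext fun x => (hφ x).deriv
  have hdiff : Differentiable ℝ φ := fun x => (hφ x).differentiableAt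
  have hwc := temp_ofReal hw
  have hsm : ContDiff ℝ (⊤ : ℕ∞) φ := by
    rw [contDiff_infty]
    intro n
    induction n with
    | zero => exact contDiff_zero.2 hdiff.continuous
    | succ n ih =>
      have : ContDiff ℝ ((n : WithTop ℕ∞) + 1) φ := by
        rw [contDiff_succ_iff_deriv]
        refine ⟨hdiff, by simp, ?_⟩
        rw [hd]
        have h1 : ContDiff ℝ (n : WithTop ℕ∞) ψ := ψ.smooth n
        have h2 : ContDiff ℝ (n : WithTop ℕ∞) (fun x => (w x : ℂ)) := hwc.1.of_le (by exact_mod_cast le_top)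
        exact h1.sub (h2.mul ih)
      exact_mod_cast this
  have hit : ∀ n : ℕ, ∃ (P : ℝ → ℂ) (χ : SchwartzMap ℝ ℂ), P.HasTemperateGrowth ∧
      iteratedDeriv n φ = fun x => P x * φ x + χ x := by
    intro n
    induction n with
    | zero => 
      refine ⟨fun _ => 1, 0, Function.HasTemperateGrowth.const 1, ?_⟩
      funext x
      simp
    | succ n ih =>
      obtain ⟨P, χ, hP, h⟩ := ih
      refine ⟨fun x => deriv P x - P x * w x, SchwartzMap.derivCLM ℂ ℂ χ + SchwartzMap.smulLeftCLM ℂ P ψ,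
        (temp_deriv hP).sub (hP.mul hwc), ?_⟩
      rw [iteratedDeriv_succ, h]
      funext x
      have hPd : HasDerivAt P (deriv P x) x := ((hP.1.differentiable (by simp)) x).hasDerivAt
      have := (hPd.mul (hφ x)).add (χ.hasDerivAt x)
      erw [this.deriv]
      simp only [_root_.add_apply, SchwartzMap.derivCLM_apply,
        SchwartzMap.smulLeftCLM_apply_apply hP, smul_eq_mul]
      ring
  refine ⟨⟨φ, hsm, fun k n => ?_⟩, rfl⟩
  obtain ⟨P, χ, hP, h⟩ := hit n
  obtain ⟨l, C, hPl⟩ := hP.2 0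
  obtain ⟨C2, hC2⟩ := hdec (k + l)
  obtain ⟨C3, hC3⟩ := χ.decay k 0
  refine ⟨|C| * |C2| * 2 ^ (k + l) + C3, fun x => ?_⟩
  have h1 := hPl x
  have h2 := hC2 x
  have h3 := hC3.2 x
  rw [norm_iteratedFDeriv_zero] at h1 h3
  rw [norm_iteratedFDeriv_eq_norm_iteratedDeriv, h]
  rw [exp_log_pow] at h2
  have h4 := one_add_abs_pow (k + l) x
  have h5 : (1 + ‖x‖) ^ (k + l) * ‖φ x‖ ≤ |C2| * 2 ^ (k + l) := by
    calc (1 + ‖x‖) ^ (k + l) * ‖φ x‖ 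
        ≤ (2 ^ (k + l) * (1 + x ^ 2) ^ (k + l)) * (|C2| * ((1 + x ^ 2) ^ (k + l))⁻¹) := by
          gcongr
          exact h2.trans (by gcongr; exact le_abs_self _)
      _ = _ := by field_simp
  calc ‖x‖ ^ k * ‖P x * φ x + χ x‖ ≤ ‖x‖ ^ k * (‖P x‖ * ‖φ x‖ + ‖χ x‖) := by
        gcongr
        exact (norm_add_le _ _).trans (by rw [norm_mul])
    _ = ‖x‖ ^ k * ‖P x‖ * ‖φ x‖ + ‖x‖ ^ k * ‖χ x‖ := by ring
    _ ≤ (1 + ‖x‖) ^ k * (|C| * (1 + ‖x‖) ^ l) * ‖φ x‖ + C3 := by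
        gcongr
        · linarith
        · exact h1.trans (by gcongr; exact le_abs_self _)
    _ = |C| * ((1 + ‖x‖) ^ (k + l) * ‖φ x‖) + C3 := by rw [pow_add]; ring
    _ ≤ |C| * (|C2| * 2 ^ (k + l)) + C3 := by gcongr
    _ = _ := by ring

lemma ode_solve (w : ℝ → ℝ) (hw : w.HasTemperateGrowth) (R : ℝ) (hR : ∀ x, R ≤ |x| → 1 ≤ w x)
    (ψ : SchwartzMap ℝ ℂ) : ∃ f : SchwartzMap ℝ ℂ, ∀ x, deriv f x + w x * f x = ψ x := by
  have hwcont : Continuous w := hw.1.continuous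
  set W : ℝ → ℝ := fun x => ∫ t in (0 : ℝ)..x, w t with hWdef
  have hW : ∀ x, HasDerivAt W (w x) x := fun x => hwcont.integral_hasStrictDerivAt 0 x |>.hasDerivAt
  have hWc : Continuous W := continuous_iff_continuousAt.2 fun x => (hW x).continuousAt
  set G : ℝ → ℂ := fun x => Real.exp (W x) * ψ x with hG
  have hGc : Continuous G := by
    exact (Complex.continuous_ofReal.comp (Real.continuous_exp.comp hWc)).mul ψ.continuous
  -- bounded on Iic 0
  obtain ⟨C, hC⟩ : ∃ C, ∀ x ≤ 0, Real.exp (W x) ≤ C := by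
    obtain ⟨C, hC⟩ := (isCompact_Icc (a := -|R|) (b := 0)).exists_bound_of_continuousOn
      (f := fun x => Real.exp (W x)) (Real.continuous_exp.comp hWc).continuousOn
    refine ⟨C, fun x hx => ?_⟩
    have key : ∀ x ∈ Set.Icc (-|R|) 0, Real.exp (W x) ≤ C := fun x hx => 
      (le_abs_self _).trans (hC x hx)
    rcases le_total (-|R|) x with h | h
    · exact key x ⟨h, hx⟩
    · refine le_trans ?_ (key (-|R|) ⟨le_rfl, by simp⟩)
      apply Real.exp_le_exp.2
      have mono : MonotoneOn W (Set.Iic (-|R|)) := by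
        apply monotoneOn_of_deriv_nonneg (convex_Iic _) hWc.continuousOn
        · exact fun x _ => (hW x).differentiableAt.differentiableWithinAt
        · intro t ht
          rw [(hW t).deriv]
          rw [interior_Iic] at ht
          have ht' : t < -|R| := ht
          have : 1 ≤ w t := by
            apply hR
            rw [abs_of_neg (by linarith [abs_nonneg R])]
            linarith [le_abs_self R]
          linarith
      exact mono h (Set.mem_Iic.2 le_rfl) h
  have hGi : IntegrableOn G (Set.Iic 0) := by
    refine Integrable.mono' (g := fun x => C * ‖ψ x‖) (ψ.integrable.norm.const_mul C).integrableOn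
      hGc.aestronglyMeasurable ?_
    refine (ae_restrict_iff' measurableSet_Iic).2 (Eventually.of_forall fun x hx => ?_)
    rw [hG]
    simp only [norm_mul, Complex.norm_real, Real.norm_eq_abs, abs_of_pos (Real.exp_pos _)]
    gcongr
    exact hC x hx
  set F : ℝ → ℂ := fun x => (∫ t in Set.Iic 0, G t) + ∫ t in (0 : ℝ)..x, G t with hF
  have hFd : ∀ x, HasDerivAt F (G x) x := fun x => 
    (hGc.integral_hasStrictDerivAt 0 x |>.hasDerivAt).const_add _
  have hFlim : Tendsto F atBot (nhds 0) := by
    have h1 := intervalIntegral_tendsto_integral_Iic 0 hGi tendsto_id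
    have h2 := h1.neg.const_add (∫ t in Set.Iic 0, G t)
    rw [add_neg_cancel] at h2
    refine h2.congr fun x => ?_
    rw [hF]
    simp only [id]
    rw [intervalIntegral.integral_symm, neg_neg]
  set φ : ℝ → ℂ := fun x => Real.exp (-W x) * F x with hφdef
  have hφ : ∀ x, HasDerivAt φ (ψ x - w x * φ x) x := by
    intro x
    have h2 := ((hW x).neg.exp.ofReal_comp).mul (hFd x)
    refine h2.congr_deriv ?_
    rw [hφdef, hG]
    have : (Real.exp (-W x) : ℂ) * (Real.exp (W x)) = 1 := by
      rw [← Complex.ofReal_mul, ← Real.exp_add]; simp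
    simp only [Pi.neg_apply, Complex.ofReal_mul, Complex.ofReal_neg]
    linear_combination (ψ x) * this
  have hEF : ∀ x, (Real.exp (W x) : ℂ) * φ x = F x := by
    intro x
    have : (Real.exp (-W x) : ℂ) * (Real.exp (W x)) = 1 := by
      rw [← Complex.ofReal_mul, ← Real.exp_add]; simp
    rw [hφdef]
    linear_combination F x * this
  have hdec := ode_decay w W φ ψ R hW hφ (schwartz_decay' ψ) hR (by
    simp only [hEF]
    simpa using hFlim.norm)
  obtain ⟨f, hf⟩ := ode_schwartz w hw φ ψ hφ hdec
  refine ⟨f, fun x => ?_⟩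
  rw [hf, (hφ x).deriv]
  ring

lemma ode_solve_neg (w : ℝ → ℝ) (hw : w.HasTemperateGrowth) (R : ℝ) (hR : ∀ x, R ≤ |x| → 1 ≤ w x)
    (ψ : SchwartzMap ℝ ℂ) : ∃ f : SchwartzMap ℝ ℂ, ∀ x, -deriv f x + w x * f x = ψ x := by
  let e := ContinuousLinearEquiv.neg ℝ (M := ℝ)
  let ψ' : SchwartzMap ℝ ℂ := SchwartzMap.compCLMOfContinuousLinearEquiv ℂ e ψ
  have hw' : (fun x => w (-x)).HasTemperateGrowth := by
    have : (fun x : ℝ => -x).HasTemperateGrowth := by fun_prop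
    exact hw.comp this
  obtain ⟨f, hf⟩ := ode_solve (fun x => w (-x)) hw' R (fun x hx => hR _ (by simpa using hx)) ψ'
  refine ⟨SchwartzMap.compCLMOfContinuousLinearEquiv ℂ e f, fun x => ?_⟩
  have h1 : ⇑(SchwartzMap.compCLMOfContinuousLinearEquiv ℂ e f) = fun x => f (-x) := by
    funext x; simp [e]
  rw [h1, deriv_comp_neg (fun x => f x) x]
  have := hf (-x)
  have h2 : ψ' (-x) = ψ x := by simp [ψ', e]
  rw [h2] at this
  simpa using this

abbrev SS := SchwartzMap ℝ ℂ

noncomputable def nm (u : SS) : ℝ := ‖u.toLp 2 volume‖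

noncomputable def cip (u v : SS) : ℂ := ∫ x, (starRingEnd ℂ) (u x) * v x

noncomputable def rp (u v : SS) : ℝ := (cip u v).re

noncomputable def Dv : SS →L[ℂ] SS := SchwartzMap.derivCLM ℂ ℂ

noncomputable def Ml (p : ℝ → ℝ) : SS →L[ℂ] SS := SchwartzMap.smulLeftCLM ℂ (fun x => (p x : ℂ))

lemma Dv_apply (u : SS) (x : ℝ) : Dv u x = deriv u x := rfl

lemma Ml_apply {p : ℝ → ℝ} (hp : p.HasTemperateGrowth) (u : SS) (x : ℝ) :
    Ml p u x = p x * u x := by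
  rw [Ml, SchwartzMap.smulLeftCLM_apply_apply (temp_ofReal hp), smul_eq_mul]

lemma nm_nonneg (u : SS) : 0 ≤ nm u := norm_nonneg _

lemma eLpNorm_eq (u : SS) : eLpNorm (⇑u) 2 volume = ENNReal.ofReal (nm u) := by
  rw [nm, SchwartzMap.norm_toLp, ENNReal.ofReal_toReal]
  exact (u.eLpNorm_lt_top 2 volume).ne

lemma nm_add_le (u v : SS) : nm (u + v) ≤ nm u + nm v := by
  have : (u + v).toLp 2 volume = u.toLp 2 volume + v.toLp 2 volume := 
    map_add (SchwartzMap.toLpCLM ℂ ℂ 2 volume) u v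
  rw [nm, this]; exact norm_add_le _ _

lemma nm_smul (c : ℂ) (u : SS) : nm (c • u) = ‖c‖ * nm u := by
  have : (c • u).toLp 2 volume = c • u.toLp 2 volume := 
    map_smul (SchwartzMap.toLpCLM ℂ ℂ 2 volume) c u
  rw [nm, this, norm_smul]; rfl

lemma nm_neg (u : SS) : nm (-u) = nm u := by
  have := nm_smul (-1) u
  simpa using this

lemma nm_sub_le (u v : SS) : nm (u - v) ≤ nm u + nm v := by
  rw [sub_eq_add_neg, ← nm_neg v]; exact nm_add_le _ _

lemma nm_eq_zero {u : SS} (h : nm u = 0) : u = 0 := by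
  apply SchwartzMap.injective_toLp 2 volume
  have h0 : (0 : SS).toLp 2 volume = 0 := map_zero (SchwartzMap.toLpCLM ℂ ℂ 2 volume)
  change u.toLp 2 volume = (0 : SS).toLp 2 volume
  rw [h0]
  exact norm_eq_zero.1 h

lemma nm_pos {u : SS} (h : u ≠ 0) : 0 < nm u :=
  lt_of_le_of_ne (nm_nonneg u) fun h' => h (nm_eq_zero h'.symm)

lemma cip_eq (u v : SS) : cip u v = inner ℂ (u.toLp 2 volume) (v.toLp 2 volume) := by
  rw [SchwartzMap.inner_toL2_toL2_eq u v volume, cip]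
  congr 1
  funext x
  simp [mul_comm]

lemma cip_int (u v : SS) : Integrable (fun x => (starRingEnd ℂ) (u x) * v x) := by
  refine Integrable.bdd_mul (c := SchwartzMap.seminorm ℂ 0 0 u) v.integrable ?_ ?_
  · exact (Complex.continuous_conj.comp u.continuous).aestronglyMeasurable
  · refine Eventually.of_forall fun x => ?_
    simpa using u.norm_le_seminorm ℂ x

lemma nm_sq (u : SS) : nm u ^ 2 = rp u u := by
  rw [rp, cip_eq, nm]
  exact norm_sq_eq_re_inner (𝕜 := ℂ) _

lemma rp_abs_le (u v : SS) : |rp u v| ≤ nm u * nm v := by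
  rw [rp, cip_eq]
  exact (Complex.abs_re_le_norm _).trans (norm_inner_le_norm _ _)

lemma rp_le (u v : SS) : rp u v ≤ nm u * nm v := (le_abs_self _).trans (rp_abs_le u v)

lemma rp_ge (u v : SS) : -(nm u * nm v) ≤ rp u v := (abs_le.1 (rp_abs_le u v)).1

lemma rp_comm (u v : SS) : rp u v = rp v u := by
  rw [rp, rp, cip_eq, cip_eq, ← inner_conj_symm, Complex.conj_re]

lemma rp_add_right (u v w : SS) : rp u (v + w) = rp u v + rp u w := by
  have : (v + w).toLp 2 volume = v.toLp 2 volume + w.toLp 2 volume := 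
    map_add (SchwartzMap.toLpCLM ℂ ℂ 2 volume) v w
  rw [rp, rp, rp, cip_eq, cip_eq, cip_eq, this, inner_add_right, Complex.add_re]

lemma cip_smul_right (u v : SS) (c : ℂ) : cip u (c • v) = c * cip u v := by
  have : (c • v).toLp 2 volume = c • v.toLp 2 volume := 
    map_smul (SchwartzMap.toLpCLM ℂ ℂ 2 volume) c v
  rw [cip_eq, cip_eq, this, inner_smul_right]

lemma cip_smul_left (u v : SS) (c : ℂ) : cip (c • u) v = (starRingEnd ℂ) c * cip u v := by
  have : (c • u).toLp 2 volume = c • u.toLp 2 volume := 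
    map_smul (SchwartzMap.toLpCLM ℂ ℂ 2 volume) c u
  rw [cip_eq, cip_eq, this, inner_smul_left]

lemma rp_smul_right (u v : SS) (r : ℝ) : rp u ((r : ℂ) • v) = r * rp u v := by
  rw [rp, cip_smul_right, Complex.re_ofReal_mul, rp]

lemma rp_smul_left (u v : SS) (r : ℝ) : rp ((r : ℂ) • u) v = r * rp u v := by
  rw [rp_comm, rp_smul_right, rp_comm]

lemma rp_add_left (u v w : SS) : rp (u + v) w = rp u w + rp v w := by
  rw [rp_comm, rp_add_right, rp_comm w u, rp_comm w v]

lemma rp_neg_right (u v : SS) : rp u (-v) = -rp u v := by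
  have := rp_smul_right u v (-1)
  simpa using this

lemma rp_neg_left (u v : SS) : rp (-u) v = -rp u v := by
  rw [rp_comm, rp_neg_right, rp_comm]

lemma rp_sub_right (u v w : SS) : rp u (v - w) = rp u v - rp u w := by
  rw [sub_eq_add_neg, rp_add_right, rp_neg_right]; ring

lemma rp_sub_left (u v w : SS) : rp (u - v) w = rp u w - rp v w := by
  rw [rp_comm, rp_sub_right, rp_comm w u, rp_comm w v]

/-- multiplication by `i` moved across: skew. -/
lemma rp_I (u v : SS) : rp (Complex.I • u) v = -rp u (Complex.I • v) := by
  rw [rp, rp, cip_smul_left, cip_smul_right]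
  simp

lemma rp_I_self (u : SS) : rp u (Complex.I • u) = 0 := by
  have h1 := rp_I u u
  have h2 := rp_comm (Complex.I • u) u
  linarith

lemma rp_I_I (u v : SS) : rp (Complex.I • u) (Complex.I • v) = rp u v := by
  rw [rp_I, smul_smul, Complex.I_mul_I, neg_smul, one_smul, rp_neg_right, neg_neg]

lemma conj_schwartz (u : SS) : ∃ f : SS, ∀ x, f x = (starRingEnd ℂ) (u x) := by
  refine ⟨SchwartzMap.postcompCLM (𝕜 := ℝ) (Complex.conjCLE : ℂ →L[ℝ] ℂ) u, fun x => ?_⟩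
  rw [SchwartzMap.postcompCLM_apply]; simp

lemma cip_D (u v : SS) : cip (Dv u) v = -cip u (Dv v) := by
  obtain ⟨f, hf⟩ := conj_schwartz u
  have hd : ∀ x, deriv f x = (starRingEnd ℂ) (deriv u x) := by
    intro x
    have h1 : ⇑f = fun x => Complex.conjCLE (u x) := funext fun x => by rw [hf]; simp
    have h2 : HasDerivAt (fun x => Complex.conjCLE (u x)) (Complex.conjCLE (deriv u x)) x :=
      (Complex.conjCLE : ℂ →L[ℝ] ℂ).hasFDerivAt.comp_hasDerivAt x (u.hasDerivAt x)
    rw [h1, h2.deriv]; simp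
  have := SchwartzMap.integral_mul_deriv_eq_neg_deriv_mul f v
  rw [cip, cip]
  simp only [Dv_apply]
  simp only [hf, hd] at this
  rw [this, neg_neg]

lemma rp_D (u v : SS) : rp (Dv u) v = -rp u (Dv v) := by
  rw [rp, rp, cip_D]; simp

lemma rp_D_self (u : SS) : rp u (Dv u) = 0 := by
  have h1 := rp_D u u
  have h2 := rp_comm (Dv u) u
  linarith

lemma rp_M {p : ℝ → ℝ} (hp : p.HasTemperateGrowth) (u v : SS) : rp (Ml p u) v = rp u (Ml p v) := by
  rw [rp, rp, cip, cip]
  congr 2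
  funext x
  rw [Ml_apply hp, Ml_apply hp]
  simp; ring

lemma D_M {p : ℝ → ℝ} (hp : p.HasTemperateGrowth) (u : SS) :
    Dv (Ml p u) = Ml (deriv p) u + Ml p (Dv u) := by
  ext x
  rw [_root_.add_apply, Ml_apply (temp_deriv hp), Ml_apply hp, Dv_apply, Dv_apply]
  have h1 : ⇑(Ml p u) = fun x => (p x : ℂ) * u x := funext fun x => Ml_apply hp u x
  have hPd : HasDerivAt p (deriv p x) x := ((hp.1.differentiable (by simp)) x).hasDerivAt
  rw [h1]
  exact (hPd.ofReal_comp.mul (u.hasDerivAt x)).deriv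

lemma nm_le_of (f g : SS) (K : ℝ) (hK : 0 ≤ K) (h : ∀ x, ‖f x‖ ≤ K * ‖g x‖) : nm f ≤ K * nm g := by
  have : eLpNorm (⇑f) 2 volume ≤ ENNReal.ofReal K * eLpNorm (⇑g) 2 volume := by
    apply eLpNorm_le_mul_eLpNorm_of_ae_le_mul
    exact Eventually.of_forall h
  rw [eLpNorm_eq, eLpNorm_eq, ← ENNReal.ofReal_mul hK] at this
  exact (ENNReal.ofReal_le_ofReal_iff (mul_nonneg hK (nm_nonneg _))).1 this

noncomputable def Em (κ : ℝ) : SS →L[ℂ] SS :=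
  SchwartzMap.smulLeftCLM ℂ (fun x : ℝ => Complex.exp (Complex.I * κ * x))

lemma Em_apply (κ : ℝ) (u : SS) (x : ℝ) : Em κ u x = Complex.exp (Complex.I * κ * x) * u x := by
  rw [Em, SchwartzMap.smulLeftCLM_apply_apply (temp_exp κ), smul_eq_mul]

lemma Em_norm (κ : ℝ) (u : SS) (x : ℝ) : ‖Em κ u x‖ = ‖u x‖ := by
  rw [Em_apply, norm_mul]
  have : ‖Complex.exp (Complex.I * κ * x)‖ = 1 := by
    rw [Complex.norm_exp]; simp
  rw [this, one_mul]

lemma nm_Em (κ : ℝ) (u : SS) : nm (Em κ u) = nm u := by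
  apply le_antisymm
  · simpa using nm_le_of (Em κ u) u 1 zero_le_one (fun x => by rw [Em_norm]; simp)
  · simpa using nm_le_of u (Em κ u) 1 zero_le_one (fun x => by rw [Em_norm]; simp)

lemma D_Em (κ : ℝ) (u : SS) : Dv (Em κ u) = Em κ (Dv u + (Complex.I * κ) • u) := by
  ext x
  rw [Em_apply, Dv_apply]
  have h1 : ⇑(Em κ u) = fun x : ℝ => Complex.exp (Complex.I * κ * x) * u x :=
    funext fun x => Em_apply κ u x
  have h2 : HasDerivAt (fun x : ℝ => Complex.I * κ * (x : ℂ)) (Complex.I * κ * 1) x :=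
    (HasDerivAt.ofReal_comp (hasDerivAt_id x)).const_mul _
  rw [h1]
  refine (h2.cexp.mul (u.hasDerivAt x)).deriv.trans ?_
  rw [_root_.add_apply, _root_.smul_apply, Dv_apply, smul_eq_mul]
  ring

lemma M_Em {p : ℝ → ℝ} (hp : p.HasTemperateGrowth) (κ : ℝ) (u : SS) :
    Ml p (Em κ u) = Em κ (Ml p u) := by
  ext x
  rw [Ml_apply hp, Em_apply, Em_apply, Ml_apply hp]; ring

lemma Em_Em (κ : ℝ) (u : SS) : Em κ (Em (-κ) u) = u := by
  ext x
  rw [Em_apply, Em_apply, ← mul_assoc, ← Complex.exp_add]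
  simp

/-- first order operator -/
noncomputable def Lo (σ κ : ℝ) (w : ℝ → ℝ) (φ : SS) : SS :=
  (σ : ℂ) • Dv φ + (Complex.I * κ) • φ + Ml w φ

lemma Lo_Em {w : ℝ → ℝ} (hw : w.HasTemperateGrowth) (σ κ μ : ℝ) (φ : SS) :
    Lo σ κ w (Em μ φ) = Em μ (Lo σ (κ + σ * μ) w φ) := by
  simp only [Lo, D_Em, M_Em hw, map_add, map_smul, smul_add, smul_smul]
  have : (Complex.I * ((κ + σ * μ : ℝ) : ℂ)) = (Complex.I * κ) + σ * (Complex.I * μ) := by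
    push_cast; ring
  rw [this, add_smul]
  abel

lemma Lo_solve {w : ℝ → ℝ} (hw : w.HasTemperateGrowth) (R : ℝ) (hR : ∀ x, R ≤ |x| → 1 ≤ w x)
    (σ κ : ℝ) (hσ : σ = 1 ∨ σ = -1) (ψ : SS) : ∃ φ : SS, Lo σ κ w φ = ψ := by
  have base : ∃ φ : SS, Lo σ 0 w φ = Em (σ * κ) ψ := by
    rcases hσ with rfl | rfl
    · obtain ⟨f, hf⟩ := ode_solve w hw R hR (Em (1 * κ) ψ)
      refine ⟨f, ?_⟩
      ext x
      rw [← hf]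
      simp [Lo, Ml_apply hw, Dv_apply]
    · obtain ⟨f, hf⟩ := ode_solve_neg w hw R hR (Em (-1 * κ) ψ)
      refine ⟨f, ?_⟩
      ext x
      rw [← hf]
      simp [Lo, Ml_apply hw, Dv_apply]
  obtain ⟨φ, h⟩ := base
  refine ⟨Em (-(σ * κ)) φ, ?_⟩
  rw [Lo_Em hw]
  have : κ + σ * -(σ * κ) = 0 := by rcases hσ with rfl | rfl <;> ring
  rw [this, h]
  have := Em_Em (-(σ * κ)) ψ
  rwa [neg_neg] at this

lemma G_solve (b : ℝ) (hb : 1 ≤ b) (u : SS) :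
    ∃ g : SS, -Dv (Dv g) + ((3 * b ^ 2 : ℝ) : ℂ) • g = u := by
  have hs : 1 ≤ √3 * b := by
    have : 1 ≤ √3 := by rw [Real.one_le_sqrt]; norm_num
    nlinarith
  have ht : (fun _ : ℝ => √3 * b).HasTemperateGrowth := Function.HasTemperateGrowth.const _
  obtain ⟨y, hy⟩ := Lo_solve ht 0 (fun x _ => hs) 1 0 (Or.inl rfl) u
  obtain ⟨g, hg⟩ := Lo_solve ht 0 (fun x _ => hs) (-1) 0 (Or.inr rfl) y
  have hM : ∀ φ : SS, Ml (fun _ : ℝ => √3 * b) φ = ((√3 * b : ℝ) : ℂ) • φ := by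
    intro φ
    ext x
    rw [Ml_apply ht]; simp
  refine ⟨g, ?_⟩
  rw [← hy, ← hg]
  simp only [Lo, hM, map_add, map_smul]
  have h3 : ((3 * b ^ 2 : ℝ) : ℂ) = ((√3 * b : ℝ) : ℂ) * ((√3 * b : ℝ) : ℂ) := by
    rw [← Complex.ofReal_mul]
    congr 1
    have : √3 * √3 = 3 := Real.mul_self_sqrt (by norm_num)
    nlinarith
  rw [h3]
  simp
  module

structure Good (a q : ℝ → ℝ) (Γ : ℝ) : Prop where
  ta : a.HasTemperateGrowth
  tq : q.HasTemperateGrowth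
  a0 : ∀ x, 0 ≤ a x
  q0 : ∀ x, 0 ≤ q x
  lim : Tendsto a (cocompact ℝ) atTop
  G1 : 1 ≤ Γ
  da : ∀ x, |deriv a x| ≤ Γ * (1 + a x)
  dda : ∀ x, |deriv (deriv a) x| ≤ Γ * (1 + a x)
  qa : ∀ x, |q x| ≤ Γ * (1 + a x)
  dq : ∀ x, |deriv q x| ≤ Γ * (1 + a x)
  ddq : ∀ x, |deriv (deriv q) x| ≤ Γ * (1 + a x)

lemma good_of_standing {a q : ℝ → ℝ} (h : Standing a q) : ∃ Γ, Good a q Γ := by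
  have ta := temp_of_symbol a h.smooth_a h.nonneg_a h.deriv_a
  have tq := temp_of_symbol q h.smooth_q h.nonneg_q h.deriv_q
  obtain ⟨A1, hA1, a1⟩ := deriv_bound a h.nonneg_a 1 (h.deriv_a 1 le_rfl)
  obtain ⟨A2, hA2, a2⟩ := deriv_bound a h.nonneg_a 2 (h.deriv_a 2 (by norm_num))
  obtain ⟨Q1, hQ1, q1⟩ := deriv_bound q h.nonneg_q 1 (h.deriv_q 1 le_rfl)
  obtain ⟨Q2, hQ2, q2⟩ := deriv_bound q h.nonneg_q 2 (h.deriv_q 2 (by norm_num))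
  obtain ⟨K₀, hK, x₀, hx₀, hqa⟩ := h.q_le_a
  obtain ⟨B, hB⟩ := (isCompact_Icc (a := -x₀) (b := x₀)).exists_bound_of_continuousOn
    (f := q) h.smooth_q.continuous.continuousOn
  have hQ : ∃ Q, 0 ≤ Q ∧ ∀ x, q x ≤ Q * (1 + a x) := by
    refine ⟨max K₀ B, le_max_of_le_left hK.le, fun x => ?_⟩
    have h0 := h.nonneg_a x
    rcases lt_or_ge x₀ |x| with hx | hx
    · have := hqa x hx
      have h2 := le_max_left K₀ B
      nlinarith
    · have := hB x (abs_le.1 hx)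
      have h3 : q x ≤ B := (le_abs_self _).trans this
      have h2 := le_max_right K₀ B
      have h4 : 0 ≤ max K₀ B := le_max_of_le_left hK.le
      nlinarith
  obtain ⟨Q, hQ0, hQ⟩ := hQ
  have d1 : ∀ f : ℝ → ℝ, iteratedDeriv 1 f = deriv f := fun f => iteratedDeriv_one
  have d2 : ∀ f : ℝ → ℝ, iteratedDeriv 2 f = deriv (deriv f) := fun f => by
    rw [iteratedDeriv_succ, d1]
  simp only [d1, d2] at a1 a2 q1 q2
  refine ⟨1 + A1 + A2 + Q + Q1 * (1 + Q) + Q2 * (1 + Q), ta, tq, h.nonneg_a, h.nonneg_q,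
    h.unbounded_a, ?_, ?_, ?_, ?_, ?_, ?_⟩
  · have : 0 ≤ Q1 * (1 + Q) := by positivity
    have : 0 ≤ Q2 * (1 + Q) := by positivity
    linarith
  all_goals
    intro x
    have p0 := h.nonneg_a x
    have hp : 0 ≤ 1 + a x := by linarith
    have t1 : 0 ≤ A1 * (1 + a x) := by positivity
    have t2 : 0 ≤ A2 * (1 + a x) := by positivity
    have t3 : 0 ≤ Q * (1 + a x) := by positivity
    have t4 : 0 ≤ Q1 * (1 + Q) * (1 + a x) := by positivity
    have t5 : 0 ≤ Q2 * (1 + Q) * (1 + a x) := by positivity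
    have t6 : 1 + q x ≤ (1 + Q) * (1 + a x) := by linarith [hQ x]
    have t7 : Q1 * (1 + q x) ≤ Q1 * ((1 + Q) * (1 + a x)) := by gcongr
    have t8 : Q2 * (1 + q x) ≤ Q2 * ((1 + Q) * (1 + a x)) := by gcongr
  · linarith [a1 x]
  · linarith [a2 x]
  · rw [abs_of_nonneg (h.nonneg_q x)]; linarith [hQ x]
  · linarith [q1 x]
  · linarith [q2 x]

lemma temp_sub_const {a : ℝ → ℝ} (ha : a.HasTemperateGrowth) (c : ℝ) :
    (fun x => a x - c).HasTemperateGrowth := ha.sub (Function.HasTemperateGrowth.const c)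

lemma Ml_sub_const {a : ℝ → ℝ} (ha : a.HasTemperateGrowth) (c : ℝ) (u : SS) :
    Ml (fun x => a x - c) u = Ml a u - (c : ℂ) • u := by
  ext x
  rw [Ml_apply (temp_sub_const ha c)]
  simp [Ml_apply ha]; ring

lemma one_le_w {a : ℝ → ℝ} (lim : Tendsto a (cocompact ℝ) atTop) (c : ℝ) :
    ∃ R, ∀ x, R ≤ |x| → 1 ≤ a x - c := by
  have h1 := lim.eventually (eventually_ge_atTop (1 + c))
  rw [← Metric.cobounded_eq_cocompact, ← comap_norm_atTop, eventually_comap] at h1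
  obtain ⟨R, hR⟩ := eventually_atTop.1 h1
  refine ⟨R, fun x hx => ?_⟩
  have := hR |x| hx x rfl
  linarith

lemma adj_Lo {w : ℝ → ℝ} (hw : w.HasTemperateGrowth) (σ κ : ℝ) (φ v : SS) :
    rp (Lo σ κ w φ) v = rp φ (Lo (-σ) (-κ) w v) := by
  have h1 : ∀ (κ : ℝ) (φ : SS), (Complex.I * κ) • φ = (κ : ℂ) • (Complex.I • φ) := by
    intro κ φ; rw [smul_smul, mul_comm]
  simp only [Lo, h1, rp_add_left, rp_add_right, rp_smul_left, rp_smul_right, rp_D, rp_I, rp_M hw]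
  ring

/-- resolvent bound, all signs and modulations -/
lemma Hgen {w : ℝ → ℝ} (hw : w.HasTemperateGrowth) (R : ℝ) (hR : ∀ x, R ≤ |x| → 1 ≤ w x) (N : ℝ)
    (hN : 0 ≤ N)
    (H1 : ∀ u, nm u ≤ N * nm (Lo (-1) 0 w u)) (σ κ : ℝ) (hσ : σ = 1 ∨ σ = -1) (φ : SS) :
    nm φ ≤ N * nm (Lo σ κ w φ) := by
  have H2 : ∀ u, nm u ≤ N * nm (Lo 1 0 w u) := by
    intro u
    obtain ⟨f, hf⟩ := Lo_solve hw R hR (-1) 0 (Or.inr rfl) u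
    have h1 := H1 f
    rw [hf] at h1
    have h2 := adj_Lo hw 1 0 u f
    rw [neg_zero, hf, ← nm_sq] at h2
    have h3 := rp_le (Lo 1 0 w u) f
    have h4 : nm (Lo 1 0 w u) * nm f ≤ nm (Lo 1 0 w u) * (N * nm u) :=
      mul_le_mul_of_nonneg_left h1 (nm_nonneg _)
    rcases (nm_nonneg u).eq_or_lt with h | h
    · rw [← h]; exact mul_nonneg hN (nm_nonneg _)
    · refine le_of_mul_le_mul_left ?_ h
      nlinarith
  have H3 : ∀ u, nm u ≤ N * nm (Lo σ 0 w u) := by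
    rcases hσ with rfl | rfl
    · exact H2
    · exact H1
  have h4 := H3 (Em (σ * κ) φ)
  rw [Lo_Em hw, nm_Em, nm_Em] at h4
  have : 0 + σ * (σ * κ) = κ := by rcases hσ with rfl | rfl <;> ring
  rwa [this] at h4

lemma NA_fun_eq {a : ℝ → ℝ} (ha : a.HasTemperateGrowth) (c : ℝ) (u : SS) :
    (fun x => -deriv (⇑u) x + (a x : ℂ) * u x - (c : ℂ) * u x) =
      ⇑(Lo (-1) 0 (fun x => a x - c) u) := by
  funext x
  simp [Lo, Ml_apply (temp_sub_const ha c), Dv_apply]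
  ring

lemma NA_H1 {a : ℝ → ℝ} (ha : a.HasTemperateGrowth) (c : ℝ) (hfin : NA a c < ⊤) (u : SS) :
    nm u ≤ (NA a c).toReal * nm (Lo (-1) 0 (fun x => a x - c) u) := by
  by_cases hu : u = 0
  · subst hu
    have : nm (0 : SS) = 0 := by simpa using nm_smul 0 (0 : SS)
    rw [this]
    exact mul_nonneg ENNReal.toReal_nonneg (nm_nonneg _)
  have h1 : ENNReal.ofReal (nm u) / ENNReal.ofReal (nm (Lo (-1) 0 (fun x => a x - c) u)) ≤ NA a c := by
    rw [← eLpNorm_eq, ← eLpNorm_eq, ← NA_fun_eq ha]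
    exact le_iSup₂_of_le u hu le_rfl
  have hp := nm_pos hu
  set z := nm (Lo (-1) 0 (fun x => a x - c) u) with hz
  have hz0 : 0 < z := by
    rcases (nm_nonneg (Lo (-1) 0 (fun x => a x - c) u)).eq_or_lt with h | h
    · exfalso
      rw [hz, ← h, ENNReal.ofReal_zero, ENNReal.div_zero (by simpa using hp)] at h1
      exact absurd hfin (not_lt.2 h1)
    · exact h
  rw [← ENNReal.ofReal_div_of_pos hz0, ENNReal.ofReal_le_iff_le_toReal hfin.ne, div_le_iff₀ hz0] at h1
  exact h1

lemma NA_sup {a : ℝ → ℝ} (ha : a.HasTemperateGrowth) (c : ℝ) (M : ℝ) (hM : 0 < M)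
    (h : ENNReal.ofReal M < NA a c) :
    ∃ u : SS, u ≠ 0 ∧ M * nm (Lo (-1) 0 (fun x => a x - c) u) ≤ nm u := by
  rw [NA, lt_iSup_iff] at h
  obtain ⟨u, h⟩ := h
  rw [lt_iSup_iff] at h
  obtain ⟨hu, h⟩ := h
  refine ⟨u, hu, ?_⟩
  rw [NA_fun_eq ha, eLpNorm_eq, eLpNorm_eq] at h
  set z := nm (Lo (-1) 0 (fun x => a x - c) u) with hz
  have hz0 : 0 ≤ z := nm_nonneg _
  rcases hz0.eq_or_lt with h' | h'
  · rw [← h', mul_zero]; exact nm_nonneg _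
  rw [← ENNReal.ofReal_div_of_pos h'] at h
  have := (ENNReal.ofReal_lt_ofReal_iff_of_nonneg hM.le).1 h
  rw [lt_div_iff₀ h'] at this
  exact this.le

lemma exists_schw : ∃ u : SS, u ≠ 0 := by
  obtain ⟨f⟩ : Nonempty (ContDiffBump (0 : ℝ)) := inferInstance
  have hs : HasCompactSupport (fun x => (f x : ℂ)) := f.hasCompactSupport.comp_left Complex.ofReal_zero
  have hd : ContDiff ℝ (⊤ : ℕ∞) (fun x => (f x : ℂ)) := Complex.ofRealCLM.contDiff.comp f.contDiff
  refine ⟨hs.toSchwartzMap hd, fun h => ?_⟩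
  have h0 : hs.toSchwartzMap hd 0 = 0 := by rw [h]; rfl
  have h1 : hs.toSchwartzMap hd 0 = (f 0 : ℂ) := rfl
  rw [h1, f.one_of_mem_closedBall (by simp [f.rIn_pos.le])] at h0
  simp at h0

lemma NA_lower {a : ℝ → ℝ} (ha : a.HasTemperateGrowth) :
    ∃ K : ℝ, 1 ≤ K ∧ ∀ c : ℝ, 0 ≤ c → NA a c < ⊤ → 1 ≤ K * (1 + c) * (NA a c).toReal := by
  obtain ⟨η, hη⟩ := exists_schw
  have hp := nm_pos hη
  refine ⟨1 + nm (Lo (-1) 0 a η) / nm η, by have := nm_nonneg (Lo (-1) 0 a η); simp; positivity, fun c hc hfin => ?_⟩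
  have h1 := NA_H1 ha c hfin η
  have h2 : Lo (-1) 0 (fun x => a x - c) η = Lo (-1) 0 a η - (c : ℂ) • η := by
    simp only [Lo, Ml_sub_const ha]; abel
  have h3 : nm (Lo (-1) 0 (fun x => a x - c) η) ≤ nm (Lo (-1) 0 a η) + c * nm η := by
    rw [h2]
    refine (nm_sub_le _ _).trans ?_
    rw [nm_smul, Complex.norm_real, Real.norm_eq_abs, abs_of_nonneg hc]
  set N := (NA a c).toReal
  have hN : 0 ≤ N := ENNReal.toReal_nonneg
  set z := nm (Lo (-1) 0 a η)
  have hz : 0 ≤ z := nm_nonneg _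
  have h4 : nm η ≤ N * (z + c * nm η) := h1.trans (mul_le_mul_of_nonneg_left h3 hN)
  have h5 : z / nm η * nm η = z := div_mul_cancel₀ _ hp.ne'
  refine le_of_mul_le_mul_right ?_ hp
  calc 1 * nm η ≤ N * (z + c * nm η) := by linarith
    _ = N * (z / nm η * nm η + c * nm η) := by rw [h5]
    _ = (z / nm η + c) * (N * nm η) := by ring
    _ ≤ ((1 + z / nm η) * (1 + c)) * (N * nm η) := by
        have : 0 ≤ z / nm η := by positivity
        gcongr
        nlinarith [mul_nonneg this hc]
    _ = _ := by ring

lemma nm_Ml_le {a p : ℝ → ℝ} (ha : a.HasTemperateGrowth) (a0 : ∀ x, 0 ≤ a x)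
    (hp : p.HasTemperateGrowth) (Γ : ℝ) (hΓ : 0 ≤ Γ) (h : ∀ x, |p x| ≤ Γ * (1 + a x)) (u : SS) :
    nm (Ml p u) ≤ Γ * (nm u + nm (Ml a u)) := by
  have h1 : nm (Ml p u) ≤ Γ * nm (u + Ml a u) := by
    apply nm_le_of _ _ _ hΓ
    intro x
    rw [Ml_apply hp, _root_.add_apply, Ml_apply ha]
    have e : u x + a x * u x = ((1 + a x : ℝ) : ℂ) * u x := by push_cast; ring
    rw [e, norm_mul, norm_mul, Complex.norm_real, Complex.norm_real, Real.norm_eq_abs,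
      Real.norm_eq_abs, abs_of_nonneg (by linarith [a0 x] : 0 ≤ 1 + a x), ← mul_assoc]
    gcongr
    exact h x
  exact h1.trans (mul_le_mul_of_nonneg_left (nm_add_le _ _) hΓ)

lemma rp_D_Ml {p : ℝ → ℝ} (hp : p.HasTemperateGrowth) (u : SS) :
    2 * rp (Dv u) (Ml p u) = -rp u (Ml (deriv p) u) := by
  have h1 := rp_D u (Ml p u)
  rw [D_M hp, rp_add_right, ← rp_M hp u (Dv u), rp_comm (Ml p u)] at h1
  linarith

lemma rp_I_Ml {p : ℝ → ℝ} (hp : p.HasTemperateGrowth) (u : SS) :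
    rp (Complex.I • u) (Ml p u) = 0 := by
  have e1 := rp_I u (Ml p u)
  have e2 : Complex.I • Ml p u = Ml p (Complex.I • u) := by rw [map_smul]
  rw [e2, ← rp_M hp u, rp_comm (Ml p u)] at e1
  linarith

lemma deriv_sub_const' (a : ℝ → ℝ) (c : ℝ) : deriv (fun x => a x - c) = deriv a := by
  funext x; simp

lemma nm_add_sq (u v : SS) : nm (u + v) ^ 2 = nm u ^ 2 + 2 * rp u v + nm v ^ 2 := by
  rw [nm_sq, nm_sq, nm_sq, rp_add_left, rp_add_right, rp_add_right, rp_comm v u]; ring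

lemma graph_num (P Q B Γ c : ℝ) (p1 : 0 ≤ P) (p2 : 0 ≤ Q) (p3 : 0 ≤ B) (hG : 1 ≤ Γ) (hc : 0 ≤ c)
    (h : B ^ 2 ≤ Q ^ 2 + P * (Γ * (P + (B + c * P)))) : B ≤ Q + 2 * (Γ * (1 + c) * P) := by
  have h7 : Γ * P ≤ Γ * (1 + c) * P := by
    gcongr; nlinarith
  have ht : P ≤ Γ * (1 + c) * P := by
    have : 1 ≤ Γ * (1 + c) := by nlinarith
    nlinarith
  have h8 : B ^ 2 ≤ Q ^ 2 + Γ * (1 + c) * P * P + Γ * P * B := by linarith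
  set t := Γ * (1 + c) * P
  have t0 : 0 ≤ t := p1.trans ht
  have h9 : B ^ 2 ≤ Q ^ 2 + t * t + t * B := by
    have := mul_le_mul_of_nonneg_left ht t0
    have := mul_le_mul_of_nonneg_right h7 p3
    linarith
  by_contra hcon
  push Not at hcon
  have : 0 < (B - Q - 2 * t) * (B + Q + t) := mul_pos (by linarith) (by linarith)
  nlinarith [mul_nonneg p2 t0, mul_nonneg t0 t0]

lemma graph_est {a q : ℝ → ℝ} {Γ : ℝ} (h : Good a q Γ) (c : ℝ) (hc : 0 ≤ c) (σ κ : ℝ)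
    (hσ : σ = 1 ∨ σ = -1) (φ : SS) :
    nm (Ml a φ) ≤ nm (Lo σ κ (fun x => a x - c) φ) + 3 * Γ * (1 + c) * nm φ := by
  have hw := temp_sub_const h.ta c
  set ψ := Lo σ κ (fun x => a x - c) φ with hψ
  set X := Ml (fun x => a x - c) φ with hX
  set Y := (σ : ℂ) • Dv φ + (κ : ℂ) • (Complex.I • φ) with hY
  have e : ψ = Y + X := by
    rw [hψ, Lo, hY, smul_smul (κ : ℂ), mul_comm (κ : ℂ)]
  have hcross : rp Y X = -(σ / 2) * rp φ (Ml (deriv a) φ) := by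
    have h1 := rp_D_Ml hw φ
    rw [deriv_sub_const'] at h1
    have h2 : rp (Complex.I • φ) X = 0 := rp_I_Ml hw φ
    rw [hY, rp_add_left, rp_smul_left, rp_smul_left, h2]
    linear_combination (σ / 2) * h1
  have hsq : nm ψ ^ 2 = nm Y ^ 2 + 2 * rp Y X + nm X ^ 2 := by
    rw [e, nm_add_sq]
  have hb1 := nm_Ml_le h.ta h.a0 (temp_deriv h.ta) Γ (by linarith [h.G1]) h.da φ
  have hb2 : |rp φ (Ml (deriv a) φ)| ≤ nm φ * (Γ * (nm φ + nm (Ml a φ))) :=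
    (rp_abs_le _ _).trans (mul_le_mul_of_nonneg_left hb1 (nm_nonneg _))
  have hb3 : |2 * rp Y X| ≤ nm φ * (Γ * (nm φ + nm (Ml a φ))) := by
    rw [hcross]
    rcases hσ with rfl | rfl
    · rw [show 2 * (-(1 / 2 : ℝ) * rp φ (Ml (deriv a) φ)) = -rp φ (Ml (deriv a) φ) by ring, abs_neg]
      exact hb2
    · rw [show 2 * (-(-1 / 2 : ℝ) * rp φ (Ml (deriv a) φ)) = rp φ (Ml (deriv a) φ) by ring]
      exact hb2
  have hA : nm (Ml a φ) ≤ nm X + c * nm φ := by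
    have : Ml a φ = X + (c : ℂ) • φ := by rw [hX, Ml_sub_const h.ta]; abel
    rw [this]
    refine (nm_add_le _ _).trans ?_
    rw [nm_smul, Complex.norm_real, Real.norm_eq_abs, abs_of_nonneg hc]
  have hXsq : nm X ^ 2 ≤ nm ψ ^ 2 + nm φ * (Γ * (nm φ + nm (Ml a φ))) := by
    have := (abs_le.1 hb3).1
    nlinarith [sq_nonneg (nm Y)]
  have p1 := nm_nonneg φ
  have p2 := nm_nonneg ψ
  have p3 := nm_nonneg X
  have hG := h.G1
  set P := nm φ
  set Q := nm ψ
  set B := nm X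
  set A := nm (Ml a φ)
  have h6 : B ^ 2 ≤ Q ^ 2 + P * (Γ * (P + (B + c * P))) := by
    refine hXsq.trans ?_
    gcongr
  have := graph_num P Q B Γ c p1 p2 p3 hG hc h6
  have h7 : c * P ≤ Γ * (1 + c) * P := by
    gcongr; nlinarith
  linarith

noncomputable def TT (a q : ℝ → ℝ) (lam : ℂ) (u : SS) : SS :=
  -Dv (Dv u) + Ml q u + (2 * lam) • Ml a u + (lam ^ 2) • u

lemma TT_eq {a q : ℝ → ℝ} (ha : a.HasTemperateGrowth) (hq : q.HasTemperateGrowth) (lam : ℂ) (u : SS) :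
    Tq a q lam (⇑u) = ⇑(TT a q lam u) := by
  funext x
  have h1 : Dv (Dv u) x = deriv (deriv (⇑u)) x := rfl
  simp only [TT, Tq, _root_.add_apply, _root_.neg_apply, _root_.smul_apply, h1, Ml_apply ha,
    Ml_apply hq, smul_eq_mul]
  ring

noncomputable def RR (a q : ℝ → ℝ) (c : ℝ) (v : SS) : SS :=
  -Dv (Dv v) + Ml q v - ((2 * c : ℝ) : ℂ) • Ml a v + ((c ^ 2 : ℝ) : ℂ) • v

lemma TT_Em {a q : ℝ → ℝ} (ha : a.HasTemperateGrowth) (hq : q.HasTemperateGrowth) (c b : ℝ) (v : SS) :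
    TT a q (-(c : ℂ) + Complex.I * (b : ℂ)) (Em b v) =
      Em b (RR a q c v + (2 * Complex.I * b) • Lo (-1) 0 (fun x => a x - c) v) := by
  have h1 : Dv (Dv (Em b v)) = Em b (Dv (Dv v) + (2 * Complex.I * b) • Dv v - ((b : ℂ) ^ 2) • v) := by
    rw [D_Em, D_Em]
    congr 1
    simp only [map_add, map_smul, smul_add, smul_smul]
    have : Complex.I * b * (Complex.I * b) = -(b : ℂ) ^ 2 := by
      linear_combination (b : ℂ) ^ 2 * Complex.I_sq
    rw [this]
    module
  have h2 : (-(c : ℂ) + Complex.I * (b : ℂ)) ^ 2 = (c : ℂ) ^ 2 - (b : ℂ) ^ 2 - 2 * Complex.I * b * c := by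
    linear_combination (b : ℂ) ^ 2 * Complex.I_sq
  rw [TT, h1, M_Em ha, M_Em hq, ← map_neg (Em b), ← map_smul (Em b),
    ← map_smul (Em b), ← map_add (Em b), ← map_add (Em b), ← map_add (Em b), h2]
  congr 1
  ext x
  simp only [RR, Lo, Ml_sub_const ha, _root_.add_apply, _root_.sub_apply, _root_.neg_apply,
    _root_.smul_apply, smul_eq_mul]
  push_cast
  ring

lemma nm_smul_real (r : ℝ) (hr : 0 ≤ r) (u : SS) : nm ((r : ℂ) • u) = r * nm u := by
  rw [nm_smul, Complex.norm_real, Real.norm_eq_abs, abs_of_nonneg hr]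

lemma nm_w_le {a : ℝ → ℝ} (ha : a.HasTemperateGrowth) (c : ℝ) (hc : 0 ≤ c) (u : SS) :
    nm (Ml (fun x => a x - c) u) ≤ nm (Ml a u) + c * nm u := by
  rw [Ml_sub_const ha, ← nm_smul_real c hc]
  exact nm_sub_le _ _

set_option maxHeartbeats 1000000 in
lemma R_bound {a q : ℝ → ℝ} {Γ : ℝ} (h : Good a q Γ) (c : ℝ) (hc : 0 ≤ c) (K : ℝ) (hK : 1 ≤ K)
    (u y v : SS) (hy : Lo 1 0 (fun x => a x - c) y = u) (hv : Lo (-1) 0 (fun x => a x - c) v = y)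
    (h1 : nm y ≤ 2 * (K * (1 + c)) * nm v) (h2 : nm u ≤ 2 * (K * (1 + c)) * nm y) :
    nm (RR a q c v) ≤ 138 * (K + Γ) ^ 2 * (1 + c ^ 2) * nm v := by
  have hG := h.G1
  have hw := temp_sub_const h.ta c
  have wd : deriv (fun x => a x - c) = deriv a := deriv_sub_const' a c
  set w : ℝ → ℝ := fun x => a x - c with hwdef
  -- derivative formulas
  have e1 : Dv v = Ml w v - y := by
    rw [← hv]; simp [Lo]
  have e2 : Dv y = u - Ml w y := by
    rw [← hy]; simp [Lo]
  have e3 : Dv (Dv v) = Ml (deriv a) v + Ml w (Ml w v) - u := by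
    rw [e1, map_sub, D_M hw, wd, e1, e2, map_sub]; abel
  have e4 : Lo (-1) 0 w (Ml w v) = Ml w y - Ml (deriv a) v := by
    rw [← hv]
    simp [Lo, D_M hw, wd]
    abel
  have V0 := nm_nonneg v
  obtain ⟨θ, hθ⟩ : ∃ θ, θ = (K + Γ) * (1 + c) := ⟨_, rfl⟩
  have θ1 : 1 ≤ θ := by rw [hθ]; nlinarith
  have θ2 : K * (1 + c) ≤ θ := by rw [hθ]; nlinarith
  have θ3 : Γ * (1 + c) ≤ θ := by rw [hθ]; nlinarith
  have θ4 : c ≤ θ := by rw [hθ]; nlinarith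
  have θ5 : Γ ≤ θ := by rw [hθ]; nlinarith
  set V := nm v
  obtain ⟨P, hP⟩ : ∃ P, P = θ * V := ⟨_, rfl⟩
  obtain ⟨Q, hQ⟩ : ∃ Q, Q = θ * P := ⟨_, rfl⟩
  have P0 : 0 ≤ P := by rw [hP]; positivity
  have Q0 : 0 ≤ Q := by rw [hQ]; positivity
  have VP : V ≤ P := by rw [hP]; nlinarith
  have PQ : P ≤ Q := by rw [hQ]; nlinarith
  have lem : ∀ s z : ℝ, s ≤ θ → 0 ≤ z → s * z ≤ θ * z := fun s z hs hz =>
    mul_le_mul_of_nonneg_right hs hz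
  have b1 : nm y ≤ 2 * P := by
    have := lem _ _ θ2 V0
    linarith
  have b2 : nm u ≤ 4 * Q := by
    have := lem _ _ θ2 (nm_nonneg y)
    have : θ * nm y ≤ θ * (2 * P) := mul_le_mul_of_nonneg_left b1 (by linarith)
    linarith
  have b3 : nm (Ml a v) ≤ 5 * P := by
    have := graph_est h c hc (-1) 0 (Or.inr rfl) v
    rw [hv] at this
    have := lem _ _ θ3 V0
    linarith
  have b4 : nm (Ml w v) ≤ 6 * P := by
    have := nm_w_le h.ta c hc v
    have := lem _ _ θ4 V0
    linarith
  have b5 : nm (Ml a y) ≤ 10 * Q := by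
    have := graph_est h c hc 1 0 (Or.inl rfl) y
    rw [hy] at this
    have := lem _ _ θ3 (nm_nonneg y)
    have : θ * nm y ≤ θ * (2 * P) := mul_le_mul_of_nonneg_left b1 (by linarith)
    linarith
  have b6 : nm (Ml w y) ≤ 12 * Q := by
    have := nm_w_le h.ta c hc y
    have := lem _ _ θ4 (nm_nonneg y)
    have : θ * nm y ≤ θ * (2 * P) := mul_le_mul_of_nonneg_left b1 (by linarith)
    linarith
  have gv : Γ * (V + nm (Ml a v)) ≤ 6 * Q := by
    have t1 : V + nm (Ml a v) ≤ 6 * P := by linarith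
    have := lem Γ _ θ5 (add_nonneg V0 (nm_nonneg (Ml a v)))
    have : θ * (V + nm (Ml a v)) ≤ θ * (6 * P) := mul_le_mul_of_nonneg_left t1 (by linarith)
    linarith
  have b7 : nm (Ml (deriv a) v) ≤ 6 * Q :=
    (nm_Ml_le h.ta h.a0 (temp_deriv h.ta) Γ (by linarith) h.da v).trans gv
  have b8 : nm (Ml q v) ≤ 6 * Q :=
    (nm_Ml_le h.ta h.a0 h.tq Γ (by linarith) h.qa v).trans gv
  have wv : θ * nm (Ml w v) ≤ θ * (6 * P) := mul_le_mul_of_nonneg_left b4 (by linarith)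
  have b9 : nm (Ml a (Ml w v)) ≤ 36 * Q := by
    have t := graph_est h c hc (-1) 0 (Or.inr rfl) (Ml w v)
    rw [← hwdef, e4] at t
    have := nm_sub_le (Ml w y) (Ml (deriv a) v)
    have := lem _ _ θ3 (nm_nonneg (Ml w v))
    linarith
  have b10 : nm (Ml w (Ml w v)) ≤ 42 * Q := by
    have t := nm_w_le h.ta c hc (Ml w v)
    rw [← hwdef] at t
    have := lem _ _ θ4 (nm_nonneg (Ml w v))
    linarith
  have b11 : nm (-Dv (Dv v)) ≤ 52 * Q := by
    rw [nm_neg, e3]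
    have := nm_sub_le (Ml (deriv a) v + Ml w (Ml w v)) u
    have := nm_add_le (Ml (deriv a) v) (Ml w (Ml w v))
    linarith
  have b12 : nm (((2 * c : ℝ) : ℂ) • Ml a v) ≤ 10 * Q := by
    rw [nm_smul_real _ (by linarith)]
    have := lem _ _ θ4 (nm_nonneg (Ml a v))
    have : θ * nm (Ml a v) ≤ θ * (5 * P) := mul_le_mul_of_nonneg_left b3 (by linarith)
    linarith
  have b13 : nm (((c ^ 2 : ℝ) : ℂ) • v) ≤ Q := by
    rw [nm_smul_real _ (by positivity)]
    have t1 := lem c V θ4 V0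
    have t2 := lem c P θ4 P0
    have t3 : c * (c * V) ≤ c * P := mul_le_mul_of_nonneg_left (by linarith) hc
    change c ^ 2 * V ≤ Q
    have t4 : c ^ 2 * V = c * (c * V) := by ring
    linarith
  have fin : nm (RR a q c v) ≤ 69 * Q := by
    rw [RR]
    have t1 := nm_add_le (-Dv (Dv v) + Ml q v - ((2 * c : ℝ) : ℂ) • Ml a v) (((c ^ 2 : ℝ) : ℂ) • v)
    have t2 := nm_sub_le (-Dv (Dv v) + Ml q v) (((2 * c : ℝ) : ℂ) • Ml a v)
    have t3 := nm_add_le (-Dv (Dv v)) (Ml q v)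
    linarith
  refine fin.trans ?_
  rw [hQ, hP, hθ]
  have : (1 + c) ^ 2 ≤ 2 * (1 + c ^ 2) := by nlinarith [sq_nonneg (1 - c)]
  calc _ = 69 * (K + Γ) ^ 2 * V * (1 + c) ^ 2 := by ring
    _ ≤ 69 * (K + Γ) ^ 2 * V * (2 * (1 + c ^ 2)) := by gcongr
    _ = _ := by ring

lemma part_two {a q : ℝ → ℝ} {Γ : ℝ} (h : Good a q Γ) (c : ℝ) (hc : 0 ≤ c) (b : ℝ) (hb : 0 < b)
    (K : ℝ) (hK : 1 ≤ K) (N M : ℝ) (hN : 0 < N) (hKN : 1 ≤ K * (1 + c) * N)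
    (hM1 : N / 2 ≤ M) (hM2 : M ≤ N) (u : SS) (hu : u ≠ 0)
    (hMu : M * nm (Lo (-1) 0 (fun x => a x - c) u) ≤ nm u) :
    ∃ v : SS, v ≠ 0 ∧ M * nm (TT a q (-(c : ℂ) + Complex.I * (b : ℂ)) v) ≤
      (2 * b + 138 * (K + Γ) ^ 2 * ((1 + c ^ 2) * N)) * nm v := by
  have hw := temp_sub_const h.ta c
  obtain ⟨R, hR⟩ := one_le_w h.lim c
  set w : ℝ → ℝ := fun x => a x - c with hwdef
  obtain ⟨y, hy⟩ := Lo_solve hw R hR 1 0 (Or.inl rfl) u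
  obtain ⟨v, hv⟩ := Lo_solve hw R hR (-1) 0 (Or.inr rfl) y
  have M0 : 0 < M := by linarith
  have u0 := nm_pos hu
  have s1 : M * nm u ≤ nm y := by
    have t1 := adj_Lo hw 1 0 y u
    rw [neg_zero, hy, ← nm_sq] at t1
    have t2 := rp_le y (Lo (-1) 0 w u)
    have t3 := mul_le_mul_of_nonneg_left hMu (nm_nonneg y)
    refine le_of_mul_le_mul_right ?_ u0
    nlinarith
  have y0 : 0 < nm y := lt_of_lt_of_le (by positivity) s1
  have s2 : M * nm y ≤ nm v := by
    have t1 := adj_Lo hw 1 0 y v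
    rw [neg_zero, hy, hv, ← nm_sq] at t1
    have t2 := rp_le u v
    have t3 := mul_le_mul_of_nonneg_right s1 (nm_nonneg v)
    refine le_of_mul_le_mul_right ?_ y0
    nlinarith
  have v0 : 0 < nm v := lt_of_lt_of_le (by positivity) s2
  have k1 : 1 ≤ 2 * (K * (1 + c)) * M := by
    have : K * (1 + c) * N ≤ K * (1 + c) * (2 * M) := by
      apply mul_le_mul_of_nonneg_left <;> [linarith; positivity]
    linarith
  have hKc : 0 ≤ 2 * (K * (1 + c)) := by positivity
  have h1 : nm y ≤ 2 * (K * (1 + c)) * nm v := by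
    have := mul_le_mul_of_nonneg_left s2 hKc
    have := mul_le_mul_of_nonneg_right k1 y0.le
    linarith
  have h2 : nm u ≤ 2 * (K * (1 + c)) * nm y := by
    have := mul_le_mul_of_nonneg_left s1 hKc
    have := mul_le_mul_of_nonneg_right k1 u0.le
    linarith
  have hRb := R_bound h c hc K hK u y v hy hv h1 h2
  refine ⟨Em b v, ?_, ?_⟩
  · intro h0
    have := nm_Em b v
    rw [h0] at this
    have h00 : nm (0 : SS) = 0 := by simpa using nm_smul 0 (0 : SS)
    linarith
  · rw [TT_Em h.ta h.tq, nm_Em, nm_Em, ← hwdef, hv]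
    have t1 := nm_add_le (RR a q c v) ((2 * Complex.I * b) • y)
    have t2 : nm ((2 * Complex.I * b) • y) = 2 * b * nm y := by
      rw [nm_smul]; simp [abs_of_pos hb]
    rw [t2] at t1
    have t3 := mul_le_mul_of_nonneg_left (t1.trans (add_le_add_left hRb _)) M0.le
    have t4 : M * (138 * (K + Γ) ^ 2 * (1 + c ^ 2) * nm v) ≤ N * (138 * (K + Γ) ^ 2 * (1 + c ^ 2) * nm v) := by
      gcongr
    have t5 : 2 * b * (M * nm y) ≤ 2 * b * nm v := by gcongr
    nlinarith

lemma nm_sub_sq (u v : SS) : nm (u - v) ^ 2 = nm u ^ 2 - 2 * rp u v + nm v ^ 2 := by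
  rw [nm_sq, nm_sq, nm_sq, rp_sub_left, rp_sub_right, rp_sub_right, rp_comm v u]; ring

lemma rp_DD (g : SS) : rp (Dv (Dv g)) g = -nm (Dv g) ^ 2 := by
  rw [rp_D, nm_sq]

/-- norm identity for the resolvent of the second derivative -/
lemma G_id (b : ℝ) (g u : SS) (h : -Dv (Dv g) + ((3 * b ^ 2 : ℝ) : ℂ) • g = u) :
    nm u ^ 2 = nm (Dv (Dv g)) ^ 2 + 6 * b ^ 2 * nm (Dv g) ^ 2 + 9 * b ^ 4 * nm g ^ 2 := by
  rw [← h, nm_add_sq, nm_neg, rp_neg_left, rp_smul_right, rp_DD, nm_smul_real _ (by positivity)]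
  ring

lemma G_bounds (b : ℝ) (hb : 0 < b) (g u : SS)
    (h : -Dv (Dv g) + ((3 * b ^ 2 : ℝ) : ℂ) • g = u) :
    nm (Dv (Dv g)) ≤ nm u ∧ b * nm (Dv g) ≤ nm u ∧ 3 * (b ^ 2 * nm g) ≤ nm u := by
  have h1 := G_id b g u h
  have p1 := nm_nonneg (Dv (Dv g))
  have p2 := nm_nonneg (Dv g)
  have p3 := nm_nonneg g
  have p4 := nm_nonneg u
  have q1 : 0 ≤ (b * nm (Dv g)) ^ 2 := by positivity
  have q2 : 0 ≤ (b ^ 2 * nm g) ^ 2 := by positivity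
  refine ⟨?_, ?_, ?_⟩
  · apply le_of_sq_le_sq _ p4; nlinarith
  · apply le_of_sq_le_sq _ p4; nlinarith [sq_nonneg (nm (Dv (Dv g)))]
  · apply le_of_sq_le_sq _ p4; nlinarith [sq_nonneg (nm (Dv (Dv g)))]

lemma temp_mul {p r : ℝ → ℝ} (hp : p.HasTemperateGrowth) (hr : r.HasTemperateGrowth) :
    (fun x => p x * r x).HasTemperateGrowth := hp.mul hr

lemma Ml_Ml {p r : ℝ → ℝ} (hp : p.HasTemperateGrowth) (hr : r.HasTemperateGrowth) (u : SS) :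
    Ml p (Ml r u) = Ml (fun x => p x * r x) u := by
  ext x
  rw [Ml_apply hp, Ml_apply hr, Ml_apply (temp_mul hp hr)]; push_cast; ring

/-- decomposition of `T` in real and imaginary coefficients -/
lemma TT_decomp (a q : ℝ → ℝ) (c b : ℝ) (u : SS) :
    TT a q (-(c : ℂ) + Complex.I * (b : ℂ)) u =
      -Dv (Dv u) + Ml q u + ((-(2 * c) : ℝ) : ℂ) • Ml a u
        + ((2 * b : ℝ) : ℂ) • (Complex.I • Ml a u) + ((c ^ 2 - b ^ 2 : ℝ) : ℂ) • u
        + ((-(2 * b * c) : ℝ) : ℂ) • (Complex.I • u) := by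
  have h2 : (-(c : ℂ) + Complex.I * (b : ℂ)) ^ 2 = (c : ℂ) ^ 2 - (b : ℂ) ^ 2 - 2 * Complex.I * b * c := by
    linear_combination (b : ℂ) ^ 2 * Complex.I_sq
  rw [TT, h2]
  push_cast
  module

lemma apriori_num1 (b c Γ U X F d : ℝ) (hb : 16 * Γ ≤ b) (hG : 1 ≤ Γ) (hc : 0 ≤ c) (hcb : c ≤ b)
    (hU : 0 ≤ U) (hX : 0 ≤ X) (hF : 0 ≤ F)
    (h : d ^ 2 ≤ U * F * b + 2 * c * (X * U) + b ^ 2 * U ^ 2 + Γ * (U * (U + X))) :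
    d ≤ 2 * b * U + X + F := by
  have hΓ : 0 ≤ Γ := by linarith
  have b1 : 1 ≤ b := by linarith
  apply le_of_sq_le_sq _ (by positivity)
  have e1 : c * (X * U) ≤ b * (X * U) := by gcongr
  have e2 : Γ * (U * (U + X)) ≤ b * (U * (U + X)) := by gcongr; linarith
  have e3 : b * U ^ 2 ≤ b ^ 2 * U ^ 2 := by gcongr; nlinarith
  have e4 : 0 ≤ U * F * b := by positivity
  have e5 : 0 ≤ b * (X * U) := by positivity
  have e6 : 0 ≤ X * F := by positivity
  have e7 : 0 ≤ b ^ 2 * U ^ 2 := by positivity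
  nlinarith [sq_nonneg X, sq_nonneg F]

lemma apriori_num2 (b c Γ U X F d V : ℝ) (hb : 16 * Γ ≤ b) (hG : 1 ≤ Γ) (hc : 0 ≤ c)
    (hU : 0 ≤ U) (hX : 0 ≤ X) (hF : 0 ≤ F) (hV : V = (1 + c) * U + F)
    (hd : d ≤ 2 * b * U + X + F)
    (h : 2 * b * X ^ 2 ≤ X * (F * b) + Γ * (U + X) * d + 2 * b * c * (X * U)) :
    X ≤ 7 * Γ * V := by
  have b0 : 0 < b := by linarith
  have hΓ : 0 ≤ Γ := by linarith
  have h1 : 2 * b * X ^ 2 ≤ X * (F * b) + Γ * (U + X) * (2 * b * U + X + F) + 2 * b * c * (X * U) := by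
    refine h.trans ?_
    gcongr
  have cU : 0 ≤ c * U := by positivity
  have uV : U ≤ V := by rw [hV]; nlinarith
  have fV : F ≤ V := by rw [hV]; nlinarith
  have cV : c * U ≤ V := by rw [hV]; nlinarith
  have V0 : 0 ≤ V := hU.trans uV
  obtain ⟨G, hGd⟩ : ∃ G, G = Γ * V := ⟨_, rfl⟩
  have VG : V ≤ G := by rw [hGd]; nlinarith
  have G0 : 0 ≤ G := V0.trans VG
  have s1 : Γ * (U + X) * (X + F) ≤ b / 16 * ((U + X) * (X + F)) := by
    have : 0 ≤ (U + X) * (X + F) := by positivity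
    nlinarith
  have s2 : (U + X) * (X + F) ≤ X ^ 2 + 2 * (X * G) + G ^ 2 := by
    have : (U + X) * (X + F) ≤ (G + X) * (X + G) := by
      gcongr <;> linarith
    nlinarith
  have s3 : Γ * (U + X) * (2 * b * U) ≤ 2 * b * (G * (G + X)) := by
    have t1 : Γ * U ≤ G := by rw [hGd]; gcongr
    have t2 : (Γ * U) * (U + X) ≤ G * (G + X) := by
      gcongr
      linarith
    have : Γ * (U + X) * (2 * b * U) = 2 * b * ((Γ * U) * (U + X)) := by ring
    rw [this]
    gcongr
  have s4 : 2 * b * c * (X * U) ≤ 2 * b * (X * G) := by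
    have : 2 * b * c * (X * U) = 2 * b * (X * (c * U)) := by ring
    rw [this]
    gcongr
    linarith
  have s5 : X * (F * b) ≤ b * (X * G) := by
    have : X * (F * b) = b * (X * F) := by ring
    rw [this]
    gcongr
    linarith
  have key : b * (2 * X ^ 2) ≤ b * ((1 / 16) * X ^ 2 + 6 * (X * G) + 3 * G ^ 2) := by
    have : b / 16 * ((U + X) * (X + F)) ≤ b / 16 * (X ^ 2 + 2 * (X * G) + G ^ 2) := by gcongr
    have p1 : 0 ≤ b * (X * G) := by positivity
    have p2 : 0 ≤ b * G ^ 2 := by positivity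
    nlinarith
  have key2 := le_of_mul_le_mul_left key b0
  have : X ≤ 7 * G := by
    by_contra hcon
    push Not at hcon
    nlinarith
  rw [hGd] at this
  linarith

lemma apriori {a q : ℝ → ℝ} {Γ : ℝ} (h : Good a q Γ) (c b : ℝ) (hc : 0 ≤ c) (hcb : c ≤ b)
    (hb : 16 * Γ ≤ b) (u f : SS) (hf : TT a q (-(c : ℂ) + Complex.I * (b : ℂ)) u = f) :
    nm (Ml a u) ≤ 7 * Γ * ((1 + c) * nm u + nm f / b) := by
  have hG := h.G1
  have b0 : 0 < b := by linarith
  have hfb : nm f = nm f / b * b := by field_simp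
  have z1 : rp (Complex.I • Ml a u) (Ml a u) = 0 := by rw [rp_comm]; exact rp_I_self _
  have z2 : rp (Complex.I • Ml a u) (Ml q u) = 0 := by
    rw [← rp_M h.tq, map_smul, Ml_Ml h.tq h.ta, rp_I]
    have := rp_I_Ml (temp_mul h.tq h.ta) u
    rw [← rp_M (temp_mul h.tq h.ta), map_smul, rp_I] at this
    exact this
  have z3 : rp u (Complex.I • Ml a u) = 0 := by
    have := rp_I u (Ml a u)
    rw [rp_I_Ml h.ta] at this
    linarith
  have z4 : rp (Complex.I • Ml a u) u = 0 := by rw [rp_comm]; exact z3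
  have gb := nm_Ml_le h.ta h.a0 h.tq Γ (by linarith) h.qa u
  have e1 : rp u f = nm (Dv u) ^ 2 + rp u (Ml q u) - 2 * c * rp u (Ml a u)
      + (c ^ 2 - b ^ 2) * nm u ^ 2 := by
    rw [← hf, TT_decomp]
    simp only [rp_add_right, rp_neg_right, rp_smul_right, rp_I_self, z3]
    rw [rp_comm u (Dv (Dv u)), rp_DD, nm_sq u]
    ring
  have d1 : nm (Dv u) ≤ 2 * b * nm u + nm (Ml a u) + nm f / b := by
    apply apriori_num1 b c Γ _ _ _ _ hb hG hc hcb (nm_nonneg _) (nm_nonneg _)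
      (div_nonneg (nm_nonneg _) b0.le)
    have t1 := rp_le u f
    have t2 := rp_ge u (Ml q u)
    have t3 := rp_le u (Ml a u)
    have t4 := mul_le_mul_of_nonneg_left gb (nm_nonneg u)
    have t5 := mul_le_mul_of_nonneg_left t3 hc
    have t6 : 0 ≤ c ^ 2 * nm u ^ 2 := by positivity
    have t7 : nm u * (nm f / b) * b = nm u * nm f := by field_simp
    rw [t7]
    nlinarith
  have e2 : rp (Complex.I • Ml a u) f = rp (Complex.I • Ml (deriv a) u) (Dv u)
      + 2 * b * nm (Ml a u) ^ 2 - 2 * b * c * rp (Ml a u) u := by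
    rw [← hf, TT_decomp]
    simp only [rp_add_right, rp_neg_right, rp_smul_right, rp_I_I, z1, z2, z4]
    have t1 : rp (Complex.I • Ml a u) (Dv (Dv u)) = -rp (Complex.I • Ml (deriv a) u) (Dv u) := by
      have s1 := rp_D (Complex.I • Ml a u) (Dv u)
      have s2 : rp (Complex.I • Ml a (Dv u)) (Dv u) = 0 := by
        have s3 := rp_I_Ml h.ta (Dv u)
        rw [← rp_M h.ta, map_smul] at s3
        exact s3
      rw [map_smul, D_M h.ta, smul_add, rp_add_left, s2] at s1
      linarith
    rw [t1, nm_sq]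
    ring
  refine apriori_num2 b c Γ (nm u) (nm (Ml a u)) (nm f / b) (nm (Dv u)) _ hb hG hc (nm_nonneg _)
    (nm_nonneg _) (div_nonneg (nm_nonneg _) b0.le) rfl d1 ?_
  have hI : ∀ v : SS, nm (Complex.I • v) = nm v := fun v => by rw [nm_smul]; simp
  have t1 := rp_le (Complex.I • Ml a u) f
  have t2 := rp_ge (Complex.I • Ml (deriv a) u) (Dv u)
  have t3 := rp_le (Ml a u) u
  rw [hI] at t1 t2
  have gd := nm_Ml_le h.ta h.a0 (temp_deriv h.ta) Γ (by linarith) h.da u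
  have t4 := mul_le_mul_of_nonneg_right gd (nm_nonneg (Dv u))
  have t5 := mul_le_mul_of_nonneg_left t3 (by positivity : 0 ≤ 2 * b * c)
  rw [← hfb]
  linarith

lemma DD_M {p : ℝ → ℝ} (hp : p.HasTemperateGrowth) (u : SS) :
    Dv (Dv (Ml p u)) = Ml (deriv (deriv p)) u + (2 : ℂ) • Ml (deriv p) (Dv u) + Ml p (Dv (Dv u)) := by
  rw [D_M hp, map_add, D_M (temp_deriv hp), D_M hp]
  module

lemma M_G {p : ℝ → ℝ} (hp : p.HasTemperateGrowth) (b : ℝ) (g u : SS)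
    (h : -Dv (Dv g) + ((3 * b ^ 2 : ℝ) : ℂ) • g = u) :
    -Dv (Dv (Ml p g)) + ((3 * b ^ 2 : ℝ) : ℂ) • Ml p g =
      Ml p u - Ml (deriv (deriv p)) g - (2 : ℂ) • Ml (deriv p) (Dv g) := by
  rw [← h, DD_M hp, map_add, map_neg, map_smul]
  module

lemma nm_two (u : SS) : nm ((2 : ℂ) • u) = 2 * nm u := by rw [nm_smul]; simp

lemma wg_num (b Γ U X ng np nd nr nD Z : ℝ) (hb : 16 * Γ ≤ b) (hG : 1 ≤ Γ)
    (hU : 0 ≤ U) (hX : 0 ≤ X) (h0 : 0 ≤ ng) (h1 : 0 ≤ np) (h2 : 0 ≤ nd) (h3 : 0 ≤ nr) (hD : 0 ≤ nD)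
    (g1 : 3 * (b ^ 2 * ng) ≤ U) (g2 : b * nd ≤ U)
    (p1 : 3 * (b ^ 2 * np) ≤ Z) (p2 : b * nD ≤ Z)
    (r1 : nr ≤ nD + Γ * (ng + np))
    (hZ : Z ≤ X + Γ * (ng + np) + 2 * (Γ * (nd + nr))) :
    b ^ 2 * (ng + np) ≤ U + X ∧ b * (nd + nr) ≤ 4 * (U + X) := by
  have b0 : 16 ≤ b := by linarith
  have Γ0 : 0 ≤ Γ := by linarith
  have k1 : 3 * (b ^ 2 * (ng + np)) ≤ U + Z := by linarith
  obtain ⟨s, hs⟩ : ∃ s, s = ng + np := ⟨_, rfl⟩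
  rw [← hs] at r1 hZ k1 ⊢
  have s0 : 0 ≤ s := by rw [hs]; linarith
  have k2 : 16 * (Γ * nd) ≤ b * nd := by nlinarith
  have k3 : 16 * (Γ * nD) ≤ b * nD := by nlinarith
  have k4 : 16 * (Γ * (Γ * s)) ≤ b * (Γ * s) := by nlinarith [mul_nonneg Γ0 s0]
  have k5 : 16 * (b * (Γ * s)) ≤ b ^ 2 * s := by
    have : 16 * (Γ * (b * s)) ≤ b * (b * s) := by nlinarith [mul_nonneg (by linarith : 0 ≤ b) s0]
    nlinarith
  have k6 : 16 * (Γ * s) ≤ b * (Γ * s) := by nlinarith [mul_nonneg Γ0 s0]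
  have k7 : Γ * nr ≤ Γ * nD + Γ * (Γ * s) := by nlinarith
  have k8 : b * nr ≤ b * nD + b * (Γ * s) := by nlinarith
  have key : Z ≤ 2 * X + U := by nlinarith
  constructor <;> nlinarith

lemma wg {a q : ℝ → ℝ} {Γ : ℝ} (h : Good a q Γ) (b : ℝ) (hb : 16 * Γ ≤ b) (g u : SS)
    (hg : -Dv (Dv g) + ((3 * b ^ 2 : ℝ) : ℂ) • g = u) :
    b ^ 2 * (nm g + nm (Ml a g)) ≤ nm u + nm (Ml a u) ∧
    b * (nm (Dv g) + nm (Ml a (Dv g))) ≤ 4 * (nm u + nm (Ml a u)) := by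
  have hG := h.G1
  have b0 : 0 < b := by linarith
  obtain ⟨-, g2, g1⟩ := G_bounds b b0 g u hg
  obtain ⟨-, p2, p1⟩ := G_bounds b b0 _ _ (M_G h.ta b g u hg)
  have d1 := nm_Ml_le h.ta h.a0 (temp_deriv h.ta) Γ (by linarith) h.da
  have d2 := nm_Ml_le h.ta h.a0 (temp_deriv (temp_deriv h.ta)) Γ (by linarith) h.dda
  refine wg_num b Γ (nm u) (nm (Ml a u)) (nm g) (nm (Ml a g)) (nm (Dv g)) (nm (Ml a (Dv g)))
    (nm (Dv (Ml a g))) _ hb hG (nm_nonneg _) (nm_nonneg _) (nm_nonneg _) (nm_nonneg _)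
    (nm_nonneg _) (nm_nonneg _) (nm_nonneg _) g1 g2 p1 p2 ?_ ?_
  · have : Ml a (Dv g) = Dv (Ml a g) - Ml (deriv a) g := by rw [D_M h.ta]; abel
    rw [this]
    exact (nm_sub_le _ _).trans (by linarith [d1 g])
  · have t1 := nm_sub_le (Ml a u - Ml (deriv (deriv a)) g) ((2 : ℂ) • Ml (deriv a) (Dv g))
    have t2 := nm_sub_le (Ml a u) (Ml (deriv (deriv a)) g)
    rw [nm_two] at t1
    linarith [d1 (Dv g), d2 g]

noncomputable def W1o (a q : ℝ → ℝ) (lam : ℂ) (u : SS) : SS :=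
  Ml (deriv q) u + (2 * lam) • Ml (deriv a) u

noncomputable def W2o (a q : ℝ → ℝ) (lam : ℂ) (u : SS) : SS :=
  Ml (deriv (deriv q)) u + (2 * lam) • Ml (deriv (deriv a)) u

lemma lam_bound (c b : ℝ) (hc : 0 ≤ c) (hcb : c ≤ b) :
    ‖2 * (-(c : ℂ) + Complex.I * (b : ℂ))‖ ≤ 4 * b := by
  have b0 : 0 ≤ b := hc.trans hcb
  rw [norm_mul]
  have := norm_add_le (-(c : ℂ)) (Complex.I * (b : ℂ))
  rw [norm_neg, norm_mul, Complex.norm_I, Complex.norm_real, Complex.norm_real, Real.norm_eq_abs,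
    Real.norm_eq_abs, abs_of_nonneg hc, abs_of_nonneg b0] at this
  have h2 : ‖(2 : ℂ)‖ = 2 := by simp
  rw [h2]
  linarith

lemma comb_bound (b s Γ : ℝ) (lam : ℂ) (hb : 1 ≤ b) (hl : ‖2 * lam‖ ≤ 4 * b) (x y : SS)
    (hx : nm x ≤ Γ * s) (hy : nm y ≤ Γ * s) : nm (x + (2 * lam) • y) ≤ 5 * Γ * (b * s) := by
  have t1 := nm_add_le x ((2 * lam) • y)
  rw [nm_smul] at t1
  have t2 : ‖2 * lam‖ * nm y ≤ 4 * b * (Γ * s) :=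
    mul_le_mul hl hy (nm_nonneg _) (by linarith)
  have t3 : 0 ≤ Γ * s := (nm_nonneg x).trans hx
  nlinarith

lemma W1_bound {a q : ℝ → ℝ} {Γ : ℝ} (h : Good a q Γ) (b : ℝ) (lam : ℂ) (hb : 1 ≤ b)
    (hl : ‖2 * lam‖ ≤ 4 * b) (u : SS) :
    nm (W1o a q lam u) ≤ 5 * Γ * (b * (nm u + nm (Ml a u))) := by
  have hG := h.G1
  exact comb_bound b _ Γ lam hb hl _ _
    (nm_Ml_le h.ta h.a0 (temp_deriv h.tq) Γ (by linarith) h.dq u)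
    (nm_Ml_le h.ta h.a0 (temp_deriv h.ta) Γ (by linarith) h.da u)

lemma W2_bound {a q : ℝ → ℝ} {Γ : ℝ} (h : Good a q Γ) (b : ℝ) (lam : ℂ) (hb : 1 ≤ b)
    (hl : ‖2 * lam‖ ≤ 4 * b) (u : SS) :
    nm (W2o a q lam u) ≤ 5 * Γ * (b * (nm u + nm (Ml a u))) := by
  have hG := h.G1
  exact comb_bound b _ Γ lam hb hl _ _
    (nm_Ml_le h.ta h.a0 (temp_deriv (temp_deriv h.tq)) Γ (by linarith) h.ddq u)
    (nm_Ml_le h.ta h.a0 (temp_deriv (temp_deriv h.ta)) Γ (by linarith) h.dda u)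

lemma TT_G {a q : ℝ → ℝ} (ha : a.HasTemperateGrowth) (hq : q.HasTemperateGrowth) (b : ℝ) (lam : ℂ)
    (g u : SS) (h : -Dv (Dv g) + ((3 * b ^ 2 : ℝ) : ℂ) • g = u) :
    -Dv (Dv (TT a q lam g)) + ((3 * b ^ 2 : ℝ) : ℂ) • TT a q lam g =
      TT a q lam u - (W2o a q lam g + (2 : ℂ) • W1o a q lam (Dv g)) := by
  rw [← h]
  simp only [TT, W1o, W2o, map_add, map_neg, map_smul, DD_M ha, DD_M hq]
  module

/-- the existence of the auxiliary functions with bounds -/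
lemma setup {a q : ℝ → ℝ} {Γ : ℝ} (h : Good a q Γ) (c b : ℝ) (hc : 0 ≤ c) (hcb : c ≤ b)
    (hb : 16 * Γ ≤ b) (u f : SS) (hf : TT a q (-(c : ℂ) + Complex.I * (b : ℂ)) u = f) :
    ∃ g k l : SS, -Dv (Dv g) + ((3 * b ^ 2 : ℝ) : ℂ) • g = u ∧
      -Dv (Dv k) + ((3 * b ^ 2 : ℝ) : ℂ) • k = f ∧
      k = TT a q (-(c : ℂ) + Complex.I * (b : ℂ)) g + l ∧
      b ^ 2 * (nm g + nm (Ml a g)) ≤ nm u + nm (Ml a u) ∧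
      b * (nm (Dv g) + nm (Ml a (Dv g))) ≤ 4 * (nm u + nm (Ml a u)) ∧
      b ^ 2 * nm l ≤ 15 * Γ * (nm u + nm (Ml a u)) ∧
      b * nm (Dv l) ≤ 45 * Γ * (nm u + nm (Ml a u)) ∧
      b * nm (W1o a q (-(c : ℂ) + Complex.I * (b : ℂ)) g) ≤ 5 * Γ * (nm u + nm (Ml a u)) := by
  have hG := h.G1
  have b1 : 1 ≤ b := by linarith
  have b0 : 0 < b := by linarith
  have hl := lam_bound c b hc hcb
  set lam := -(c : ℂ) + Complex.I * (b : ℂ)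
  obtain ⟨g, hg⟩ := G_solve b b1 u
  obtain ⟨l, hl'⟩ := G_solve b b1 (W2o a q lam g + (2 : ℂ) • W1o a q lam (Dv g))
  obtain ⟨s1, s2⟩ := wg h b hb g u hg
  have w1 := W1_bound h b lam b1 hl g
  have w2 := W2_bound h b lam b1 hl g
  have w3 := W1_bound h b lam b1 hl (Dv g)
  set m := nm u + nm (Ml a u) with hm
  have m0 : 0 ≤ m := add_nonneg (nm_nonneg _) (nm_nonneg _)
  have u1 : 5 * Γ * (b * (b * (nm g + nm (Ml a g)))) ≤ 5 * Γ * m := by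
    gcongr
    linarith
  have u2 : 5 * Γ * (b * (nm (Dv g) + nm (Ml a (Dv g)))) ≤ 5 * Γ * (4 * m) := by gcongr
  have u3 : b * nm (W1o a q lam g) ≤ 5 * Γ * m := by
    have := mul_le_mul_of_nonneg_left w1 b0.le
    linarith
  have u4 : nm (W2o a q lam g) ≤ 5 * Γ * m := by
    have := mul_le_mul_of_nonneg_left w2 b0.le
    have := mul_le_mul_of_nonneg_right b1 (nm_nonneg (W2o a q lam g))
    linarith
  have u5 : nm (W2o a q lam g + (2 : ℂ) • W1o a q lam (Dv g)) ≤ 45 * Γ * m := by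
    have := nm_add_le (W2o a q lam g) ((2 : ℂ) • W1o a q lam (Dv g))
    rw [nm_two] at this
    linarith
  obtain ⟨-, v1, v2⟩ := G_bounds b b0 _ _ hl'
  refine ⟨g, TT a q lam g + l, l, hg, ?_, rfl, s1, s2, by linarith, by linarith, u3⟩
  have := TT_G h.ta h.tq b lam g u hg
  rw [hf] at this
  have e : f = (f - (W2o a q lam g + (2 : ℂ) • W1o a q lam (Dv g))) +
    (W2o a q lam g + (2 : ℂ) • W1o a q lam (Dv g)) := by abel
  rw [e, ← this, ← hl', map_add, map_add]
  module

noncomputable def zo (b : ℝ) (g : SS) : SS := -Dv (Dv g) - ((b ^ 2 : ℝ) : ℂ) • g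

noncomputable def Bo (β : ℝ) (g : SS) : SS := -(Complex.I • Dv g) + (β : ℂ) • g

noncomputable def Ro (a q : ℝ → ℝ) (c : ℝ) (g : SS) : SS :=
  Ml q g - ((2 * c : ℝ) : ℂ) • Ml a g + ((c ^ 2 : ℝ) : ℂ) • g

noncomputable def vo (b β : ℝ) (g : SS) : SS := zo b g + ((2 * β : ℝ) : ℂ) • Bo β g

lemma TT_zo (a q : ℝ → ℝ) (c b : ℝ) (g : SS) :
    TT a q (-(c : ℂ) + Complex.I * (b : ℂ)) g =
      zo b g + Ro a q c g + (2 * Complex.I * b) • (Ml a g - (c : ℂ) • g) := by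
  rw [TT_decomp]
  simp only [zo, Ro]
  push_cast
  module

lemma D_vo (b σ : ℝ) (hσ : σ = 1 ∨ σ = -1) (g : SS) :
    (2 * Complex.I * b) • ((((-σ : ℝ)) : ℂ) • Dv (vo b (σ * b) g) + (Complex.I * b) • vo b (σ * b) g)
      = ((2 * (σ * b) : ℝ) : ℂ) • Bo (σ * b) (zo b g) := by
  have hI := Complex.I_sq
  rcases hσ with rfl | rfl
  all_goals
    simp only [vo, zo, Bo, map_add, map_neg, map_smul, map_sub]
    push_cast
    match_scalars <;> ring_nf <;> simp only [Complex.I_sq, Complex.I_pow_three] <;> ring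

lemma Bo_add (β : ℝ) (x y : SS) : Bo β (x + y) = Bo β x + Bo β y := by
  simp only [Bo, map_add]; module

lemma Bo_smul (β : ℝ) (r : ℂ) (x : SS) : Bo β (r • x) = r • Bo β x := by
  simp only [Bo, map_smul]; module

lemma Bo_M {p : ℝ → ℝ} (hp : p.HasTemperateGrowth) (β : ℝ) (x : SS) :
    Bo β (Ml p x) = Ml p (Bo β x) - Complex.I • Ml (deriv p) x := by
  simp only [Bo, D_M hp, map_add, map_neg, map_smul]; module

lemma key_id {a q : ℝ → ℝ} (ha : a.HasTemperateGrowth) (hq : q.HasTemperateGrowth) (c b σ : ℝ)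
    (hσ : σ = 1 ∨ σ = -1) (g k l : SS)
    (hk : k = TT a q (-(c : ℂ) + Complex.I * (b : ℂ)) g + l) :
    (2 * Complex.I * b) • Lo (-σ) b (fun x => a x - c) (vo b (σ * b) g) =
      ((2 * (σ * b) : ℝ) : ℂ) • Bo (σ * b) k
      + ((2 * b : ℝ) : ℂ) • (Complex.I • Ml (fun x => a x - c) (zo b g))
      - ((2 * (σ * b) : ℝ) : ℂ) • Ro a q c (Bo (σ * b) g)
      + ((2 * (σ * b) : ℝ) : ℂ) • (Complex.I • W1o a q (-(c : ℂ) + Complex.I * (b : ℂ)) g)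
      - ((2 * (σ * b) : ℝ) : ℂ) • Bo (σ * b) l := by
  rw [Lo, smul_add, D_vo b σ hσ, hk, TT_zo]
  have e1 : Bo (σ * b) (zo b g + Ro a q c g + (2 * Complex.I * b) • (Ml a g - (c : ℂ) • g) + l) =
      Bo (σ * b) (zo b g) + Ro a q c (Bo (σ * b) g) - Complex.I • W1o a q (-(c : ℂ) + Complex.I * (b : ℂ)) g
       + (2 * Complex.I * b) • (Ml a (Bo (σ * b) g) - (c : ℂ) • Bo (σ * b) g) + Bo (σ * b) l := by
    have : Ro a q c g = Ml q g + (-((2 * c : ℝ) : ℂ)) • Ml a g + ((c ^ 2 : ℝ) : ℂ) • g := by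
      simp only [Ro]; module
    rw [this]
    have h2 : Ml a g - (c : ℂ) • g = Ml a g + (-(c : ℂ)) • g := by module
    rw [h2]
    simp only [Bo_add, Bo_smul, Bo_M ha, Bo_M hq, Ro, W1o]
    push_cast
    module
  rw [e1, vo, Ml_sub_const ha]
  simp only [map_add, map_smul, Ml_sub_const ha]
  push_cast
  module

lemma nm_I (v : SS) : nm (Complex.I • v) = nm v := by rw [nm_smul]; simp

lemma zo_bound {a q : ℝ → ℝ} {Γ : ℝ} (h : Good a q Γ) (c b m U F : ℝ) (hc : 0 ≤ c) (hcb : c ≤ b)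
    (hb : 16 * Γ ≤ b) (g k l : SS) (hk : k = TT a q (-(c : ℂ) + Complex.I * (b : ℂ)) g + l)
    (h1 : b ^ 2 * (nm g + nm (Ml a g)) ≤ m) (h2 : 3 * (b ^ 2 * nm g) ≤ U)
    (h3 : b ^ 2 * nm l ≤ 15 * Γ * m) (h4 : b * (b * nm k) ≤ b * F) :
    b * nm (zo b g) ≤ 5 * (m + c * U + F) := by
  have hG := h.G1
  have b0 : 0 < b := by linarith
  have hl := lam_bound c b hc hcb
  have g0 := nm_nonneg g
  have p0 := nm_nonneg (Ml a g)
  have m0 : 0 ≤ m := le_trans (by positivity) h1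
  have U0 : 0 ≤ U := le_trans (by positivity) h2
  have e : zo b g = k - l - (Ml q g + (2 * (-(c : ℂ) + Complex.I * (b : ℂ))) • Ml a g)
      - (((c ^ 2 : ℝ) : ℂ) • g - ((2 * b * c : ℝ) : ℂ) • (Complex.I • g)) := by
    rw [hk, TT_zo, Ro]; push_cast; module
  have t1 : nm (zo b g) ≤ nm k + nm l + nm (Ml q g) + 4 * b * nm (Ml a g) + 3 * b * c * nm g := by
    rw [e]
    have s1 := nm_sub_le (k - l - (Ml q g + (2 * (-(c : ℂ) + Complex.I * (b : ℂ))) • Ml a g))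
      (((c ^ 2 : ℝ) : ℂ) • g - ((2 * b * c : ℝ) : ℂ) • (Complex.I • g))
    have s2 := nm_sub_le (k - l) (Ml q g + (2 * (-(c : ℂ) + Complex.I * (b : ℂ))) • Ml a g)
    have s3 := nm_sub_le k l
    have s4 := nm_add_le (Ml q g) ((2 * (-(c : ℂ) + Complex.I * (b : ℂ))) • Ml a g)
    rw [nm_smul] at s4
    have s5 := mul_le_mul_of_nonneg_right hl p0
    have s6 := nm_sub_le (((c ^ 2 : ℝ) : ℂ) • g) (((2 * b * c : ℝ) : ℂ) • (Complex.I • g))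
    rw [nm_smul_real _ (by positivity), nm_smul_real _ (by positivity), nm_I] at s6
    have s7 : c ^ 2 * nm g ≤ b * c * nm g := by gcongr; nlinarith
    linarith
  have gq := nm_Ml_le h.ta h.a0 h.tq Γ (by linarith) h.qa g
  have hs : 0 ≤ nm g + nm (Ml a g) := by positivity
  -- multiply by b
  have u1 := mul_le_mul_of_nonneg_left t1 b0.le
  have u2 : b * nm k ≤ F := le_of_mul_le_mul_left h4 b0
  have u3 : b * nm l ≤ m := by
    have : b * (b * nm l) ≤ b * m := by nlinarith
    exact le_of_mul_le_mul_left this b0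
  have u4 : 16 * (b * nm (Ml q g)) ≤ m := by
    have : 16 * Γ * (b * (nm g + nm (Ml a g))) ≤ b * (b * (nm g + nm (Ml a g))) := by gcongr
    have : b * nm (Ml q g) ≤ b * (Γ * (nm g + nm (Ml a g))) := by gcongr
    linarith
  have u3' : 16 * (b * nm l) ≤ 15 * m := by
    have : b * (16 * (b * nm l)) ≤ b * (15 * m) := by nlinarith
    exact le_of_mul_le_mul_left this b0
  have u5 : b ^ 2 * nm (Ml a g) ≤ m := by
    have : 0 ≤ b ^ 2 * nm g := by positivity
    linarith
  have u6 : c * (3 * (b ^ 2 * nm g)) ≤ c * U := by gcongr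
  have F0 : 0 ≤ F := le_trans (by have := nm_nonneg k; positivity) u2
  have cU : 0 ≤ c * U := by positivity
  nlinarith

lemma Ro_bound {a q : ℝ → ℝ} {Γ : ℝ} (h : Good a q Γ) (c : ℝ) (hc : 0 ≤ c) (g : SS) :
    nm (Ro a q c g) ≤ (Γ + 2 * c) * (nm g + nm (Ml a g)) + c ^ 2 * nm g := by
  have hG := h.G1
  have gq := nm_Ml_le h.ta h.a0 h.tq Γ (by linarith) h.qa g
  have s1 := nm_add_le (Ml q g - ((2 * c : ℝ) : ℂ) • Ml a g) (((c ^ 2 : ℝ) : ℂ) • g)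
  have s2 := nm_sub_le (Ml q g) (((2 * c : ℝ) : ℂ) • Ml a g)
  rw [nm_smul_real _ (by positivity)] at s1 s2
  have : 0 ≤ c * nm g := mul_nonneg hc (nm_nonneg _)
  rw [Ro]
  linarith

lemma Ro_Bo {a q : ℝ → ℝ} (ha : a.HasTemperateGrowth) (hq : q.HasTemperateGrowth) (c β : ℝ) (g : SS) :
    Ro a q c (Bo β g) = -(Complex.I • Ro a q c (Dv g)) + (β : ℂ) • Ro a q c g := by
  simp only [Ro, Bo, map_add, map_neg, map_smul]; module

lemma nm_sb (b σ : ℝ) (hb : 0 < b) (hσ : σ = 1 ∨ σ = -1) (x : SS) :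
    nm (((2 * (σ * b) : ℝ) : ℂ) • x) = 2 * b * nm x := by
  rw [nm_smul, Complex.norm_real, Real.norm_eq_abs]
  congr 1
  rcases hσ with rfl | rfl
  · rw [abs_of_nonneg] <;> linarith
  · rw [abs_of_nonpos] <;> linarith

lemma nm_comb (b σ : ℝ) (hb : 0 < b) (hσ : σ = 1 ∨ σ = -1) (x y : SS) :
    nm (-(Complex.I • x) + ((σ * b : ℝ) : ℂ) • y) ≤ nm x + b * nm y := by
  refine (nm_add_le _ _).trans ?_
  rw [nm_neg, nm_I, nm_smul, Complex.norm_real, Real.norm_eq_abs]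
  have : |σ * b| = b := by
    rcases hσ with rfl | rfl
    · rw [abs_of_nonneg] <;> linarith
    · rw [abs_of_nonpos] <;> linarith
  rw [this]

/-- numeric part for the Ro term -/
lemma ro_num (b c Γ m U Y F g p d r ρ ρ' : ℝ) (hG : 1 ≤ Γ) (hc : 0 ≤ c) (b0 : 0 < b)
    (hcU : 0 ≤ c * U) (hF : 0 ≤ F) (hm : 0 ≤ m) (hY : Y = m + c * U + F)
    (h1 : b ^ 2 * (g + p) ≤ m) (h2 : b * (d + r) ≤ 4 * m) (h3 : 3 * (b ^ 2 * g) ≤ U) (h4 : b * d ≤ U)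
    (hρ : ρ ≤ (Γ + 2 * c) * (g + p) + c ^ 2 * g) (hρ' : ρ' ≤ (Γ + 2 * c) * (d + r) + c ^ 2 * d)
    (g0 : 0 ≤ g) :
    2 * b * (ρ' + b * ρ) ≤ 24 * Γ * (1 + c) * Y := by
  have x1 : b * ρ' ≤ (Γ + 2 * c) * (4 * m) + c * (c * U) := by
    calc b * ρ' ≤ b * ((Γ + 2 * c) * (d + r) + c ^ 2 * d) := by gcongr
      _ = (Γ + 2 * c) * (b * (d + r)) + c ^ 2 * (b * d) := by ring
      _ ≤ (Γ + 2 * c) * (4 * m) + c ^ 2 * U := by gcongr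
      _ = _ := by ring
  have x2 : b ^ 2 * ρ ≤ (Γ + 2 * c) * m + c * (c * U) := by
    have h3' : b ^ 2 * g ≤ U := by nlinarith [mul_nonneg (sq_nonneg b) g0]
    calc b ^ 2 * ρ ≤ b ^ 2 * ((Γ + 2 * c) * (g + p) + c ^ 2 * g) := by gcongr
      _ = (Γ + 2 * c) * (b ^ 2 * (g + p)) + c ^ 2 * (b ^ 2 * g) := by ring
      _ ≤ (Γ + 2 * c) * m + c ^ 2 * U := by gcongr
      _ = _ := by ring
  have mY : m ≤ Y := by linarith
  have cY : c * U ≤ Y := by linarith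
  have Y0 : 0 ≤ Y := hm.trans mY
  have y1 : (Γ + 2 * c) * m ≤ (Γ + 2 * c) * Y := by gcongr
  have y2 : c * (c * U) ≤ c * Y := by gcongr
  have y3 : c * Y ≤ Γ * (c * Y) := by nlinarith [mul_nonneg hc Y0]
  have y4 : 0 ≤ Γ * Y := by positivity
  have y5 : 0 ≤ c * Y := by positivity
  nlinarith

lemma div_num (x b T : ℝ) (b0 : 0 < b) (h : b * x ≤ T) : x ≤ T / b := by
  rw [le_div_iff₀ b0]; linarith

/-- the duality estimate -/
lemma dual {a q : ℝ → ℝ} {Γ : ℝ} (h : Good a q Γ) (c b m U F Y : ℝ) (hc : 0 ≤ c) (hcb : c ≤ b)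
    (hb : 16 * Γ ≤ b) (K N : ℝ) (hN : 0 ≤ N) (hKN : 1 ≤ K * (1 + c) * N)
    (H1 : ∀ φ : SS, nm φ ≤ N * nm (Lo (-1) 0 (fun x => a x - c) φ))
    (g k l : SS) (hk : k = TT a q (-(c : ℂ) + Complex.I * (b : ℂ)) g + l)
    (h1 : b ^ 2 * (nm g + nm (Ml a g)) ≤ m) (h2 : 3 * (b ^ 2 * nm g) ≤ U)
    (h2' : b * nm (Dv g) ≤ U) (h1' : b * (nm (Dv g) + nm (Ml a (Dv g))) ≤ 4 * m)
    (h3 : b ^ 2 * nm l ≤ 15 * Γ * m) (h3' : b * nm (Dv l) ≤ 45 * Γ * m)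
    (h5 : b * nm (W1o a q (-(c : ℂ) + Complex.I * (b : ℂ)) g) ≤ 5 * Γ * m)
    (h4 : b * (b * nm k) ≤ b * F) (hF : 0 ≤ F) (hY : Y = m + c * U + F) (σ : ℝ)
    (hσ : σ = 1 ∨ σ = -1) :
    2 * b * nm (vo b (σ * b) g) ≤ N * nm (((2 * (σ * b) : ℝ) : ℂ) • Bo (σ * b) k)
      + (10 * K + 203 * Γ) * (1 + c) * N * Y := by
  have hG := h.G1
  have b0 : 0 < b := by linarith
  have g0 := nm_nonneg g
  have m0 : 0 ≤ m := le_trans (by have := nm_nonneg (Ml a g); positivity) h1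
  have U0 : 0 ≤ U := le_trans (by positivity) h2
  have cU : 0 ≤ c * U := by positivity
  have mY : m ≤ Y := by linarith
  have Y0 : 0 ≤ Y := m0.trans mY
  have hz := zo_bound h c b m U F hc hcb hb g k l hk h1 h2 h3 h4
  rw [← hY] at hz
  obtain ⟨R, hR⟩ := one_le_w h.lim c
  have hw := temp_sub_const h.ta c
  obtain ⟨φ, hφ⟩ := Lo_solve hw R hR σ (-b) hσ (vo b (σ * b) g)
  have n1 := Hgen hw R hR N hN H1 σ (-b) hσ φ
  have n2 := graph_est h c hc σ (-b) hσ φ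
  rw [hφ] at n1 n2
  have id := key_id h.ta h.tq c b σ hσ g k l hk
  set lam := -(c : ℂ) + Complex.I * (b : ℂ)
  set v := vo b (σ * b) g with hv
  set y := ((2 * (σ * b) : ℝ) : ℂ) • Bo (σ * b) k with hy
  have e1 : 2 * b * nm v ^ 2 = rp (Complex.I • φ) ((2 * Complex.I * b) • Lo (-σ) b (fun x => a x - c) v) := by
    have s1 := adj_Lo hw σ (-b) φ v
    rw [hφ, neg_neg, ← nm_sq] at s1
    have s2 : (2 * Complex.I * b) • Lo (-σ) b (fun x => a x - c) v =
      ((2 * b : ℝ) : ℂ) • (Complex.I • Lo (-σ) b (fun x => a x - c) v) := by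
        push_cast; module
    rw [s2, rp_smul_right, rp_I_I, ← s1]
  rw [id, rp_sub_right, rp_add_right, rp_sub_right, rp_add_right] at e1
  have r1 := rp_le (Complex.I • φ) y
  have r2 : rp (Complex.I • φ) (((2 * b : ℝ) : ℂ) • (Complex.I • Ml (fun x => a x - c) (zo b g))) ≤
      10 * Y * (nm (Ml a φ) + c * nm φ) := by
    rw [rp_smul_right, rp_I_I, ← rp_M hw]
    have s1 := rp_le (Ml (fun x => a x - c) φ) (zo b g)
    have s2 := nm_w_le h.ta c hc φ
    have s3 := mul_le_mul_of_nonneg_left s1 (by linarith : 0 ≤ 2 * b)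
    have s4 : nm (Ml (fun x => a x - c) φ) * (b * nm (zo b g)) ≤ (nm (Ml a φ) + c * nm φ) * (5 * Y) :=
      mul_le_mul s2 hz (mul_nonneg b0.le (nm_nonneg _)) ((nm_nonneg _).trans s2)
    linarith
  have r3 := rp_ge (Complex.I • φ) (((2 * (σ * b) : ℝ) : ℂ) • Ro a q c (Bo (σ * b) g))
  have r4 := rp_le (Complex.I • φ) (((2 * (σ * b) : ℝ) : ℂ) • (Complex.I • W1o a q lam g))
  have r5 := rp_ge (Complex.I • φ) (((2 * (σ * b) : ℝ) : ℂ) • Bo (σ * b) l)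
  rw [nm_I, nm_sb b σ b0 hσ] at r3 r4 r5
  rw [nm_I] at r1 r4
  have w3 : 2 * b * nm (Ro a q c (Bo (σ * b) g)) ≤ 24 * Γ * (1 + c) * Y := by
    have s1 := nm_comb b σ b0 hσ (Ro a q c (Dv g)) (Ro a q c g)
    rw [← Ro_Bo h.ta h.tq] at s1
    have s2 := mul_le_mul_of_nonneg_left s1 (by linarith : 0 ≤ 2 * b)
    exact s2.trans (ro_num b c Γ m U Y F _ _ _ _ _ _ hG hc b0 cU hF m0 hY h1 h1' h2 h2'
      (Ro_bound h c hc g) (Ro_bound h c hc (Dv g)) g0)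
  have w5 : 2 * b * nm (Bo (σ * b) l) ≤ 120 * Γ * m := by
    have s1 := nm_comb b σ b0 hσ (Dv l) l
    rw [Bo]
    nlinarith
  have p3 := mul_le_mul_of_nonneg_left w3 (nm_nonneg φ)
  have p5 := mul_le_mul_of_nonneg_left w5 (nm_nonneg φ)
  have p4 := mul_le_mul_of_nonneg_left h5 (nm_nonneg φ)
  have φ0 := nm_nonneg φ
  have Gm : Γ * m ≤ Γ * (1 + c) * Y := by
    have : Γ * m ≤ Γ * Y := by gcongr
    have : 0 ≤ Γ * (c * Y) := by positivity
    linarith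
  have pm := mul_le_mul_of_nonneg_left Gm φ0
  have cYG : c * Y ≤ Γ * (1 + c) * Y := by
    have : 1 * (c * Y) ≤ Γ * (c * Y) := by gcongr
    have : 0 ≤ Γ * Y := by positivity
    linarith
  have pc := mul_le_mul_of_nonneg_left cYG φ0
  have tot : 2 * b * nm v ^ 2 ≤ nm φ * nm y + 10 * Y * nm (Ml a φ) + 173 * (nm φ * (Γ * (1 + c) * Y)) := by
    have : 0 ≤ nm φ * (Γ * (1 + c) * Y) := by positivity
    linarith
  -- insert the bounds on φ
  have v0 := nm_nonneg v
  have y0 := nm_nonneg y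
  have aφ : nm (Ml a φ) ≤ (K + 3 * Γ) * (1 + c) * N * nm v := by
    have s1 : 1 * nm v ≤ K * (1 + c) * N * nm v := by gcongr
    have s2 : 3 * Γ * (1 + c) * nm φ ≤ 3 * Γ * (1 + c) * (N * nm v) := by gcongr
    linarith
  have t1 : nm φ * nm y ≤ N * nm v * nm y := by gcongr
  have t2 : 10 * Y * nm (Ml a φ) ≤ 10 * Y * ((K + 3 * Γ) * (1 + c) * N * nm v) := by gcongr
  have t3 : nm φ * (Γ * (1 + c) * Y) ≤ N * nm v * (Γ * (1 + c) * Y) := by gcongr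
  have fin : nm v * (2 * b * nm v) ≤ nm v * (N * nm y + (10 * K + 203 * Γ) * (1 + c) * N * Y) := by
    linarith
  rcases eq_or_lt_of_le v0 with hv0 | hv0
  · rw [← hv0, mul_zero]
    have : 0 ≤ K * (1 + c) * N * Y := mul_nonneg (by linarith) Y0
    have : 0 ≤ Γ * (1 + c) * N * Y := by positivity
    have : 0 ≤ N * nm y := by positivity
    linarith
  · exact le_of_mul_le_mul_left fin hv0

lemma Bo_sum (b : ℝ) (k : SS) :
    nm (Bo (1 * b) k) ^ 2 + nm (Bo (-1 * b) k) ^ 2 = 2 * nm (Dv k) ^ 2 + 2 * b ^ 2 * nm k ^ 2 := by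
  have h : ∀ β : ℝ, nm (Bo β k) ^ 2 = nm (Dv k) ^ 2 + 2 * β * rp (-(Complex.I • Dv k)) k + β ^ 2 * nm k ^ 2 := by
    intro β
    rw [Bo, nm_add_sq, nm_neg, nm_I, rp_smul_right, nm_smul, Complex.norm_real, Real.norm_eq_abs,
      mul_pow, sq_abs]
    ring
  rw [h, h]; ring

lemma y_sum (b : ℝ) (b0 : 0 < b) (k f : SS) (hk : -Dv (Dv k) + ((3 * b ^ 2 : ℝ) : ℂ) • k = f) :
    nm (((2 * (1 * b) : ℝ) : ℂ) • Bo (1 * b) k) ^ 2 + nm (((2 * (-1 * b) : ℝ) : ℂ) • Bo (-1 * b) k) ^ 2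
      ≤ nm f ^ 2 := by
  rw [nm_sb b 1 b0 (Or.inl rfl), nm_sb b (-1) b0 (Or.inr rfl), G_id b k f hk]
  have h1 := Bo_sum b k
  have h2 := nm_add_sq (Dv (Dv k)) (((b ^ 2 : ℝ) : ℂ) • k)
  rw [rp_smul_right, rp_DD, nm_smul_real _ (by positivity)] at h2
  have h3 := sq_nonneg (nm (Dv (Dv k) + ((b ^ 2 : ℝ) : ℂ) • k))
  have h4 : (2 * b * nm (Bo (1 * b) k)) ^ 2 + (2 * b * nm (Bo (-1 * b) k)) ^ 2 =
    4 * b ^ 2 * (nm (Bo (1 * b) k) ^ 2 + nm (Bo (-1 * b) k) ^ 2) := by ring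
  rw [h4, h1]
  linarith

lemma v_sum (b : ℝ) (b0 : 0 < b) (g u : SS) (hg : -Dv (Dv g) + ((3 * b ^ 2 : ℝ) : ℂ) • g = u) :
    nm u ^ 2 - 4 * nm (zo b g) * nm u ≤ nm (vo b (1 * b) g) ^ 2 + nm (vo b (-1 * b) g) ^ 2 := by
  have e : ∀ β : ℝ, β ^ 2 = b ^ 2 → vo b β g =
      (-Dv (Dv g) + ((b ^ 2 : ℝ) : ℂ) • g) + ((-(2 * β) : ℝ) : ℂ) • (Complex.I • Dv g) := by
    intro β hβ
    have : ((β ^ 2 : ℝ) : ℂ) = ((b ^ 2 : ℝ) : ℂ) := by rw [hβ]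
    have h2 : ((2 * β : ℝ) : ℂ) • ((β : ℂ) • g) = (2 : ℂ) • (((b ^ 2 : ℝ) : ℂ) • g) := by
      rw [← this]; push_cast; module
    rw [vo, zo, Bo, smul_add, h2]; push_cast; module
  have h : ∀ β : ℝ, β ^ 2 = b ^ 2 → nm (vo b β g) ^ 2 =
      nm (-Dv (Dv g) + ((b ^ 2 : ℝ) : ℂ) • g) ^ 2
      + 2 * (-(2 * β)) * rp (-Dv (Dv g) + ((b ^ 2 : ℝ) : ℂ) • g) (Complex.I • Dv g)
      + 4 * b ^ 2 * nm (Dv g) ^ 2 := by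
    intro β hβ
    rw [e β hβ, nm_add_sq, rp_smul_right, nm_smul, nm_I, Complex.norm_real, Real.norm_eq_abs,
      mul_pow, sq_abs, ← hβ]
    ring
  rw [h (1 * b) (by ring), h (-1 * b) (by ring)]
  have h1 := nm_add_sq (-Dv (Dv g)) (((b ^ 2 : ℝ) : ℂ) • g)
  rw [rp_smul_right, rp_neg_left, rp_DD, nm_smul_real _ (by positivity), nm_neg] at h1
  have h2 := G_id b g u hg
  have h3 : rp (zo b g) (-Dv (Dv g) + ((7 * b ^ 2 : ℝ) : ℂ) • g) =
      nm (Dv (Dv g)) ^ 2 + 6 * b ^ 2 * nm (Dv g) ^ 2 - 7 * b ^ 4 * nm g ^ 2 := by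
    rw [zo]
    simp only [rp_add_right, rp_sub_left, rp_neg_left, rp_neg_right, rp_smul_left, rp_smul_right]
    rw [rp_comm g (Dv (Dv g)), rp_DD, ← nm_sq, ← nm_sq]; ring
  have h4 := rp_ge (zo b g) (-Dv (Dv g) + ((7 * b ^ 2 : ℝ) : ℂ) • g)
  obtain ⟨b1, -, b2⟩ := G_bounds b b0 g u hg
  have h5 := nm_add_le (-Dv (Dv g)) (((7 * b ^ 2 : ℝ) : ℂ) • g)
  rw [nm_neg, nm_smul_real _ (by positivity)] at h5
  have h6 : nm (-Dv (Dv g) + ((7 * b ^ 2 : ℝ) : ℂ) • g) ≤ 4 * nm u := by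
    have := nm_nonneg u
    linarith
  have h7 := mul_le_mul_of_nonneg_left h6 (nm_nonneg (zo b g))
  nlinarith

lemma sum_num (b N F κ v1 v2 y1 y2 : ℝ) (hb : 0 < b) (hN : 0 ≤ N) (hF : 0 ≤ F) (hκ : 0 ≤ κ)
    (hv1 : 0 ≤ v1) (hv2 : 0 ≤ v2) (hy : y1 ^ 2 + y2 ^ 2 ≤ F ^ 2)
    (h1 : 2 * b * v1 ≤ N * y1 + κ) (h2 : 2 * b * v2 ≤ N * y2 + κ) :
    4 * b ^ 2 * (v1 ^ 2 + v2 ^ 2) ≤ (N * F + 2 * κ) ^ 2 := by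
  have a1 : (2 * b * v1) ^ 2 ≤ (N * y1 + κ) ^ 2 := by gcongr
  have a2 : (2 * b * v2) ^ 2 ≤ (N * y2 + κ) ^ 2 := by gcongr
  have c1 : y1 ≤ F := by apply le_of_sq_le_sq _ hF; nlinarith [sq_nonneg y2]
  have c2 : y2 ≤ F := by apply le_of_sq_le_sq _ hF; nlinarith [sq_nonneg y1]
  have d1 : N * κ * (y1 + y2) ≤ N * κ * (2 * F) := by gcongr; linarith
  have d2 : N ^ 2 * (y1 ^ 2 + y2 ^ 2) ≤ N ^ 2 * F ^ 2 := by gcongr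
  nlinarith [sq_nonneg κ]

set_option maxHeartbeats 1000000 in
lemma fin_num (b c Γ K N U X F Y Φ : ℝ) (hb : 0 < b) (hc : 0 ≤ c) (hG : 1 ≤ Γ) (hK : 1 ≤ K)
    (hN : 0 < N) (hKN : 1 ≤ K * (1 + c) * N) (hU : 0 ≤ U) (hF : 0 ≤ F)
    (hX : X ≤ 7 * Γ * ((1 + c) * U + F / b)) (hY : Y = (U + X) + c * U + F / b)
    (hΦ : Φ = (1 + c ^ 2) * N / b) (hY0 : 0 ≤ Y)
    (h : 4 * b ^ 2 * U ^ 2 - 80 * b * Y * U ≤ (N * F + 2 * ((10 * K + 203 * Γ) * (1 + c) * N * Y)) ^ 2) :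
    2 * b * (1 - (1080 * Γ * K ^ 2 + 54 * Γ * K * (10 * K + 203 * Γ)) * Φ) * U ≤ N * F := by
  have Φ0 : 0 ≤ Φ := by rw [hΦ]; positivity
  obtain ⟨s, hs⟩ : ∃ s, s = N * F / (2 * b) := ⟨_, rfl⟩
  have hs' : N * F = 2 * b * s := by rw [hs]; field_simp
  have s0 : 0 ≤ s := by rw [hs]; positivity
  obtain ⟨α, hα⟩ : ∃ α, α = 1080 * Γ * K ^ 2 := ⟨_, rfl⟩
  obtain ⟨β, hβ⟩ : ∃ β, β = 54 * Γ * K * (10 * K + 203 * Γ) := ⟨_, rfl⟩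
  rw [← hα, ← hβ]
  have α0 : 0 ≤ α := by rw [hα]; positivity
  have β0 : 0 ≤ β := by rw [hβ]; positivity
  suffices hh : (1 - (α + β) * Φ) * U ≤ s by
    rw [hs']
    have := mul_le_mul_of_nonneg_left hh (by linarith : 0 ≤ 2 * b)
    linarith
  rcases le_or_gt U s with hUs | hUs
  · have : 0 ≤ (α + β) * Φ * U := by positivity
    linarith
  have bF : F / b ≤ 2 * K * (1 + c) * U := by
    rw [div_le_iff₀ hb]
    have t1 : 1 * F ≤ K * (1 + c) * N * F := by gcongr
    have t2 : K * (1 + c) * (N * F) ≤ K * (1 + c) * (2 * b * U) := by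
      rw [hs']; gcongr
    linarith
  have hV : (1 + c) * U + F / b ≤ 3 * K * (1 + c) * U := by
    have : 1 * ((1 + c) * U) ≤ K * ((1 + c) * U) := by gcongr
    linarith
  have hYV : Y ≤ 27 * Γ * K * (1 + c) * U := by
    have v0 : 0 ≤ (1 + c) * U + F / b := by positivity
    have t1 : 1 * ((1 + c) * U + F / b) ≤ Γ * ((1 + c) * U + F / b) := by gcongr
    have t2 : Γ * ((1 + c) * U + F / b) ≤ Γ * (3 * K * (1 + c) * U) := by gcongr
    have t3 : 0 ≤ Γ * (K * (1 + c) * U) := by positivity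
    linarith
  have bΦ : b * Φ = (1 + c ^ 2) * N := by rw [hΦ]; field_simp
  have c2 : (1 + c) ^ 2 ≤ 2 * (1 + c ^ 2) := by nlinarith [sq_nonneg (1 - c)]
  have c2N : (1 + c) ^ 2 * N ≤ 2 * (b * Φ) := by
    rw [bΦ]
    have := mul_le_mul_of_nonneg_right c2 hN.le
    linarith
  have c1 : 1 + c ≤ 2 * K * (b * Φ) := by
    have t1 : (1 + c) * 1 ≤ (1 + c) * (K * (1 + c) * N) := by gcongr
    have t2 : K * ((1 + c) ^ 2 * N) ≤ K * (2 * (b * Φ)) := by gcongr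
    linarith
  have y1 : 20 * Y ≤ α * (b * Φ) * U := by
    have t : 27 * Γ * K * U * (1 + c) ≤ 27 * Γ * K * U * (2 * K * (b * Φ)) := by gcongr
    rw [hα]
    linarith
  have y2 : (10 * K + 203 * Γ) * (1 + c) * N * Y ≤ b * (β * Φ * U) := by
    have t1 : (10 * K + 203 * Γ) * (1 + c) * N * Y ≤
      (10 * K + 203 * Γ) * (1 + c) * N * (27 * Γ * K * (1 + c) * U) := by gcongr
    have t2 : (10 * K + 203 * Γ) * (27 * Γ * K) * U * ((1 + c) ^ 2 * N) ≤
      (10 * K + 203 * Γ) * (27 * Γ * K) * U * (2 * (b * Φ)) := by gcongr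
    rw [hβ]
    linarith
  have key : (1 - α * Φ) * U ^ 2 ≤ (s + β * Φ * U) ^ 2 := by
    have t1 : (N * F + 2 * ((10 * K + 203 * Γ) * (1 + c) * N * Y)) ^ 2 ≤
        (2 * b * (s + β * Φ * U)) ^ 2 := by
      rw [hs']
      have : 0 ≤ (10 * K + 203 * Γ) * (1 + c) * N * Y := by positivity
      gcongr
      linarith
    have t2 : 4 * b * U * (20 * Y) ≤ 4 * b * U * (α * (b * Φ) * U) := by gcongr
    have t3 : 4 * b ^ 2 * ((1 - α * Φ) * U ^ 2) ≤ 4 * b ^ 2 * (s + β * Φ * U) ^ 2 := by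
      linarith
    exact le_of_mul_le_mul_left t3 (by positivity)
  by_contra hcon
  push Not at hcon
  have w0 : 0 ≤ s + β * Φ * U := by positivity
  have w1 : s + β * Φ * U < (1 - α * Φ) * U := by linarith
  have w2 : (s + β * Φ * U) ^ 2 < ((1 - α * Φ) * U) ^ 2 := by gcongr
  have Up : 0 < U := s0.trans_lt hUs
  have w3 : 0 < 1 - α * Φ := by
    by_contra hn
    push Not at hn
    have := mul_nonpos_of_nonpos_of_nonneg hn hU
    linarith
  have w4 : 0 ≤ α * Φ := by positivity
  have w5 : (1 - α * Φ) * ((1 - α * Φ) * U ^ 2) ≤ 1 * ((1 - α * Φ) * U ^ 2) := by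
    gcongr
    linarith
  have w6 : ((1 - α * Φ) * U) ^ 2 = (1 - α * Φ) * ((1 - α * Φ) * U ^ 2) := by ring
  rw [w6] at w2
  exact absurd (lt_of_le_of_lt key w2) (by rw [one_mul] at w5; exact not_lt.2 w5)

lemma part_one {a q : ℝ → ℝ} {Γ : ℝ} (h : Good a q Γ) (c b : ℝ) (hc : 0 ≤ c) (hcb : c ≤ b)
    (hb : 16 * Γ ≤ b) (K : ℝ) (hK : 1 ≤ K) (N : ℝ) (hN : 0 < N) (hKN : 1 ≤ K * (1 + c) * N)
    (H1 : ∀ φ : SS, nm φ ≤ N * nm (Lo (-1) 0 (fun x => a x - c) φ)) (u : SS) :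
    2 * b * (1 - (1080 * Γ * K ^ 2 + 54 * Γ * K * (10 * K + 203 * Γ)) * ((1 + c ^ 2) * N / b)) * nm u
      ≤ N * nm (TT a q (-(c : ℂ) + Complex.I * (b : ℂ)) u) := by
  have hG := h.G1
  have b0 : 0 < b := by linarith
  obtain ⟨f, hf⟩ : ∃ f, TT a q (-(c : ℂ) + Complex.I * (b : ℂ)) u = f := ⟨_, rfl⟩
  obtain ⟨g, k, l, hg, hkf, hk, s1, s2, s3, s4, s5⟩ := setup h c b hc hcb hb u f hf
  have hX := apriori h c b hc hcb hb u f hf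
  rw [hf]
  obtain ⟨-, g2, g1⟩ := G_bounds b b0 g u hg
  obtain ⟨-, -, k1⟩ := G_bounds b b0 k f hkf
  have F0 : 0 ≤ nm f / b := div_nonneg (nm_nonneg _) b0.le
  have k0 := nm_nonneg k
  have h4 : b * (b * nm k) ≤ b * (nm f / b) := by
    have : b * (nm f / b) = nm f := by field_simp
    rw [this]
    have : 0 ≤ b ^ 2 * nm k := by positivity
    linarith
  have D := dual h c b _ (nm u) (nm f / b) _ hc hcb hb K N hN.le hKN H1 g k l hk s1 g1 g2 s2 s3 s4 s5
    h4 F0 rfl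
  have Z := zo_bound h c b _ (nm u) (nm f / b) hc hcb hb g k l hk s1 g1 s3 h4
  obtain ⟨Y, hY⟩ : ∃ Y, Y = nm u + nm (Ml a u) + c * nm u + nm f / b := ⟨_, rfl⟩
  rw [← hY] at D Z
  have u0 := nm_nonneg u
  have x0 := nm_nonneg (Ml a u)
  have Y0 : 0 ≤ Y := by rw [hY]; positivity
  refine fin_num b c Γ K N (nm u) (nm (Ml a u)) (nm f) Y _ b0 hc hG hK hN hKN u0 (nm_nonneg _) hX hY rfl
    Y0 ?_
  refine le_trans ?_ (sum_num b N (nm f) ((10 * K + 203 * Γ) * (1 + c) * N * Y) _ _ _ _ b0 hN.le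
    (nm_nonneg _) (by positivity) (nm_nonneg _) (nm_nonneg _) (y_sum b b0 k f hkf)
    (D 1 (Or.inl rfl)) (D (-1) (Or.inr rfl)))
  have vs := mul_le_mul_of_nonneg_left (v_sum b b0 g u hg) (by positivity : 0 ≤ 4 * b ^ 2)
  have t : 16 * (b * nm u) * (b * nm (zo b g)) ≤ 16 * (b * nm u) * (5 * Y) := by gcongr
  linarith

theorem stmt10 (a q : ℝ → ℝ) (h : Standing a q) (c : ℝ → ℝ)
    (hc0 : ∀ b : ℝ, 0 < b → 0 ≤ c b)
    (hNAfin : ∀ b : ℝ, 0 < b → NA a (c b) < ⊤)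
    (hc : Tendsto (fun b => c b / b) atTop (nhds 0))
    (hΦ : Tendsto (Phi a c) atTop (nhds 0))
    (hdich : (∃ M : ℝ, ∀ b : ℝ, 0 < b → c b ≤ M) ∨
        Tendsto (fun b => Real.sqrt (1 + c b ^ 2) * (NA a (c b)).toReal) atTop atTop) :
    ∃ C : ℝ, 0 < C ∧ ∃ b₀ : ℝ, 0 < b₀ ∧ ∀ b : ℝ, b₀ ≤ b →
      (∀ u : SchwartzMap ℝ ℂ,
          ENNReal.ofReal (2 * b * (1 - C * Phi a c b)) * eLpNorm (⇑u) 2 volume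
            ≤ NA a (c b) *
                eLpNorm (Tq a q (-(c b : ℂ) + Complex.I * (b : ℂ)) ⇑u) 2 volume) ∧
      (∀ M : ℝ, ENNReal.ofReal M < NA a (c b) →
          ∃ u : SchwartzMap ℝ ℂ, u ≠ 0 ∧
            ENNReal.ofReal M * eLpNorm (Tq a q (-(c b : ℂ) + Complex.I * (b : ℂ)) ⇑u) 2 volume
              ≤ ENNReal.ofReal (2 * b * (1 + C * Phi a c b)) * eLpNorm (⇑u) 2 volume) := by
  obtain ⟨Γ, hG⟩ := good_of_standing h
  obtain ⟨K, hK, hKlow⟩ := NA_lower hG.ta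
  have G1 := hG.G1
  obtain ⟨b1, hb1⟩ := eventually_atTop.1 (hc.eventually (gt_mem_nhds (zero_lt_one' ℝ)))
  obtain ⟨A, hA⟩ : ∃ A, A = 1080 * Γ * K ^ 2 + 54 * Γ * K * (10 * K + 203 * Γ) := ⟨_, rfl⟩
  have A0 : 0 < A := by rw [hA]; positivity
  have B0 : 0 < 69 * (K + Γ) ^ 2 := by positivity
  refine ⟨A + 69 * (K + Γ) ^ 2, by linarith, max b1 (16 * Γ), lt_max_of_lt_right (by linarith),
    fun b hb => ?_⟩
  have hb2 : 16 * Γ ≤ b := (le_max_right _ _).trans hb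
  have b0 : 0 < b := by linarith
  have hcb : c b ≤ b := by
    have := hb1 b ((le_max_left _ _).trans hb)
    rw [div_lt_one b0] at this
    exact this.le
  have c0 := hc0 b b0
  have hfin := hNAfin b b0
  have hKN := hKlow (c b) c0 hfin
  obtain ⟨N, hNd⟩ : ∃ N, N = (NA a (c b)).toReal := ⟨_, rfl⟩
  have hNA : NA a (c b) = ENNReal.ofReal N := by rw [hNd, ENNReal.ofReal_toReal hfin.ne]
  have H1 := NA_H1 hG.ta (c b) hfin
  have hPhi : Phi a c b = (1 + c b ^ 2) * N / b := by rw [Phi, hNd]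
  rw [← hNd] at hKN H1
  have N0 : 0 < N := by
    by_contra hn
    push Not at hn
    have : K * (1 + c b) * N ≤ 0 := mul_nonpos_of_nonneg_of_nonpos (by positivity) hn
    linarith
  have P0 : 0 ≤ Phi a c b := by rw [hPhi]; positivity
  constructor
  · intro u
    rw [TT_eq hG.ta hG.tq, eLpNorm_eq, eLpNorm_eq, hNA, ← ENNReal.ofReal_mul N0.le,
      ← ENNReal.ofReal_mul' (nm_nonneg u)]
    apply ENNReal.ofReal_le_ofReal
    refine le_trans ?_ (part_one hG (c b) b c0 hcb hb2 K hK N N0 hKN H1 u)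
    rw [← hA, ← hPhi]
    have u0 := nm_nonneg u
    gcongr
    linarith
  · intro M hM
    rcases le_or_gt M 0 with hM0 | hM0
    · obtain ⟨u, hu⟩ := exists_schw
      refine ⟨u, hu, ?_⟩
      rw [ENNReal.ofReal_of_nonpos hM0, zero_mul]
      exact bot_le
    · have hMN : M < N := by
        rw [hNA] at hM
        exact (ENNReal.ofReal_lt_ofReal_iff N0).1 hM
      have hM1 : max M (N / 2) < N := max_lt hMN (by linarith)
      obtain ⟨u, hu, hMu⟩ := NA_sup hG.ta (c b) (max M (N / 2)) (lt_max_of_lt_left hM0)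
        (by rw [hNA]; exact (ENNReal.ofReal_lt_ofReal_iff N0).2 hM1)
      obtain ⟨v, hv, hMv⟩ := part_two hG (c b) c0 b b0 K hK N (max M (N / 2)) N0 hKN (le_max_right _ _)
        hM1.le u hu hMu
      refine ⟨v, hv, ?_⟩
      have v0 := nm_nonneg v
      rw [TT_eq hG.ta hG.tq, eLpNorm_eq, eLpNorm_eq, ← ENNReal.ofReal_mul hM0.le,
        ← ENNReal.ofReal_mul' v0]
      apply ENNReal.ofReal_le_ofReal
      have t1 := mul_le_mul_of_nonneg_right (le_max_left M (N / 2))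
        (nm_nonneg (TT a q (-(c b : ℂ) + Complex.I * (b : ℂ)) v))
      refine t1.trans (hMv.trans ?_)
      apply mul_le_mul_of_nonneg_right _ v0
      have e : (1 + c b ^ 2) * N = b * Phi a c b := by rw [hPhi]; field_simp
      rw [e]
      have : 0 ≤ b * (A * Phi a c b) := by positivity
      linarith
end

section
/- Under the standing assumptions on a and q, for every bounded set K ⊂ [0,∞) there exist constants C > 0 and b₀ > 0 such that for all c ∈ K, all real b with |b| ≥ b₀, and every smooth compactly supported function u : ℝ → ℂ, setting λ = −c + i·b, one has ‖−u'' + q·u‖ ≤ C·|b|·‖T(λ)u‖. (This is the statement that ‖H_q T(λ)^{-1}‖ ≲_K |b|, expressed on the core C_c^∞(ℝ).) -/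
open MeasureTheory Filter
open scoped ENNReal

set_option maxHeartbeats 400000 in
/-- Pointwise inequality, the algebraic heart of the multiplier argument. -/
lemma pointwise_main (c₁ C₁ N : ℝ) (hc₁ : 0 ≤ c₁) (hN : 1 ≤ N) (δ : ℝ) (hδ : 0 < δ)
    (hδ1 : δ ≤ 1) (η : ℝ) (hη : 0 < η) (hηδ : η * (4 * c₁ ^ 2 + 2 + C₁ ^ 2) ≤ δ / 4) :
    ∃ b₀ : ℝ, 0 < b₀ ∧ ∃ M : ℝ, 0 < M ∧ ∀ b : ℝ, b₀ ≤ |b| → ∀ c, 0 ≤ c → c ≤ c₁ →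
      ∀ a a1 A B C ψ1 L φ ψ S v w v1 w1 f1 f2 : ℝ, 0 ≤ a → |a1| ≤ C₁ * (1 + a) →
      (∀ X Y Z : ℝ, 0 ≤ X → 0 ≤ Y → 2 * |Z| ≤ X + Y → δ * (X + Y) ≤ A * X + B * Y + C * Z) →
      -(N * (1 + a)) ≤ L → |ψ1| ≤ N → |φ| ≤ N → |ψ| ≤ N → |S| ≤ N →
      δ / 4 * (v1 ^ 2 + w1 ^ 2 + b ^ 2 * (v ^ 2 + w ^ 2)) + η / 4 * (a ^ 2 * (b ^ 2 * (v ^ 2 + w ^ 2)))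
        - M * (f1 ^ 2 + f2 ^ 2) ≤
      A * (v1 ^ 2 + w1 ^ 2) + (B + 4 * (a - c) * (η * a)) * (b ^ 2 * (v ^ 2 + w ^ 2))
       + (C + 2 * (η * a1)) * (b * (w1 * v - v1 * w)) + 2 * ψ1 * (v1 * v + w1 * w)
       + L * (v ^ 2 + w ^ 2)
       - 2 * (φ * (f1 * v1 + f2 * w1) + ψ * (f1 * v + f2 * w)
          + b * (S + η * a) * (f2 * v - f1 * w)) := by
  refine ⟨1 + 16 * N / δ + 16 * N / η, by positivity, 4 * N ^ 2 / δ + 16 * N ^ 2 / δ + 4 * η,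
    by positivity, ?_⟩
  intro b hb c hc hcc a a1 A B C ψ1 L φ ψ S v w v1 w1 f1 f2 ha ha1 hQ hL hψ1 hφ hψ hS
  have hb1 : 1 ≤ |b| := by
    have : 0 ≤ 16 * N / δ + 16 * N / η := by positivity
    linarith
  have hbδ : 16 * N ≤ δ * |b| := by
    have h1 : 16 * N / δ ≤ |b| := by
      have : 0 ≤ 16 * N / η := by positivity
      linarith
    rw [div_le_iff₀ hδ] at h1; linarith
  have hbη : 16 * N ≤ η * |b| := by
    have h1 : 16 * N / η ≤ |b| := by
      have : 0 ≤ 16 * N / δ := by positivity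
      linarith
    rw [div_le_iff₀ hη] at h1; linarith
  -- magnitudes
  obtain ⟨p, hp0, hp⟩ : ∃ p, 0 ≤ p ∧ p ^ 2 = v1 ^ 2 + w1 ^ 2 :=
    ⟨√(v1 ^ 2 + w1 ^ 2), by positivity, Real.sq_sqrt (by positivity)⟩
  obtain ⟨r, hr0, hr⟩ : ∃ p, 0 ≤ p ∧ p ^ 2 = v ^ 2 + w ^ 2 :=
    ⟨√(v ^ 2 + w ^ 2), by positivity, Real.sq_sqrt (by positivity)⟩
  obtain ⟨F, hF0, hF⟩ : ∃ p, 0 ≤ p ∧ p ^ 2 = f1 ^ 2 + f2 ^ 2 :=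
    ⟨√(f1 ^ 2 + f2 ^ 2), by positivity, Real.sq_sqrt (by positivity)⟩
  obtain ⟨J, hJ⟩ : ∃ J, J = w1 * v - v1 * w := ⟨_, rfl⟩
  have key : ∀ x y z t X Y : ℝ, 0 ≤ X → 0 ≤ Y → X ^ 2 = x ^ 2 + y ^ 2 → Y ^ 2 = z ^ 2 + t ^ 2 →
      |x * z + y * t| ≤ X * Y := by
    intro x y z t X Y hX hY h1 h2
    apply abs_le_of_sq_le_sq _ (by positivity)
    rw [mul_pow, h1, h2]; have h4 := sq_nonneg (x * t - y * z); linarith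
  have hJa : |J| ≤ p * r := by
    have := key w1 (-v1) v w p r hp0 hr0 (by rw [hp]; ring) hr
    rwa [hJ, show w1 * v - v1 * w = w1 * v + -v1 * w by ring]
  have hRa : |v1 * v + w1 * w| ≤ p * r := key _ _ _ _ p r hp0 hr0 hp hr
  have hfu' : |f1 * v1 + f2 * w1| ≤ F * p := key _ _ _ _ F p hF0 hp0 hF hp
  have hfu : |f1 * v + f2 * w| ≤ F * r := key _ _ _ _ F r hF0 hr0 hF hr
  have hfu2 : |f2 * v - f1 * w| ≤ F * r := by
    have := key f2 (-f1) v w F r hF0 hr0 (by rw [hF]; ring) hr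
    rwa [show f2 * v - f1 * w = f2 * v + -f1 * w by ring]
  rw [← hp, ← hr, ← hF, ← hJ]
  generalize hRR : v1 * v + w1 * w = RR at *
  generalize f1 * v1 + f2 * w1 = G1 at *
  generalize f1 * v + f2 * w = G2 at *
  generalize f2 * v - f1 * w = G3 at *
  obtain ⟨β, hβ⟩ : ∃ β, β = |b| := ⟨_, rfl⟩
  have hβ2 : b ^ 2 = β ^ 2 := by rw [hβ, sq_abs]
  rw [← hβ] at hb1 hbδ hbη
  obtain ⟨t, ht⟩ : ∃ t, t = β * r := ⟨_, rfl⟩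
  have ht0 : 0 ≤ t := by rw [ht]; positivity
  have ht2 : b ^ 2 * r ^ 2 = t ^ 2 := by rw [ht, hβ2]; ring
  have hrt : r ≤ t := by rw [ht]; exact le_mul_of_one_le_left hr0 hb1
  rw [ht2]
  -- main quadratic form
  have hbJ : |b * J| ≤ p * t := by
    rw [abs_mul, ← hβ, ht]
    calc β * |J| ≤ β * (p * r) := by gcongr
      _ = _ := by ring
  have e1 := hQ (p ^ 2) (t ^ 2) (b * J) (by positivity) (by positivity)
    (by have := sq_nonneg (p - t); linarith)
  -- damping term
  have e2 : -(η * ((1 + a) ^ 2 * t ^ 2 + C₁ ^ 2 * p ^ 2)) ≤ 2 * (η * a1) * (b * J) := by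
    have h1 : |a1 * (b * J)| ≤ C₁ * (1 + a) * (p * t) := by
      rw [abs_mul]; exact mul_le_mul ha1 hbJ (abs_nonneg _) ((abs_nonneg _).trans ha1)
    have h2 := neg_abs_le (a1 * (b * J))
    have h3 : 2 * (C₁ * (1 + a) * (p * t)) ≤ (1 + a) ^ 2 * t ^ 2 + C₁ ^ 2 * p ^ 2 := by
      have h4 := sq_nonneg ((1 + a) * t - C₁ * p)
      linarith
    have h4 : -((1 + a) ^ 2 * t ^ 2 + C₁ ^ 2 * p ^ 2) ≤ 2 * (a1 * (b * J)) := by linarith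
    have := mul_le_mul_of_nonneg_left h4 hη.le
    linarith
  have e3 : η * (a ^ 2 * t ^ 2) - η * (4 * c₁ ^ 2 + 2) * t ^ 2 ≤
      4 * (a - c) * (η * a) * t ^ 2 - η * ((1 + a) ^ 2 * t ^ 2) := by
    have h1 : a ^ 2 - (4 * c₁ ^ 2 + 2) ≤ 4 * (a - c) * a - (1 + a) ^ 2 := by
      have h4 := sq_nonneg (a - 2 * c₁)
      have h5 := sq_nonneg (a - 1)
      have h6 := mul_nonneg ha (sub_nonneg.2 hcc)
      linarith
    have := mul_le_mul_of_nonneg_left h1 (show 0 ≤ η * t ^ 2 by positivity)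
    linarith
  have e4 : η * (4 * c₁ ^ 2 + 2) * t ^ 2 + η * (C₁ ^ 2 * p ^ 2) ≤ δ / 4 * (p ^ 2 + t ^ 2) := by
    have h1 := mul_le_mul_of_nonneg_right hηδ (show 0 ≤ p ^ 2 + t ^ 2 by positivity)
    have h2 : 0 ≤ η * (4 * c₁ ^ 2 + 2) * p ^ 2 := by positivity
    have h3 : 0 ≤ η * (C₁ ^ 2 * t ^ 2) := by positivity
    linarith
  -- lower order
  have hNr : ∀ κ : ℝ, 16 * N ≤ κ * β → 0 < κ → N * r ≤ κ / 16 * t := by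
    intro κ h1 h2
    rw [ht]
    have := mul_le_mul_of_nonneg_right h1 hr0
    linarith
  have hd := hNr δ hbδ hδ
  have he := hNr η hbη hη
  have e5 : -(δ / 16 * (p ^ 2 + t ^ 2)) ≤ 2 * ψ1 * RR := by
    have h1 : |ψ1 * RR| ≤ N * (p * r) := by
      rw [abs_mul]; exact mul_le_mul hψ1 hRa (abs_nonneg _) (by linarith)
    have h2 := neg_abs_le (ψ1 * RR)
    have h3 := mul_le_mul_of_nonneg_left hd hp0
    have h4 := mul_nonneg hδ.le (sq_nonneg (p - t))
    linarith
  have e6 : -(δ / 8 * t ^ 2 + η / 16 * (a ^ 2 * t ^ 2)) ≤ L * r ^ 2 := by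
    have h1 : -(N * (1 + a)) * r ^ 2 ≤ L * r ^ 2 := by gcongr
    have h2 : N * (1 + a) ≤ N * (2 + a ^ 2) := by
      apply mul_le_mul_of_nonneg_left _ (by linarith)
      have h4 := sq_nonneg (a - 1)
      linarith
    have h3 : N * (1 + a) * r ^ 2 ≤ N * (2 + a ^ 2) * r ^ 2 := by gcongr
    have h4 : N * r ^ 2 ≤ δ / 16 * t ^ 2 := by
      calc N * r ^ 2 = N * r * r := by ring
        _ ≤ δ / 16 * t * t := by gcongr
        _ = _ := by ring
    have h5 : N * r ^ 2 ≤ η / 16 * t ^ 2 := by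
      calc N * r ^ 2 = N * r * r := by ring
        _ ≤ η / 16 * t * t := by gcongr
        _ = _ := by ring
    have h6 := mul_le_mul_of_nonneg_left h5 (sq_nonneg a)
    linarith
  -- source terms
  have g1 : 2 * (φ * G1) ≤ δ / 4 * p ^ 2 + 4 * N ^ 2 / δ * F ^ 2 := by
    have h1 : φ * G1 ≤ N * (F * p) := by
      refine (le_abs_self _).trans ?_
      rw [abs_mul]; exact mul_le_mul hφ hfu' (abs_nonneg _) (by linarith)
    have h2 : 2 * (N * (F * p)) ≤ δ / 4 * p ^ 2 + 4 * N ^ 2 / δ * F ^ 2 := by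
      have : δ / 4 * p ^ 2 + 4 * N ^ 2 / δ * F ^ 2 - 2 * (N * (F * p))
        = 1 / (4 * δ) * ((δ * p - 4 * N * F) ^ 2) := by field_simp; ring
      have h : 0 ≤ 1 / (4 * δ) * ((δ * p - 4 * N * F) ^ 2) := by positivity
      linarith
    linarith
  have g2 : 2 * (ψ * G2 + b * S * G3) ≤ δ / 4 * t ^ 2 + 16 * N ^ 2 / δ * F ^ 2 := by
    have h1 : ψ * G2 ≤ N * (F * t) := by
      refine (le_abs_self _).trans ?_
      rw [abs_mul]; exact mul_le_mul hψ (hfu.trans (by gcongr)) (abs_nonneg _) (by linarith)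
    have h1' : b * S * G3 ≤ N * (F * t) := by
      refine (le_abs_self _).trans ?_
      rw [abs_mul, abs_mul, ← hβ, ht]
      calc β * |S| * |G3| ≤ β * N * (F * r) := by gcongr
        _ = _ := by ring
    have h2 : 4 * (N * (F * t)) ≤ δ / 4 * t ^ 2 + 16 * N ^ 2 / δ * F ^ 2 := by
      have : δ / 4 * t ^ 2 + 16 * N ^ 2 / δ * F ^ 2 - 4 * (N * (F * t))
        = 1 / (4 * δ) * ((δ * t - 8 * N * F) ^ 2) := by field_simp; ring
      have h : 0 ≤ 1 / (4 * δ) * ((δ * t - 8 * N * F) ^ 2) := by positivity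
      linarith
    linarith
  have g3 : 2 * (b * (η * a) * G3) ≤ η / 4 * (a ^ 2 * t ^ 2) + 4 * η * F ^ 2 := by
    have h1' : b * G3 ≤ F * t := by
      refine (le_abs_self _).trans ?_
      rw [abs_mul, ← hβ, ht]
      calc β * |G3| ≤ β * (F * r) := by gcongr
        _ = _ := by ring
    have h2 : 2 * (a * (b * G3)) ≤ 1 / 4 * (a ^ 2 * t ^ 2) + 4 * F ^ 2 := by
      have := mul_le_mul_of_nonneg_left h1' ha
      have h4 := sq_nonneg (a * t - 4 * F)
      linarith
    have := mul_le_mul_of_nonneg_left h2 hη.le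
    linarith
  have z1 : 0 ≤ δ * p ^ 2 := by positivity
  have z2 : 0 ≤ δ * t ^ 2 := by positivity
  have z3 : 0 ≤ η * (a ^ 2 * t ^ 2) := by positivity
  linarith


/-- Auxiliary functions `g`, `α` of the multiplier construction. -/
lemma exists_aux (a q : ℝ → ℝ) (h : Standing a q) (c₁ : ℝ) (hc₁ : 0 ≤ c₁) :
    ∃ g g1 α α1 : ℝ → ℝ, ∃ N : ℝ, 1 ≤ N ∧ Continuous g1 ∧ Continuous α1 ∧
      (∀ x, HasDerivAt g (g1 x) x) ∧ (∀ x, HasDerivAt α (α1 x) x) ∧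
      (∀ x, |g x| ≤ N) ∧ (∀ x, |g1 x| ≤ N) ∧ (∀ x, |α x| ≤ N) ∧ (∀ x, |α1 x| ≤ N) ∧
      ∀ x, (α x = a x ∧ 1 ≤ g1 x + 2 * (a x - c₁) ∧ a x ≤ N ∧ q x ≤ N ∧
              |deriv a x| ≤ N ∧ |deriv q x| ≤ N) ∨
           (g x = 0 ∧ g1 x = 0 ∧ c₁ + 1 ≤ α x ∧ α x ≤ a x) := by
  obtain ⟨R, hR0, hR⟩ : ∃ R : ℝ, 0 < R ∧ ∀ x, R < |x| → c₁ + 1 ≤ a x := by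
    have h1 := h.unbounded_a.eventually (eventually_ge_atTop (c₁ + 1))
    rw [← Metric.cobounded_eq_cocompact, ← comap_norm_atTop] at h1
    obtain ⟨r, hr⟩ := (eventually_atTop.1 (eventually_comap.1 h1))
    exact ⟨max r 1, by positivity, fun x hx => hr |x| ((le_max_left _ _).trans hx.le) x rfl⟩
  obtain ⟨m, hm⟩ : ∃ m, m = 2 * c₁ + 2 := ⟨_, rfl⟩
  have hm1 : 1 ≤ m := by linarith
  have hm0 : 0 < m := by linarith
  let θ : ℝ → ℝ := fun x => max 0 (min 1 (R + 1 - |x|))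
  have hθc : Continuous θ := by fun_prop
  have hθ0 : ∀ x, 0 ≤ θ x := fun x => le_max_left _ _
  have hθ1 : ∀ x, θ x ≤ 1 := fun x => max_le zero_le_one (min_le_left _ _)
  have hθin : ∀ x, |x| ≤ R → θ x = 1 := fun x hx => by
    simp only [θ]
    rw [min_eq_left (by linarith), max_eq_right zero_le_one]
  have hθout : ∀ x, R + 1 ≤ |x| → θ x = 0 := fun x hx => by
    simp only [θ]
    exact max_eq_left ((min_le_right _ _).trans (by linarith))
  let Θ : ℝ → ℝ := fun x => ∫ y in (0:ℝ)..x, θ y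
  have hΘ : ∀ x, HasDerivAt Θ (θ x) x := fun x => hθc.integral_hasStrictDerivAt 0 x |>.hasDerivAt
  let g : ℝ → ℝ := fun x => m * Θ x - m * Θ (x / m)
  let g1 : ℝ → ℝ := fun x => m * θ x - θ (x / m)
  have hg : ∀ x, HasDerivAt g (g1 x) x := by
    intro x
    have h1 : HasDerivAt (fun x => Θ (x / m)) (θ (x / m) * (1 / m)) x :=
      HasDerivAt.comp (h₂ := Θ) (h := fun x => x / m) x (hΘ (x / m)) ((hasDerivAt_id x).div_const m)
    have e : g1 x = m * θ x - m * (θ (x / m) * (1 / m)) := by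
      simp only [g1]; field_simp
    rw [e]
    exact ((hΘ x).const_mul m).sub (h1.const_mul m)
  have hg1c : Continuous g1 := by fun_prop
  obtain ⟨R2, hR2⟩ : ∃ R2, R2 = m * (R + 1) := ⟨_, rfl⟩
  have hR2R : R + 1 ≤ R2 := by nlinarith
  have hg1out : ∀ x, R2 ≤ |x| → g1 x = 0 := by
    intro x hx
    have : R + 1 ≤ |x / m| := by
      rw [abs_div, abs_of_pos hm0, le_div_iff₀ hm0]; linarith
    simp only [g1]; rw [hθout x (by linarith), hθout _ this]; simp
  have hgout : ∀ x, R2 ≤ |x| → g x = 0 := by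
    intro x hx
    have h2 : R + 1 ≤ |x| / m := by
      rw [le_div_iff₀ hm0]; linarith
    have h1 : ∫ y in (x / m)..x, θ y = 0 := by
      rw [intervalIntegral.integral_congr (g := fun _ => (0:ℝ))]
      · simp
      · intro y hy
        apply hθout
        rcases le_total 0 x with h0 | h0
        · rw [abs_of_nonneg h0] at h2
          rw [Set.uIcc_of_le (div_le_self h0 hm1)] at hy
          exact (h2.trans hy.1).trans (le_abs_self _)
        · rw [abs_of_nonpos h0] at h2
          have hle : x ≤ x / m := by
            rw [le_div_iff₀ hm0]; nlinarith
          rw [Set.uIcc_of_ge hle] at hy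
          have := hy.2
          rw [neg_div] at h2
          exact le_trans (by linarith) (neg_le_abs y)
    have h3 := intervalIntegral.integral_add_adjacent_intervals
      (hθc.intervalIntegrable (μ := volume) 0 (x / m)) (hθc.intervalIntegrable (x / m) x)
    rw [h1, add_zero] at h3
    simp only [g, Θ]; rw [h3]; ring
  have hcs : ∀ f : ℝ → ℝ, Continuous f → (∀ x, R2 + 1 ≤ |x| → f x = 0) → ∃ C, ∀ x, |f x| ≤ C := by
    intro f hf h0
    have : HasCompactSupport f := by
      apply HasCompactSupport.intro (isCompact_closedBall (0:ℝ) (R2 + 1))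
      intro x hx
      apply h0
      simp at hx; exact hx.le
    obtain ⟨C, hC⟩ := this.exists_bound_of_continuous hf
    exact ⟨C, hC⟩
  obtain ⟨N1, hN1⟩ := hcs g (continuous_iff_continuousAt.2 fun x => (hg x).continuousAt)
    (fun x hx => hgout x (by linarith))
  obtain ⟨N2, hN2⟩ := hcs g1 hg1c (fun x hx => hg1out x (by linarith))
  let χ : ContDiffBump (0:ℝ) := ⟨R2, R2 + 1, by linarith, by linarith⟩
  have hχ : ContDiff ℝ 1 (χ : ℝ → ℝ) := χ.contDiff
  have ha1 : ContDiff ℝ 1 a := h.smooth_a.of_le (by exact_mod_cast le_top)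
  have hq1 : ContDiff ℝ 1 q := h.smooth_q.of_le (by exact_mod_cast le_top)
  let γ : ℝ → ℝ := fun x => χ x * (a x - (c₁ + 1))
  have hγ : ContDiff ℝ 1 γ := hχ.mul (ha1.sub contDiff_const)
  have hγs : HasCompactSupport γ := χ.hasCompactSupport.mul_right
  obtain ⟨N3, hN3⟩ := hγs.exists_bound_of_continuous hγ.continuous
  obtain ⟨N4, hN4⟩ := hγs.deriv.exists_bound_of_continuous (hγ.continuous_deriv le_rfl)
  have hcb : ∀ f : ℝ → ℝ, Continuous f → ∃ C, ∀ x, |x| ≤ R2 → |f x| ≤ C := by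
    intro f hf
    obtain ⟨C, hC⟩ := (isCompact_closedBall (0:ℝ) R2).exists_bound_of_continuousOn hf.continuousOn
    exact ⟨C, fun x hx => hC x (by simpa using hx)⟩
  obtain ⟨N5, hN5⟩ := hcb a ha1.continuous
  obtain ⟨N6, hN6⟩ := hcb q hq1.continuous
  obtain ⟨N7, hN7⟩ := hcb _ (ha1.continuous_deriv le_rfl)
  obtain ⟨N8, hN8⟩ := hcb _ (hq1.continuous_deriv le_rfl)
  obtain ⟨N, hN⟩ : ∃ N, N = 1 + |N1| + |N2| + (|N3| + (c₁ + 1)) + |N4| + |N5| + |N6| + |N7| + |N8| :=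
    ⟨_, rfl⟩
  have p1 := abs_nonneg N1
  have p2 := abs_nonneg N2
  have p3 := abs_nonneg N3
  have p4 := abs_nonneg N4
  have p5 := abs_nonneg N5
  have p6 := abs_nonneg N6
  have p7 := abs_nonneg N7
  have p8 := abs_nonneg N8
  refine ⟨g, g1, fun x => γ x + (c₁ + 1), deriv γ, N, by linarith, hg1c,
    hγ.continuous_deriv le_rfl, hg, ?_, ?_, ?_, ?_, ?_, ?_⟩
  · intro x
    exact ((hγ.differentiable one_ne_zero x).hasDerivAt).add_const _
  · intro x; linarith [hN1 x, le_abs_self N1]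
  · intro x; linarith [hN2 x, le_abs_self N2]
  · intro x
    have h1 := abs_add_le (γ x) (c₁ + 1)
    rw [abs_of_nonneg (show 0 ≤ c₁ + 1 by linarith)] at h1
    have h2 := hN3 x
    rw [Real.norm_eq_abs] at h2
    linarith [le_abs_self N3]
  · intro x
    have h2 := hN4 x
    rw [Real.norm_eq_abs] at h2
    linarith [le_abs_self N4]
  · intro x
    rcases le_or_gt |x| R2 with hx | hx
    · left
      have hχ1 : χ x = 1 := χ.one_of_mem_closedBall (by simpa using hx)
      refine ⟨by simp only [γ]; rw [hχ1]; ring, ?_, ?_, ?_, ?_, ?_⟩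
      · rcases le_or_gt |x| R with hxR | hxR
        · have := hθ1 (x / m)
          have := h.nonneg_a x
          simp only [g1]; rw [hθin x hxR]; linarith
        · have := hθ1 (x / m)
          have := hR x hxR
          have := mul_nonneg hm0.le (hθ0 x)
          simp only [g1]; linarith
      · linarith [hN5 x hx, le_abs_self N5, le_abs_self (a x)]
      · linarith [hN6 x hx, le_abs_self N6, le_abs_self (q x)]
      · linarith [hN7 x hx, le_abs_self N7]
      · linarith [hN8 x hx, le_abs_self N8]
    · right
      have h1 := hR x (by linarith)
      refine ⟨hgout x hx.le, hg1out x hx.le, ?_, ?_⟩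
      · have := mul_nonneg (χ.nonneg (x := x)) (sub_nonneg.2 h1)
        simp only [γ]; linarith
      · have := mul_le_mul_of_nonneg_right (χ.le_one (x := x)) (sub_nonneg.2 h1)
        simp only [γ]; linarith


/-- Pointwise coefficient estimates for the multiplier. -/
lemma coeff_bounds (c₁ N : ℝ) (hc₁ : 0 ≤ c₁) (hN : 1 ≤ N) :
    ∃ M : ℝ, 1 ≤ M ∧ ∀ c, 0 ≤ c → c ≤ c₁ → ∀ a q a1 q1 g g1 α α1 : ℝ, 0 ≤ a → 0 ≤ q →
      |g| ≤ N → |g1| ≤ N → |α| ≤ N → |α1| ≤ N →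
      ((α = a ∧ 1 ≤ g1 + 2 * (a - c₁) ∧ a ≤ N ∧ q ≤ N ∧ |a1| ≤ N ∧ |q1| ≤ N) ∨
           (g = 0 ∧ g1 = 0 ∧ c₁ + 1 ≤ α ∧ α ≤ a)) →
      (∀ X Y Z : ℝ, 0 ≤ X → 0 ≤ Y → 2 * |Z| ≤ X + Y → Real.exp (-N) * (X + Y) ≤
        (g1 * Real.cosh g + 2 * ((α - c) * Real.cosh g)) * X +
        (g1 * Real.cosh g - 2 * ((α - c) * Real.cosh g) + 4 * (a - c) * Real.cosh g) * Y +
        (4 * (a - c) * Real.sinh g + 2 * (g1 * Real.sinh g)) * Z) ∧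
      -(M * (1 + a)) ≤ -c ^ 2 * (g1 * Real.cosh g) - (g1 * Real.cosh g) * (q - 2 * c * a)
        - Real.sinh g * (q1 - 2 * c * a1) + 2 * ((α - c) * Real.cosh g) * (q - 2 * c * a + c ^ 2) ∧
      |α1 * Real.cosh g + (α - c) * (g1 * Real.sinh g)| ≤ M ∧ |Real.sinh g| ≤ M ∧
      |(α - c) * Real.cosh g| ≤ M ∧ |Real.cosh g| ≤ M := by
  obtain ⟨H, hH⟩ : ∃ H, H = Real.cosh N := ⟨_, rfl⟩
  have hH1 : 1 ≤ H := hH ▸ Real.one_le_cosh N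
  obtain ⟨P, hP⟩ : ∃ P, P = (N + c₁) * H := ⟨_, rfl⟩
  have hP0 : 0 ≤ P := by rw [hP]; positivity
  refine ⟨c₁ ^ 2 * (N * H) + (N * H) * (N + 2 * c₁ * N) + H * (N + 2 * c₁ * N)
    + 2 * P * (N + 2 * c₁ * N + c₁ ^ 2) + 4 * P * c₁
    + (N * H + (N + c₁) * (N * H)) + H + P, ?_, ?_⟩
  · have : 0 ≤ c₁ ^ 2 * (N * H) + (N * H) * (N + 2 * c₁ * N) + H * (N + 2 * c₁ * N)
      + 2 * P * (N + 2 * c₁ * N + c₁ ^ 2) + 4 * P * c₁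
      + (N * H + (N + c₁) * (N * H)) := by positivity
    linarith
  intro c hc hcc a q a1 q1 g g1 α α1 ha hq hg hg1 hα hα1 hcase
  have hch : Real.cosh g ≤ H := by
    rw [hH]; apply Real.cosh_le_cosh.2; rwa [abs_of_nonneg (show 0 ≤ N by linarith)]
  have hch1 := Real.one_le_cosh g
  have hdist : Real.exp (-N) ≤ Real.cosh g - |Real.sinh g| := by
    have h1 : Real.cosh g - |Real.sinh g| = Real.exp (-|g|) := by
      rw [← Real.cosh_abs g, Real.abs_sinh, Real.cosh_sub_sinh]
    rw [h1]; exact Real.exp_le_exp.2 (by linarith)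
  have hexp1 : Real.exp (-N) ≤ 1 := Real.exp_le_one_iff.2 (by linarith)
  have hexp0 := Real.exp_pos (-N)
  have hs0 := abs_nonneg (Real.sinh g)
  have hsinh : |Real.sinh g| ≤ H := by linarith
  have hch0 : 0 ≤ Real.cosh g := by linarith
  have hchabs : |Real.cosh g| ≤ H := by rwa [abs_of_nonneg hch0]
  have hαc : |α - c| ≤ N + c₁ := by
    have := abs_sub α c
    rw [abs_of_nonneg hc] at this
    linarith
  generalize hhh : Real.cosh g = h at *
  generalize hsss : Real.sinh g = s at *
  generalize Real.exp (-N) = δ at *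
  have hψ : |(α - c) * h| ≤ P := by
    rw [abs_mul, hP]; gcongr
  have hφ' : |g1 * h| ≤ N * H := by
    rw [abs_mul]; gcongr
  have hS' : |g1 * s| ≤ N * H := by
    rw [abs_mul]; gcongr
  have hψ1 : |α1 * h + (α - c) * (g1 * s)| ≤ N * H + (N + c₁) * (N * H) := by
    refine (abs_add_le _ _).trans ?_
    rw [abs_mul, abs_mul (α - c)]; gcongr
  have t1 : 0 ≤ c₁ ^ 2 * (N * H) := by positivity
  have t2 : 0 ≤ (N * H) * (N + 2 * c₁ * N) := by positivity
  have t3 : 0 ≤ H * (N + 2 * c₁ * N) := by positivity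
  have t4 : 0 ≤ 2 * P * (N + 2 * c₁ * N + c₁ ^ 2) := by positivity
  have t5 : 0 ≤ 4 * P * c₁ := by positivity
  have t6 : 0 ≤ N * H + (N + c₁) * (N * H) := by positivity
  refine ⟨?_, ?_, by linarith, by linarith, by linarith, by linarith⟩
  · intro X Y Z hX hY hZ
    rcases hcase with ⟨rfl, hm, -⟩ | ⟨h0, h01, hα1, hα2⟩
    · have hm1 : 1 ≤ g1 + 2 * (α - c) := by linarith
      have e1 : δ * (X + Y) ≤ h * (X + Y) + 2 * s * Z := by
        have h1 := mul_le_mul_of_nonneg_right hdist (show 0 ≤ X + Y by linarith)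
        have h2 : -(|s| * (2 * |Z|)) ≤ 2 * s * Z := by
          have := neg_abs_le (s * Z)
          rw [abs_mul] at this; linarith
        have h3 := mul_le_mul_of_nonneg_left hZ hs0
        linarith
      have e2 : 0 ≤ h * (X + Y) + 2 * s * Z := le_trans (by positivity) e1
      have e3 := mul_le_mul_of_nonneg_right hm1 e2
      linarith
    · subst h0
      have hh : h = 1 := by rw [← hhh, Real.cosh_zero]
      have hs : s = 0 := by rw [← hsss, Real.sinh_zero]
      subst hh hs h01
      have e1 : δ * X ≤ 2 * (α - c) * X := mul_le_mul_of_nonneg_right (by linarith) hX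
      have e2 : δ * Y ≤ (4 * (a - c) - 2 * (α - c)) * Y :=
        mul_le_mul_of_nonneg_right (by linarith) hY
      linarith
  · rcases hcase with ⟨rfl, hm, hα1, hqN, ha1, hq1⟩ | ⟨h0, h01, hα1, hα2⟩
    · have hcα : 0 ≤ c * α := by positivity
      have hcα' : c * α ≤ c₁ * N := by gcongr
      have b0 : |q - 2 * c * α| ≤ N + 2 * c₁ * N := by
        rw [abs_le]; constructor <;> nlinarith
      have b0' : |q - 2 * c * α + c ^ 2| ≤ N + 2 * c₁ * N + c₁ ^ 2 := by
        refine (abs_add_le _ _).trans ?_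
        rw [abs_of_nonneg (sq_nonneg c)]; gcongr
      have b0'' : |q1 - 2 * c * a1| ≤ N + 2 * c₁ * N := by
        refine (abs_sub _ _).trans ?_
        rw [abs_mul, abs_mul, abs_of_nonneg hc, abs_two]; gcongr
      have b1 : |c ^ 2 * (g1 * h)| ≤ c₁ ^ 2 * (N * H) := by
        rw [abs_mul, abs_of_nonneg (sq_nonneg c)]; gcongr
      have b2 : |g1 * h * (q - 2 * c * α)| ≤ N * H * (N + 2 * c₁ * N) := by
        rw [abs_mul]; gcongr
      have b3 : |s * (q1 - 2 * c * a1)| ≤ H * (N + 2 * c₁ * N) := by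
        rw [abs_mul]; gcongr
      have b4 : |(α - c) * h * (q - 2 * c * α + c ^ 2)| ≤ P * (N + 2 * c₁ * N + c₁ ^ 2) := by
        rw [abs_mul]; gcongr
      rw [abs_le] at b1 b2 b3 b4
      have hbig : c₁ ^ 2 * (N * H) + (N * H) * (N + 2 * c₁ * N) + H * (N + 2 * c₁ * N)
          + 2 * P * (N + 2 * c₁ * N + c₁ ^ 2) ≤ (c₁ ^ 2 * (N * H) + (N * H) * (N + 2 * c₁ * N)
          + H * (N + 2 * c₁ * N)
          + 2 * P * (N + 2 * c₁ * N + c₁ ^ 2) + 4 * P * c₁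
          + (N * H + (N + c₁) * (N * H)) + H + P) * (1 + α) := by
        refine le_trans ?_ (le_mul_of_one_le_right (by positivity) (by linarith))
        linarith
      linarith [b1.1, b1.2, b2.1, b2.2, b3.1, b3.2, b4.1, b4.2]
    · subst h0
      have hh : h = 1 := by rw [← hhh, Real.cosh_zero]
      have hs : s = 0 := by rw [← hsss, Real.sinh_zero]
      subst hh hs h01
      have hp : 0 ≤ α - c := by linarith
      rw [mul_one, abs_of_nonneg hp] at hψ
      have e1 : 0 ≤ (α - c) * (q + c ^ 2) := by positivity
      have e2 : (α - c) * (c * a) ≤ P * (c₁ * a) := by gcongr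
      have e3 : 4 * P * c₁ * (1 + a) ≤ (c₁ ^ 2 * (N * H) + (N * H) * (N + 2 * c₁ * N)
          + H * (N + 2 * c₁ * N)
          + 2 * P * (N + 2 * c₁ * N + c₁ ^ 2) + 4 * P * c₁
          + (N * H + (N + c₁) * (N * H)) + H + P) * (1 + a) := by
        gcongr; linarith
      linarith


/-- The integral of the derivative of the multiplier flux vanishes. -/
lemma flux_integral (u : ℝ → ℂ) (hu : ContDiff ℝ (⊤ : ℕ∞) u) (hs : HasCompactSupport u)
    (φ φ1 ψ ψ1 S S1 P P1 : ℝ → ℝ) (b : ℝ)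
    (hφ : ∀ x, HasDerivAt φ (φ1 x) x) (hψ : ∀ x, HasDerivAt ψ (ψ1 x) x)
    (hS : ∀ x, HasDerivAt S (S1 x) x) (hP : ∀ x, HasDerivAt P (P1 x) x)
    (cφ : Continuous φ1) (cψ : Continuous ψ1) (cS : Continuous S1) (cP : Continuous P1)
    (G : ℝ → ℝ)
    (hG : ∀ x v w v1 w1 v2 w2 : ℝ, v = (u x).re → w = (u x).im → v1 = (deriv u x).re →
      w1 = (deriv u x).im → v2 = (deriv (deriv u) x).re → w2 = (deriv (deriv u) x).im →
      G x = φ1 x * (v1 ^ 2 + w1 ^ 2) + φ x * (2 * v1 * v2 + 2 * w1 * w2)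
        - (φ1 x * P x + φ x * P1 x) * (v ^ 2 + w ^ 2) - φ x * P x * (2 * v * v1 + 2 * w * w1)
        + 2 * ψ1 x * (v1 * v + w1 * w) + 2 * ψ x * (v2 * v + w2 * w + v1 ^ 2 + w1 ^ 2)
        + 2 * b * (S1 x * (w1 * v - v1 * w) + S x * (w2 * v - v2 * w))) :
    Integrable G ∧ ∫ x, G x = 0 := by
  have hu1 : ContDiff ℝ (⊤ : ℕ∞) (deriv u) := by
    have : ContDiff ℝ ((⊤ : ℕ∞) + 1) u := by simpa using hu
    exact (contDiff_succ_iff_deriv.1 this).2.2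
  have hu2 : ContDiff ℝ (⊤ : ℕ∞) (deriv (deriv u)) := by
    have : ContDiff ℝ ((⊤ : ℕ∞) + 1) (deriv u) := by simpa using hu1
    exact (contDiff_succ_iff_deriv.1 this).2.2
  have d0 : ∀ x, HasDerivAt u (deriv u x) x := fun x =>
    (hu.differentiable (by simp) x).hasDerivAt
  have d1 : ∀ x, HasDerivAt (deriv u) (deriv (deriv u) x) x := fun x =>
    (hu1.differentiable (by simp) x).hasDerivAt
  have hre : ∀ (f : ℝ → ℂ) (f' : ℂ) (x : ℝ), HasDerivAt f f' x →
      HasDerivAt (fun x => (f x).re) f'.re x := fun f f' x hf =>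
    Complex.reCLM.hasFDerivAt.comp_hasDerivAt x hf
  have him : ∀ (f : ℝ → ℂ) (f' : ℂ) (x : ℝ), HasDerivAt f f' x →
      HasDerivAt (fun x => (f x).im) f'.im x := fun f f' x hf =>
    Complex.imCLM.hasFDerivAt.comp_hasDerivAt x hf
  have cu := hu.continuous
  have cu1 := hu1.continuous
  have cu2 := hu2.continuous
  have cont : ∀ f f' : ℝ → ℝ, (∀ x, HasDerivAt f (f' x) x) → Continuous f := fun f f' hf =>
    continuous_iff_continuousAt.2 fun x => (hf x).continuousAt
  have cφ0 := cont _ _ hφ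
  have cψ0 := cont _ _ hψ
  have cS0 := cont _ _ hS
  have cP0 := cont _ _ hP
  have hG' : G = fun x => φ1 x * ((deriv u x).re ^ 2 + (deriv u x).im ^ 2) + φ x * (2 * (deriv u x).re * (deriv (deriv u) x).re + 2 * (deriv u x).im * (deriv (deriv u) x).im)
        - (φ1 x * P x + φ x * P1 x) * ((u x).re ^ 2 + (u x).im ^ 2) - φ x * P x * (2 * (u x).re * (deriv u x).re + 2 * (u x).im * (deriv u x).im)
        + 2 * ψ1 x * ((deriv u x).re * (u x).re + (deriv u x).im * (u x).im) + 2 * ψ x * ((deriv (deriv u) x).re * (u x).re + (deriv (deriv u) x).im * (u x).im + (deriv u x).re ^ 2 + (deriv u x).im ^ 2)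
        + 2 * b * (S1 x * ((deriv u x).im * (u x).re - (deriv u x).re * (u x).im) + S x * ((deriv (deriv u) x).im * (u x).re - (deriv (deriv u) x).re * (u x).im)) :=
    funext fun x => hG x _ _ _ _ _ _ rfl rfl rfl rfl rfl rfl
  let F : ℝ → ℝ := fun x => φ x * ((deriv u x).re ^ 2 + (deriv u x).im ^ 2)
    - φ x * P x * ((u x).re ^ 2 + (u x).im ^ 2)
    + 2 * ψ x * ((deriv u x).re * (u x).re + (deriv u x).im * (u x).im)
    + 2 * b * (S x * ((deriv u x).im * (u x).re - (deriv u x).re * (u x).im))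
  have hz0 : ∀ x, x ∉ tsupport u → u x = 0 := fun x hx => image_eq_zero_of_notMem_tsupport hx
  have hz1 : ∀ x, x ∉ tsupport u → deriv u x = 0 := fun x hx =>
    Function.notMem_support.1 fun h => hx (support_deriv_subset h)
  have cG : Continuous G := by rw [hG']; fun_prop
  have cF : Continuous F := by fun_prop
  have iG : Integrable G := by
    apply cG.integrable_of_hasCompactSupport
    apply HasCompactSupport.intro hs
    intro x hx
    rw [hG']; simp [hz0 x hx, hz1 x hx]
  have iF : Integrable F := by
    apply cF.integrable_of_hasCompactSupport
    apply HasCompactSupport.intro hs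
    intro x hx
    simp [F, hz0 x hx, hz1 x hx]
  refine ⟨iG, integral_eq_zero_of_hasDerivAt_of_integrable (f := F) ?_ iG iF⟩
  intro x
  have v0 := hre _ _ _ (d0 x)
  have w0 := him _ _ _ (d0 x)
  have v1 := hre _ _ _ (d1 x)
  have w1 := him _ _ _ (d1 x)
  have := ((((hφ x).mul ((v1.pow 2).add (w1.pow 2))).sub
    (((hφ x).mul (hP x)).mul ((v0.pow 2).add (w0.pow 2)))).add
    (((hψ x).const_mul 2).mul ((v1.mul v0).add (w1.mul w0)))).add
    (((hS x).mul ((w1.mul v0).sub (v1.mul w0))).const_mul (2 * b))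
  refine this.congr_deriv ?_
  rw [hG']
  simp only [Pi.pow_apply, Pi.add_apply, Pi.mul_apply, Pi.sub_apply]
  push_cast
  ring

lemma eLpNorm_le_of_sq (f h : ℝ → ℂ) (cf : Continuous f) (ch : Continuous h)
    (sf : HasCompactSupport f) (sh : HasCompactSupport h) (C : ℝ) (hC : 0 ≤ C)
    (hle : ∫ x, ‖h x‖ ^ 2 ≤ C ^ 2 * ∫ x, ‖f x‖ ^ 2) :
    eLpNorm h 2 volume ≤ ENNReal.ofReal C * eLpNorm f 2 volume := by
  have key : ∀ g : ℝ → ℂ, Continuous g → HasCompactSupport g →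
      eLpNorm g 2 volume = ENNReal.ofReal (√(∫ x, ‖g x‖ ^ 2)) := by
    intro g cg sg
    have := (cg.memLp_of_hasCompactSupport (p := 2) (μ := volume) sg).eLpNorm_eq_integral_rpow_norm
      (by norm_num) (by norm_num)
    rw [this, Real.sqrt_eq_rpow]
    norm_num
  rw [key f cf sf, key h ch sh, ← ENNReal.ofReal_mul hC]
  apply ENNReal.ofReal_le_ofReal
  calc √(∫ x, ‖h x‖ ^ 2) ≤ √(C ^ 2 * ∫ x, ‖f x‖ ^ 2) := Real.sqrt_le_sqrt hle
    _ = _ := by rw [Real.sqrt_mul (by positivity), Real.sqrt_sq hC]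

/-- Bound of `‖H u‖` pointwise. -/
lemma H_pointwise (a q c b v w v2 w2 f1 f2 : ℝ) (hb1 : 1 ≤ |b|) (hc : 0 ≤ c) (hcb : c ≤ |b|)
    (h1 : f1 = -v2 + q * v + (-2 * c * a + c ^ 2 - b ^ 2) * v - 2 * b * (a - c) * w)
    (h2 : f2 = -w2 + q * w + (-2 * c * a + c ^ 2 - b ^ 2) * w + 2 * b * (a - c) * v) :
    (-v2 + q * v) ^ 2 + (-w2 + q * w) ^ 2 ≤
      2 * (f1 ^ 2 + f2 ^ 2) + 32 * b ^ 2 * ((1 + a ^ 2) * (b ^ 2 * (v ^ 2 + w ^ 2))) := by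
  have hb2 : 1 ≤ b ^ 2 := by rw [← sq_abs]; nlinarith
  have hc2 : c ^ 2 ≤ b ^ 2 := by rw [← sq_abs b]; gcongr
  obtain ⟨p, hp⟩ : ∃ p, p = -2 * c * a + c ^ 2 - b ^ 2 := ⟨_, rfl⟩
  obtain ⟨n, hn⟩ : ∃ n, n = 2 * b * (a - c) := ⟨_, rfl⟩
  rw [← hp, ← hn] at h1 h2
  have e1 : -v2 + q * v = f1 - (p * v - n * w) := by rw [h1]; ring
  have e2 : -w2 + q * w = f2 - (p * w + n * v) := by rw [h2]; ring
  rw [e1, e2]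
  have e3 : (f1 - (p * v - n * w)) ^ 2 + (f2 - (p * w + n * v)) ^ 2 ≤
      2 * (f1 ^ 2 + f2 ^ 2) + 2 * (p ^ 2 + n ^ 2) * (v ^ 2 + w ^ 2) := by
    have := sq_nonneg (f1 + (p * v - n * w))
    have := sq_nonneg (f2 + (p * w + n * v))
    linarith
  have e4 : p ^ 2 + n ^ 2 ≤ 16 * (b ^ 2 * ((1 + a ^ 2) * b ^ 2)) := by
    have : p ^ 2 + n ^ 2 = (c ^ 2 + b ^ 2) * ((2 * a - c) ^ 2 + b ^ 2) := by rw [hp, hn]; ring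
    rw [this]
    have h5 : (2 * a - c) ^ 2 + b ^ 2 ≤ 8 * ((1 + a ^ 2) * b ^ 2) := by
      have := sq_nonneg (2 * a + c)
      have := mul_le_mul_of_nonneg_left hb2 (sq_nonneg a)
      linarith
    calc (c ^ 2 + b ^ 2) * ((2 * a - c) ^ 2 + b ^ 2) ≤ (2 * b ^ 2) * (8 * ((1 + a ^ 2) * b ^ 2)) := by
          gcongr; linarith
      _ = _ := by ring
  have e5 := mul_le_mul_of_nonneg_right e4 (show 0 ≤ v ^ 2 + w ^ 2 by positivity)
  linarith


set_option maxHeartbeats 1000000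

theorem stmt11 (a q : ℝ → ℝ) (h : Standing a q)
    (K : Set ℝ) (hKb : Bornology.IsBounded K) (hK : K ⊆ Set.Ici 0) :
    ∃ C : ℝ, 0 < C ∧ ∃ b₀ : ℝ, 0 < b₀ ∧ ∀ c ∈ K, ∀ b : ℝ, b₀ ≤ |b| →
      ∀ u : ℝ → ℂ, ContDiff ℝ (⊤ : ℕ∞) u → HasCompactSupport u →
        eLpNorm (fun x => -deriv (deriv u) x + (q x : ℂ) * u x) 2 volume
          ≤ ENNReal.ofReal (C * |b|) *
              eLpNorm (Tq a q (-(c : ℂ) + Complex.I * (b : ℂ)) u) 2 volume := by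
  obtain ⟨c₁, hc₁, hKc⟩ : ∃ c₁ : ℝ, 0 ≤ c₁ ∧ ∀ c ∈ K, c ≤ c₁ := by
    obtain ⟨r, hr⟩ := hKb.exists_norm_le
    exact ⟨max r 0, le_max_right _ _, fun c hc =>
      ((le_abs_self c).trans (hr c hc)).trans (le_max_left _ _)⟩
  obtain ⟨C₁, hC₁, hda⟩ : ∃ C : ℝ, 0 < C ∧ ∀ x, |deriv a x| ≤ C * (1 + a x) := by
    obtain ⟨C, hC, hx⟩ := h.deriv_a 1 le_rfl
    refine ⟨C, hC, fun x => ?_⟩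
    have h1 := hx x
    rw [iteratedDeriv_one] at h1
    have h2 : (1 + x ^ 2) ^ (-((1 : ℕ) : ℝ) / 2) ≤ 1 :=
      Real.rpow_le_one_of_one_le_of_nonpos (by linarith [sq_nonneg x]) (by norm_num)
    have h3 : 0 ≤ C * (1 + a x) := mul_nonneg hC.le (by linarith [h.nonneg_a x])
    exact h1.trans (mul_le_of_le_one_right h3 h2)
  obtain ⟨g, g1, α, α1, N, hN, cg1, cα1, hg, hα, bg, bg1, bα, bα1, hcase⟩ := exists_aux a q h c₁ hc₁
  obtain ⟨M₀, hM₀, hcoef⟩ := coeff_bounds c₁ N hc₁ hN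
  obtain ⟨δ, hδdef⟩ : ∃ δ, δ = Real.exp (-N) := ⟨_, rfl⟩
  have hδ : 0 < δ := hδdef ▸ Real.exp_pos _
  have hδ1 : δ ≤ 1 := hδdef ▸ Real.exp_le_one_iff.2 (by linarith)
  obtain ⟨η, hηdef⟩ : ∃ η, η = δ / 4 / (4 * c₁ ^ 2 + 2 + C₁ ^ 2) := ⟨_, rfl⟩
  have hη : 0 < η := by rw [hηdef]; positivity
  have hηδ : η * (4 * c₁ ^ 2 + 2 + C₁ ^ 2) ≤ δ / 4 := by
    rw [hηdef, div_mul_cancel₀]; positivity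
  obtain ⟨b₁, hb₁, M, hM, hpt⟩ := pointwise_main c₁ C₁ M₀ hc₁ hM₀ δ hδ hδ1 η hη hηδ
  obtain ⟨κ, hκdef⟩ : ∃ κ, κ = min δ η / 4 := ⟨_, rfl⟩
  have hκ : 0 < κ := by rw [hκdef]; have := lt_min hδ hη; positivity
  have hκδ : κ ≤ δ / 4 := by rw [hκdef]; have := min_le_left δ η; linarith
  have hκη : κ ≤ η / 4 := by rw [hκdef]; have := min_le_right δ η; linarith
  refine ⟨√(2 + 32 * M / κ), by positivity, max b₁ (1 + c₁), by positivity, ?_⟩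
  intro c hcK b hb u hu hs
  have hc : 0 ≤ c := hK hcK
  have hcc := hKc c hcK
  have hbb₁ : b₁ ≤ |b| := (le_max_left _ _).trans hb
  have hbc : 1 + c₁ ≤ |b| := (le_max_right _ _).trans hb
  have ha1 : ContDiff ℝ 1 a := h.smooth_a.of_le (by exact_mod_cast le_top)
  have hq1 : ContDiff ℝ 1 q := h.smooth_q.of_le (by exact_mod_cast le_top)
  have da : ∀ x, HasDerivAt a (deriv a x) x := fun x =>
    (ha1.differentiable one_ne_zero x).hasDerivAt
  have dq : ∀ x, HasDerivAt q (deriv q x) x := fun x =>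
    (hq1.differentiable one_ne_zero x).hasDerivAt
  have cda : Continuous (deriv a) := ha1.continuous_deriv le_rfl
  have cdq : Continuous (deriv q) := hq1.continuous_deriv le_rfl
  have ca := ha1.continuous
  have cq := hq1.continuous
  have cg : Continuous g := continuous_iff_continuousAt.2 fun x => (hg x).continuousAt
  have cα : Continuous α := continuous_iff_continuousAt.2 fun x => (hα x).continuousAt
  let φ : ℝ → ℝ := fun x => Real.sinh (g x)
  let φ1 : ℝ → ℝ := fun x => g1 x * Real.cosh (g x)
  let ψ : ℝ → ℝ := fun x => (α x - c) * Real.cosh (g x)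
  let ψ1 : ℝ → ℝ := fun x => α1 x * Real.cosh (g x) + (α x - c) * (g1 x * Real.sinh (g x))
  let S : ℝ → ℝ := fun x => Real.cosh (g x) + η * a x
  let S1 : ℝ → ℝ := fun x => g1 x * Real.sinh (g x) + η * deriv a x
  let P : ℝ → ℝ := fun x => q x - 2 * c * a x + (c ^ 2 - b ^ 2)
  let P1 : ℝ → ℝ := fun x => deriv q x - 2 * c * deriv a x
  have dsinh : ∀ x, HasDerivAt (fun x => Real.sinh (g x)) (g1 x * Real.cosh (g x)) x := fun x =>
    (hg x).sinh.congr_deriv (mul_comm _ _)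
  have dcosh : ∀ x, HasDerivAt (fun x => Real.cosh (g x)) (g1 x * Real.sinh (g x)) x := fun x =>
    (hg x).cosh.congr_deriv (mul_comm _ _)
  have dψ : ∀ x, HasDerivAt ψ (ψ1 x) x := fun x => ((hα x).sub_const c).mul (dcosh x)
  have dS : ∀ x, HasDerivAt S (S1 x) x := fun x => (dcosh x).add ((da x).const_mul η)
  have dP : ∀ x, HasDerivAt P (P1 x) x := fun x =>
    ((dq x).sub ((da x).const_mul (2 * c))).add_const _
  have hu2c : Continuous (deriv (deriv u)) := by
    have hu1 : ContDiff ℝ (⊤ : ℕ∞) (deriv u) := by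
      have : ContDiff ℝ ((⊤ : ℕ∞) + 1) u := by simpa using hu
      exact (contDiff_succ_iff_deriv.1 this).2.2
    exact hu1.continuous_deriv (by simp)
  have cu := hu.continuous
  obtain ⟨T, hT⟩ : ∃ T, T = Tq a q (-(c : ℂ) + Complex.I * (b : ℂ)) u := ⟨_, rfl⟩
  rw [← hT]
  have hTre : ∀ x, (T x).re = -(deriv (deriv u) x).re + q x * (u x).re
      + (-2 * c * a x + c ^ 2 - b ^ 2) * (u x).re - 2 * b * (a x - c) * (u x).im := by
    intro x
    rw [hT]; simp [Tq, pow_two]; ring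
  have hTim : ∀ x, (T x).im = -(deriv (deriv u) x).im + q x * (u x).im
      + (-2 * c * a x + c ^ 2 - b ^ 2) * (u x).im + 2 * b * (a x - c) * (u x).re := by
    intro x
    rw [hT]; simp [Tq, pow_two]; ring
  have cT : Continuous T := by rw [hT]; unfold Tq; fun_prop
  have cH : Continuous (fun x => -deriv (deriv u) x + (q x : ℂ) * u x) := by fun_prop
  have hz0 : ∀ x, x ∉ tsupport u → u x = 0 := fun x hx => image_eq_zero_of_notMem_tsupport hx
  have hz2 : ∀ x, x ∉ tsupport u → deriv (deriv u) x = 0 := fun x hx =>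
    Function.notMem_support.1 fun h =>
      hx ((closure_minimal support_deriv_subset (isClosed_tsupport u)) (support_deriv_subset h))
  have sT : HasCompactSupport T := by
    apply HasCompactSupport.intro hs
    intro x hx
    rw [hT]; simp [Tq, hz0 x hx, hz2 x hx]
  have sH : HasCompactSupport (fun x => -deriv (deriv u) x + (q x : ℂ) * u x) := by
    apply HasCompactSupport.intro hs
    intro x hx
    simp [hz0 x hx, hz2 x hx]
  have nsq : ∀ z : ℂ, ‖z‖ ^ 2 = z.re ^ 2 + z.im ^ 2 := fun z => by
    rw [Complex.sq_norm, Complex.normSq_apply]; ring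
  obtain ⟨G, hG⟩ : ∃ G : ℝ → ℝ, (∀ x v w v1 w1 v2 w2 : ℝ, v = (u x).re → w = (u x).im →
      v1 = (deriv u x).re → w1 = (deriv u x).im → v2 = (deriv (deriv u) x).re →
      w2 = (deriv (deriv u) x).im →
      G x = φ1 x * (v1 ^ 2 + w1 ^ 2) + φ x * (2 * v1 * v2 + 2 * w1 * w2)
        - (φ1 x * P x + φ x * P1 x) * (v ^ 2 + w ^ 2) - φ x * P x * (2 * v * v1 + 2 * w * w1)
        + 2 * ψ1 x * (v1 * v + w1 * w) + 2 * ψ x * (v2 * v + w2 * w + v1 ^ 2 + w1 ^ 2)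
        + 2 * b * (S1 x * (w1 * v - v1 * w) + S x * (w2 * v - v2 * w))) := by
    refine ⟨fun x => φ1 x * ((deriv u x).re ^ 2 + (deriv u x).im ^ 2)
      + φ x * (2 * (deriv u x).re * (deriv (deriv u) x).re
        + 2 * (deriv u x).im * (deriv (deriv u) x).im)
      - (φ1 x * P x + φ x * P1 x) * ((u x).re ^ 2 + (u x).im ^ 2)
      - φ x * P x * (2 * (u x).re * (deriv u x).re + 2 * (u x).im * (deriv u x).im)
      + 2 * ψ1 x * ((deriv u x).re * (u x).re + (deriv u x).im * (u x).im)
      + 2 * ψ x * ((deriv (deriv u) x).re * (u x).re + (deriv (deriv u) x).im * (u x).im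
        + (deriv u x).re ^ 2 + (deriv u x).im ^ 2)
      + 2 * b * (S1 x * ((deriv u x).im * (u x).re - (deriv u x).re * (u x).im)
        + S x * ((deriv (deriv u) x).im * (u x).re - (deriv (deriv u) x).re * (u x).im)), ?_⟩
    intro x v w v1 w1 v2 w2 r1 r2 r3 r4 r5 r6
    rw [r1, r2, r3, r4, r5, r6]
  obtain ⟨iG, hG0⟩ := flux_integral u hu hs φ φ1 ψ ψ1 S S1 P P1 b dsinh dψ dS dP
      (by fun_prop) (by fun_prop) (by fun_prop) (by fun_prop) G hG
  have hpoint : ∀ x, ‖-deriv (deriv u) x + (q x : ℂ) * u x‖ ^ 2 ≤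
      (2 + 32 * M / κ) * b ^ 2 * ‖T x‖ ^ 2 + 32 * b ^ 2 / κ * G x := by
    intro x
    obtain ⟨k1, k2, k3, k4, k5, k6⟩ := hcoef c hc hcc (a x) (q x) (deriv a x) (deriv q x) (g x)
      (g1 x) (α x) (α1 x) (h.nonneg_a x) (h.nonneg_q x) (bg x) (bg1 x) (bα x) (bα1 x) (hcase x)
    rw [← hδdef] at k1
    have m1 := hpt b hbb₁ c hc hcc (a x) (deriv a x) _ _ _ _ _ _ _ _ (u x).re (u x).im
      (deriv u x).re (deriv u x).im (T x).re (T x).im (h.nonneg_a x) (hda x) k1 k2 k3 k4 k5 k6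
    have m2 := H_pointwise (a x) (q x) c b (u x).re (u x).im (deriv (deriv u) x).re
      (deriv (deriv u) x).im (T x).re (T x).im (by linarith) hc (by linarith) (hTre x) (hTim x)
    have m3 := hG x _ _ _ _ _ _ rfl rfl rfl rfl rfl rfl
    have hT1 := hTre x
    have hT2 := hTim x
    simp only [φ, φ1, ψ, ψ1, S, S1, P, P1] at m3
    rw [nsq, nsq]
    have eH1 : (-deriv (deriv u) x + (q x : ℂ) * u x).re
      = -(deriv (deriv u) x).re + q x * (u x).re := by simp
    have eH2 : (-deriv (deriv u) x + (q x : ℂ) * u x).im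
      = -(deriv (deriv u) x).im + q x * (u x).im := by simp
    rw [eH1, eH2]
    refine m2.trans ?_
    have hb2 : 1 ≤ b ^ 2 := by rw [← sq_abs]; exact one_le_pow₀ (by linarith)
    have ha0 := h.nonneg_a x
    generalize (T x).re = f1 at *
    generalize (T x).im = f2 at *
    generalize (deriv (deriv u) x).re = v2 at *
    generalize (deriv (deriv u) x).im = w2 at *
    generalize (deriv u x).re = v1 at *
    generalize (deriv u x).im = w1 at *
    generalize (u x).re = v at *
    generalize (u x).im = w at *
    have m4 : δ / 4 * (v1 ^ 2 + w1 ^ 2 + b ^ 2 * (v ^ 2 + w ^ 2))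
        + η / 4 * (a x ^ 2 * (b ^ 2 * (v ^ 2 + w ^ 2))) - M * (f1 ^ 2 + f2 ^ 2) ≤ G x := by
      refine m1.trans (le_of_eq ?_)
      rw [m3, hT1, hT2]
      ring
    have m5 : κ * ((1 + a x ^ 2) * (b ^ 2 * (v ^ 2 + w ^ 2))) ≤ M * (f1 ^ 2 + f2 ^ 2) + G x := by
      have z1 : κ * (b ^ 2 * (v ^ 2 + w ^ 2)) ≤ δ / 4 * (b ^ 2 * (v ^ 2 + w ^ 2)) := by gcongr
      have z2 : κ * (a x ^ 2 * (b ^ 2 * (v ^ 2 + w ^ 2))) ≤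
        η / 4 * (a x ^ 2 * (b ^ 2 * (v ^ 2 + w ^ 2))) := by gcongr
      have z3 : 0 ≤ δ / 4 * (v1 ^ 2 + w1 ^ 2) := by positivity
      linarith
    have m6 : (1 + a x ^ 2) * (b ^ 2 * (v ^ 2 + w ^ 2)) ≤ (M * (f1 ^ 2 + f2 ^ 2) + G x) / κ := by
      rw [le_div_iff₀ hκ]; linarith
    have m7 := mul_le_mul_of_nonneg_left m6 (show 0 ≤ 32 * b ^ 2 by positivity)
    have m8 := mul_le_mul_of_nonneg_right hb2 (show 0 ≤ 2 * (f1 ^ 2 + f2 ^ 2) by positivity)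
    have m9 : (2 + 32 * M / κ) * b ^ 2 * (f1 ^ 2 + f2 ^ 2) + 32 * b ^ 2 / κ * G x
      = b ^ 2 * (2 * (f1 ^ 2 + f2 ^ 2)) + 32 * b ^ 2 * ((M * (f1 ^ 2 + f2 ^ 2) + G x) / κ) := by
      ring
    rw [m9]
    linarith
  apply eLpNorm_le_of_sq _ _ cT cH sT sH _ (by positivity)
  have iT : Integrable (fun x => ‖T x‖ ^ 2) :=
    (cT.memLp_of_hasCompactSupport (p := 2) sT).integrable_norm_pow (by norm_num)
  have iH : Integrable (fun x => ‖-deriv (deriv u) x + (q x : ℂ) * u x‖ ^ 2) :=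
    (cH.memLp_of_hasCompactSupport (p := 2) sH).integrable_norm_pow (by norm_num)
  have := integral_mono iH ((iT.const_mul _).add (iG.const_mul _)) hpoint
  refine this.trans (le_of_eq ?_)
  simp only [Pi.add_apply]
  rw [integral_add (iT.const_mul _) (iG.const_mul _), integral_const_mul, integral_const_mul, hG0,
    mul_pow, Real.sq_sqrt (by positivity), sq_abs]
  ring
end
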